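/- Let G be a finite nonsolvable group with Noether index n(G). Then n(G) > 2.7, and G has a characteristic cyclic subgroup of index at most n(G)^{100 + 10 · log₂ log₂ n(G)}. -/

import Mathlib

/-!  Definition of the Noether number `β(G)` of a group `G`, over the field `ℂ`
(of characteristic 0).  A finite-dimensional `ℂG`-module is (up to isomorphism)
given by a representation `ρ : Representation ℂ G (Fin n → ℂ)`; the algebra of
polynomial invariants is realised inside `MvPolynomial (Fin n) ℂ` as the
common equalizer of the substitution maps induced by the group elements. -/

/-- The algebra endomorphism of the polynomial ring induced by the linear action of
`g : G` on the underlying space (substitution of the variables by linear forms). -/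
noncomputable def Representation.polySubst {G : Type*} [Group G] {n : ℕ}
    (ρ : Representation ℂ G (Fin n → ℂ)) (g : G) :
    MvPolynomial (Fin n) ℂ →ₐ[ℂ] MvPolynomial (Fin n) ℂ :=
  MvPolynomial.aeval fun i =>
    ∑ j, MvPolynomial.C (LinearMap.toMatrix' (ρ g) i j) * MvPolynomial.X j

/-- The subalgebra of `G`-invariant polynomials. -/
noncomputable def Representation.invariantAlgebra {G : Type*} [Group G] {n : ℕ}
    (ρ : Representation ℂ G (Fin n → ℂ)) : Subalgebra ℂ (MvPolynomial (Fin n) ℂ) :=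
  ⨅ g : G, AlgHom.equalizer (ρ.polySubst g) (AlgHom.id ℂ (MvPolynomial (Fin n) ℂ))

/-- The invariant algebra is generated by its elements of (total) degree at most `d`. -/
def Representation.InvariantsGeneratedInDegree {G : Type*} [Group G] {n : ℕ}
    (ρ : Representation ℂ G (Fin n → ℂ)) (d : ℕ) : Prop :=
  Algebra.adjoin ℂ {f : MvPolynomial (Fin n) ℂ | f ∈ ρ.invariantAlgebra ∧ f.totalDegree ≤ d}
    = ρ.invariantAlgebra

/-- The Noether number `β(G)`: the smallest degree bound `d` such that for every
finite-dimensional `ℂG`-module the algebra of polynomial invariants is generated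
by its elements of degree at most `d`.  (Equivalently, the maximum over all
finite-dimensional modules `V` of the minimal generating degree `β(G,V)`.) -/
noncomputable def noetherNumber (G : Type*) [Group G] : ℕ :=
  sInf {d : ℕ | ∀ (n : ℕ) (ρ : Representation ℂ G (Fin n → ℂ)),
    ρ.InvariantsGeneratedInDegree d}

/-- The Noether index `n(G) = |G| / β(G)`, as a real number. -/
noncomputable def noetherIndex (G : Type*) [Group G] : ℝ :=
  (Nat.card G : ℝ) / (noetherNumber G : ℝ)

namespace NoetherIndex

open MvPolynomial
open scoped Pointwise

/-- The ideal generated by the invariants lying in `J`. -/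
def invIdeal {T A : Type} [Group T] [CommRing A] [Algebra ℂ A] (φ : T →* (A →ₐ[ℂ] A))
    (J : Ideal A) : Ideal A :=
  Ideal.span {a | a ∈ J ∧ ∀ t, φ t a = a}

/-- For every action of `T` on a commutative algebra, every product of `d` elements of a stable
ideal lies in the `k`-th power of the ideal generated by the invariants in that ideal. -/
def Absorbs (T : Type) [Group T] (d k : ℕ) : Prop :=
  ∀ (A : Type) [CommRing A] [Algebra ℂ A] (φ : T →* (A →ₐ[ℂ] A)) (J : Ideal A),
    (∀ t, ∀ a ∈ J, φ t a ∈ J) → ∀ s : Multiset A, s.card = d → (∀ a ∈ s, a ∈ J) →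
      s.prod ∈ invIdeal φ J ^ k

theorem multiset_exists_le_card_eq {α : Type*} {s : Multiset α} {d : ℕ} (h : d ≤ s.card) :
    ∃ t ≤ s, t.card = d := by
  have h1 : 0 < (Multiset.powersetCard d s).card := by
    rw [Multiset.card_powersetCard]; exact Nat.choose_pos h
  obtain ⟨t, ht⟩ := Multiset.card_pos_iff_exists_mem.1 h1
  exact ⟨t, Multiset.mem_powersetCard.1 ht⟩

theorem ideal_span_pow {A : Type*} [CommRing A] (s : Set A) (n : ℕ) :
    Ideal.span s ^ n = Ideal.span (s ^ n) := by
  induction n with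
  | zero => simp [Ideal.one_eq_top, ← Set.singleton_one]
  | succ n ih => rw [pow_succ, pow_succ, ih, Ideal.span_mul_span']

theorem Absorbs.mul {T : Type} [Group T] {d : ℕ} (h : Absorbs T d 1) (m : ℕ) :
    Absorbs T (d * m) m := by
  intro A _ _ φ J hJ s hs hsJ
  induction m generalizing s with
  | zero => simp
  | succ m ih =>
    obtain ⟨t, ht, htc⟩ := multiset_exists_le_card_eq (s := s) (d := d) (by rw [hs]; nlinarith)
    obtain ⟨u, rfl⟩ := Multiset.le_iff_exists_add.1 ht
    rw [Multiset.prod_add, pow_succ']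
    have h1 := h A φ J hJ t htc (fun a ha => hsJ a (by simp [ha]))
    rw [pow_one] at h1
    refine Ideal.mul_mem_mul h1 (ih u ?_ (fun a ha => hsJ a (by simp [ha])))
    have : Multiset.card t + Multiset.card u = d * (m + 1) := by simpa using hs
    rw [htc] at this; nlinarith

theorem mem_ideal_of_smul_complex {A : Type} [CommRing A] [Algebra ℂ A] {I : Ideal A} {a : A}
    {c : ℂ} (hc : c ≠ 0) (h : c • a ∈ I) : a ∈ I := by
  have := I.mul_mem_left (algebraMap ℂ A c⁻¹) h
  rwa [← Algebra.smul_def, smul_smul, inv_mul_cancel₀ hc, one_smul] at this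

/-- A product of `[G : H]` invariants of `H` lies in the Hilbert ideal of `G`. -/
theorem prod_mem_invIdeal_of_index {G A : Type} [Group G] [Finite G] [CommRing A] [Algebra ℂ A]
    (φ : G →* (A →ₐ[ℂ] A)) (J : Ideal A) (hJ : ∀ t, ∀ a ∈ J, φ t a ∈ J) (H : Subgroup G)
    (f : G ⧸ H → A) (hf : ∀ c, f c ∈ J) (hfH : ∀ c, ∀ h ∈ H, φ h (f c) = f c)
    [Fintype (G ⧸ H)] :
    ∏ c, f c ∈ invIdeal φ J := by
  classical
  have := Fintype.ofFinite G
  have hmul : ∀ g h a, φ (g * h) a = φ g (φ h a) := fun g h a => by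
    rw [map_mul]; rfl
  set F : G ⧸ H → A := fun c => φ c.out (f c) with hF
  have hFv : ∀ h : G, ∏ c, (φ h (F c) - f c) = 0 := by
    intro h
    apply Finset.prod_eq_zero (Finset.mem_univ ((h⁻¹ : G) : G ⧸ H))
    obtain ⟨k, hk⟩ := QuotientGroup.mk_out_eq_mul H (h⁻¹)
    rw [hF]; dsimp only
    rw [hk, ← hmul, mul_inv_cancel_left, hfH _ _ k.2, sub_self]
  have hsum : ∑ h : G, ∏ c, (φ h (F c) - f c) = 0 := Finset.sum_eq_zero fun h _ => hFv h
  have hexp : ∀ h : G, ∏ c, (φ h (F c) - f c) =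
      ∑ S ∈ (Finset.univ : Finset (G ⧸ H)).powerset,
        φ h (∏ c ∈ S, F c) * ∏ c ∈ Finset.univ \ S, (- f c) := by
    intro h
    simp_rw [sub_eq_add_neg, Finset.prod_add, map_prod]
  simp_rw [hexp] at hsum
  rw [Finset.sum_comm, ← Finset.sum_erase_add _ _ (Finset.empty_mem_powerset _)] at hsum
  have hin : (∑ S ∈ (Finset.univ : Finset (G ⧸ H)).powerset.erase ∅, ∑ h : G,
        φ h (∏ c ∈ S, F c) * ∏ c ∈ Finset.univ \ S, (- f c)) ∈ invIdeal φ J := by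
    refine Ideal.sum_mem _ fun S hS => ?_
    rw [← Finset.sum_mul]
    refine Ideal.mul_mem_right _ _ (Ideal.subset_span ⟨?_, ?_⟩)
    · refine Ideal.sum_mem _ fun h _ => hJ _ _ ?_
      obtain ⟨c, hc⟩ := Finset.nonempty_iff_ne_empty.2 (Finset.ne_of_mem_erase hS)
      rw [← Finset.mul_prod_erase _ _ hc]
      exact Ideal.mul_mem_right _ _ (hJ _ _ (hf c))
    · intro t
      rw [map_sum]
      simp_rw [← hmul]
      exact Fintype.sum_equiv (Equiv.mulLeft t) _ _ (fun _ => rfl)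
  rw [add_eq_zero_iff_neg_eq] at hsum
  have h2 := hsum ▸ (invIdeal φ J).neg_mem hin
  simp only [Finset.prod_empty, map_one, one_mul, Finset.sdiff_empty, Finset.sum_const,
    Finset.card_univ] at h2
  rw [Finset.prod_neg] at h2
  rw [← Nat.cast_smul_eq_nsmul ℂ] at h2
  have h3 := mem_ideal_of_smul_complex (by exact_mod_cast Fintype.card_ne_zero) h2
  have h4 := Ideal.mul_mem_left _ ((-1) ^ (Finset.univ : Finset (G ⧸ H)).card) h3
  rwa [← mul_assoc, ← mul_pow, neg_mul_neg, one_mul, one_pow, one_mul] at h4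

theorem Absorbs.of_subgroup {G : Type} [Group G] [Finite G] (H : Subgroup G) {d : ℕ}
    (h : Absorbs H d H.index) : Absorbs G d 1 := by
  classical
  intro A _ _ φ J hJ s hs hsJ
  have := Fintype.ofFinite (G ⧸ H)
  have h1 := h A (φ.comp H.subtype) J (fun t a ha => hJ t a ha) s hs hsJ
  rw [pow_one]
  refine (?_ : invIdeal (φ.comp H.subtype) J ^ H.index ≤ invIdeal φ J) h1
  rw [invIdeal, ideal_span_pow, Ideal.span_le]
  intro a ha
  rw [Set.mem_pow] at ha
  obtain ⟨f, rfl⟩ := ha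
  have hc : Fintype.card (G ⧸ H) = H.index := by
    rw [Subgroup.index, Nat.card_eq_fintype_card]
  let e := (Fintype.equivFin (G ⧸ H)).trans (finCongr hc)
  have := prod_mem_invIdeal_of_index φ J hJ H (fun c => (f (e c) : A)) (fun c => (f (e c)).2.1)
    (fun c h hh => (f (e c)).2.2 ⟨h, hh⟩)
  rw [List.prod_ofFn]
  rwa [Fintype.prod_equiv e (fun c => (f (e c) : A)) (fun i => (f i : A)) (fun _ => rfl)] at this

theorem Absorbs.card (G : Type) [Group G] [Finite G] : Absorbs G (Nat.card G) 1 := by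
  apply Absorbs.of_subgroup (⊥ : Subgroup G)
  rw [Subgroup.index_bot]
  intro A _ _ φ J hJ s hs hsJ
  have : J ≤ invIdeal φ J := fun a ha => Ideal.subset_span ⟨ha, fun t => by
    rw [Subsingleton.elim t 1, map_one]; rfl⟩
  rw [← hs]
  clear hs
  induction s using Multiset.induction with
  | empty => simp
  | cons a s ih =>
    rw [Multiset.prod_cons, Multiset.card_cons, pow_succ']
    exact Ideal.mul_mem_mul (this (hsJ a (by simp))) (ih fun b hb => hsJ b (by simp [hb]))

end NoetherIndex

namespace NoetherIndex

open MvPolynomial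
open scoped Pointwise

section Quotient

variable {T A : Type} [Group T] [CommRing A] [Algebra ℂ A]

theorem act_mul (φ : T →* (A →ₐ[ℂ] A)) (g h : T) (a : A) : φ (g * h) a = φ g (φ h a) := by
  rw [map_mul]; rfl

theorem act_one (φ : T →* (A →ₐ[ℂ] A)) (a : A) : φ 1 a = a := by
  rw [map_one]; rfl

/-- The subalgebra of `K`-invariants. -/
def fixedAlg (φ : T →* (A →ₐ[ℂ] A)) (K : Subgroup T) : Subalgebra ℂ A where
  carrier := {a | ∀ k ∈ K, φ k a = a}
  mul_mem' ha hb k hk := by rw [map_mul, ha k hk, hb k hk]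
  add_mem' ha hb k hk := by rw [map_add, ha k hk, hb k hk]
  algebraMap_mem' r k _ := by rw [AlgHom.commutes]

theorem act_mem_fixedAlg (φ : T →* (A →ₐ[ℂ] A)) (K : Subgroup T) [hK : K.Normal] (t : T) {a : A}
    (ha : a ∈ fixedAlg φ K) : φ t a ∈ fixedAlg φ K := by
  intro k hk
  have h1 := ha (t⁻¹ * k * t) (by simpa using hK.conj_mem k hk t⁻¹)
  rw [← act_mul, show k * t = t * (t⁻¹ * k * t) by group, act_mul, h1]

/-- The action of `T` on the `K`-invariants. -/
def fixedAct (φ : T →* (A →ₐ[ℂ] A)) (K : Subgroup T) [K.Normal] :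
    T →* (fixedAlg φ K →ₐ[ℂ] fixedAlg φ K) where
  toFun t := ((φ t).comp (fixedAlg φ K).val).codRestrict (fixedAlg φ K)
    fun a => act_mem_fixedAlg φ K t a.2
  map_one' := by
    ext a
    exact act_one φ a.1
  map_mul' s t := by
    ext a
    exact act_mul φ s t a.1

/-- The action of `T ⧸ K` on the `K`-invariants. -/
def quotAct (φ : T →* (A →ₐ[ℂ] A)) (K : Subgroup T) [K.Normal] :
    (T ⧸ K) →* (fixedAlg φ K →ₐ[ℂ] fixedAlg φ K) :=
  QuotientGroup.lift K (fixedAct φ K) fun k hk => by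
    ext a
    exact a.2 k hk

theorem invIdeal_quot_le (φ : T →* (A →ₐ[ℂ] A)) (K : Subgroup T) [K.Normal] (J : Ideal A) (k : ℕ) :
    (invIdeal (quotAct φ K) (J.comap (fixedAlg φ K).val) ^ k).map (fixedAlg φ K).val ≤
      invIdeal φ J ^ k := by
  rw [Ideal.map_pow]
  refine Ideal.pow_right_mono ?_ k
  rw [invIdeal, Ideal.map_span, Ideal.span_le]
  rintro _ ⟨a, ⟨ha, hat⟩, rfl⟩
  exact Ideal.subset_span ⟨ha, fun t => congrArg Subtype.val (hat (t : T ⧸ K))⟩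

theorem exists_multiset_split {α : Type*} (q d : ℕ) (s : Multiset α) (hs : s.card = q * d) :
    ∃ f : Fin d → Multiset α, (∀ i, (f i).card = q) ∧ ∑ i, f i = s := by
  induction d generalizing s with
  | zero => exact ⟨fun i => i.elim0, fun i => i.elim0, by simpa using (by simpa using hs : s = 0).symm⟩
  | succ d ih =>
    obtain ⟨t, ht, htc⟩ := multiset_exists_le_card_eq (s := s) (d := q) (by rw [hs]; nlinarith)
    obtain ⟨u, rfl⟩ := Multiset.le_iff_exists_add.1 ht
    obtain ⟨f, hf, hfu⟩ := ih u (by rw [Multiset.card_add, htc] at hs; linarith)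
    refine ⟨Fin.cons t f, fun i => ?_, by rw [Fin.sum_univ_succ]; simp [hfu]⟩
    refine Fin.cases ?_ (fun i => ?_) i
    · simpa using htc
    · simpa using hf i

theorem Absorbs.of_quotient [Finite T] (K : Subgroup T) [K.Normal] {d k : ℕ}
    (h : Absorbs (T ⧸ K) d k) : Absorbs T (Nat.card K * d) k := by
  intro A _ _ φ J hJ s hs hsJ
  obtain ⟨f, hf, rfl⟩ := exists_multiset_split _ _ _ hs
  have h1 : ∀ i, (f i).prod ∈ invIdeal (φ.comp K.subtype) J := fun i => by
    have := Absorbs.card K A (φ.comp K.subtype) J (fun t a ha => hJ t a ha) (f i) (hf i)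
      (fun a ha => hsJ a (Multiset.mem_sum.2 ⟨i, Finset.mem_univ _, ha⟩))
    rwa [pow_one] at this
  rw [Multiset.prod_sum]
  have h2 : ∏ i, (f i).prod ∈ invIdeal (φ.comp K.subtype) J ^ d := by
    have := Ideal.prod_mem_prod (s := Finset.univ) (I := fun _ : Fin d =>
      invIdeal (φ.comp K.subtype) J) (x := fun i => (f i).prod) (fun i _ => h1 i)
    simpa using this
  refine (?_ : invIdeal (φ.comp K.subtype) J ^ d ≤ invIdeal φ J ^ k) h2
  rw [invIdeal, ideal_span_pow, Ideal.span_le]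
  intro a ha
  rw [Set.mem_pow] at ha
  obtain ⟨x, rfl⟩ := ha
  have hx : ∀ i, (x i : A) ∈ fixedAlg φ K := fun i k hk => (x i).2.2 ⟨k, hk⟩
  have h3 := h (fixedAlg φ K) (quotAct φ K) (J.comap (fixedAlg φ K).val)
    (fun t a ha => by
      induction t using QuotientGroup.induction_on with
      | H t => exact hJ t _ ha)
    (Multiset.ofList (List.ofFn fun i => ⟨x i, hx i⟩)) (by simp)
    (fun a ha => by
      simp only [Multiset.mem_coe, List.mem_ofFn] at ha
      obtain ⟨i, rfl⟩ := ha
      exact (x i).2.1)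
  have h4 := invIdeal_quot_le φ K J k (Ideal.mem_map_of_mem _ h3)
  convert h4 using 1
  simp [List.prod_ofFn]

end Quotient

end NoetherIndex

namespace NoetherIndex

open MvPolynomial
open scoped Pointwise

section Hilbert

variable {σ : Type} {G : Type} [Group G]

/-- An action on a polynomial ring which preserves the grading. -/
def GradedAct (φ : G →* (MvPolynomial σ ℂ →ₐ[ℂ] MvPolynomial σ ℂ)) : Prop :=
  ∀ g d f, f.IsHomogeneous d → (φ g f).IsHomogeneous d

/-- The degree `D` part of the Hilbert ideal. -/
noncomputable def hilbSpan (φ : G →* (MvPolynomial σ ℂ →ₐ[ℂ] MvPolynomial σ ℂ)) (D : ℕ) :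
    Submodule ℂ (MvPolynomial σ ℂ) :=
  Submodule.span ℂ {f | ∃ (i j : ℕ) (m h : MvPolynomial σ ℂ), i + j = D ∧ 1 ≤ j ∧
    m.IsHomogeneous i ∧ h.IsHomogeneous j ∧ (∀ g, φ g h = h) ∧ f = m * h}

variable {φ : G →* (MvPolynomial σ ℂ →ₐ[ℂ] MvPolynomial σ ℂ)}

theorem GradedAct.homogeneousComponent (hφ : GradedAct φ) (g : G) (f : MvPolynomial σ ℂ) (d : ℕ) :
    φ g (homogeneousComponent d f) = homogeneousComponent d (φ g f) := by
  conv_rhs => rw [← sum_homogeneousComponent f, map_sum, map_sum]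
  rw [Finset.sum_congr rfl (fun i _ => homogeneousComponent_of_mem (m := d) (n := i)
    (hφ g i _ (homogeneousComponent_isHomogeneous i f)))]
  rw [Finset.sum_ite_eq]
  split_ifs with h
  · rfl
  · rw [homogeneousComponent_eq_zero, map_zero]
    simpa using h

/-- The averaging operator. -/
noncomputable def reynolds [Fintype G] (φ : G →* (MvPolynomial σ ℂ →ₐ[ℂ] MvPolynomial σ ℂ)) :
    MvPolynomial σ ℂ →ₗ[ℂ] MvPolynomial σ ℂ :=
  (Fintype.card G : ℂ)⁻¹ • ∑ g, (φ g).toLinearMap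

theorem reynolds_apply [Fintype G] (f : MvPolynomial σ ℂ) :
    reynolds φ f = (Fintype.card G : ℂ)⁻¹ • ∑ g, φ g f := by
  simp [reynolds]

theorem act_sum [Fintype G] (h : G) (f : MvPolynomial σ ℂ) :
    φ h (∑ g, φ g f) = ∑ g, φ g f := by
  rw [map_sum]
  simp_rw [← act_mul]
  exact Fintype.sum_equiv (Equiv.mulLeft h) _ _ (fun _ => rfl)

theorem act_reynolds [Fintype G] (h : G) (f : MvPolynomial σ ℂ) :
    φ h (reynolds φ f) = reynolds φ f := by
  rw [reynolds_apply, map_smul, act_sum]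

theorem reynolds_mul [Fintype G] (f h : MvPolynomial σ ℂ) (hh : ∀ g, φ g h = h) :
    reynolds φ (f * h) = reynolds φ f * h := by
  simp_rw [reynolds_apply, map_mul, hh, ← Finset.sum_mul, smul_mul_assoc]

theorem reynolds_of_inv [Fintype G] (h : MvPolynomial σ ℂ) (hh : ∀ g, φ g h = h) :
    reynolds φ h = h := by
  rw [reynolds_apply]
  simp_rw [hh]
  rw [Finset.sum_const, Finset.card_univ, ← Nat.cast_smul_eq_nsmul ℂ, smul_smul,
    inv_mul_cancel₀ (by exact_mod_cast Fintype.card_ne_zero), one_smul]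

theorem GradedAct.sum_isHomogeneous [Fintype G] (hφ : GradedAct φ) {f : MvPolynomial σ ℂ} {d : ℕ}
    (hf : f.IsHomogeneous d) : (∑ g, φ g f).IsHomogeneous d :=
  IsHomogeneous.sum _ _ _ fun g _ => hφ g d f hf

theorem GradedAct.reynolds_isHomogeneous [Fintype G] (hφ : GradedAct φ) {f : MvPolynomial σ ℂ}
    {d : ℕ} (hf : f.IsHomogeneous d) : (reynolds φ f).IsHomogeneous d := by
  rw [reynolds_apply, ← algebraMap_smul (MvPolynomial σ ℂ), smul_eq_mul]
  simpa using (hφ.sum_isHomogeneous hf).C_mul _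

theorem homogeneous_le_hilbSpan_of_le {d e : ℕ} (hde : d ≤ e)
    (h : homogeneousSubmodule σ ℂ d ≤ hilbSpan φ d) :
    ∀ f : MvPolynomial σ ℂ, f.IsHomogeneous e →
      f ∈ Submodule.span ℂ {f | ∃ (i j : ℕ) (m h : MvPolynomial σ ℂ), i + j = e ∧ 1 ≤ j ∧ j ≤ d ∧
    m.IsHomogeneous i ∧ h.IsHomogeneous j ∧ (∀ g, φ g h = h) ∧ f = m * h} := by
  intro f hf
  have hf' : f ∈ homogeneousSubmodule σ ℂ (e - d) * homogeneousSubmodule σ ℂ d := by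
    rw [← homogeneousSubmodule_one_pow (σ := σ) (R := ℂ) (e - d), ← homogeneousSubmodule_one_pow (σ := σ) (R := ℂ) d,
      ← pow_add, Nat.sub_add_cancel hde, homogeneousSubmodule_one_pow]
    exact hf
  refine Submodule.mul_induction_on hf' (fun m hm n hn => ?_) (fun x y hx hy => add_mem hx hy)
  have hn' := h hn
  have hm' : m.IsHomogeneous (e - d) := hm
  clear hn hf
  induction hn' using Submodule.span_induction with
  | mem x hx =>
    obtain ⟨i, j, a, h, hij, hj, ha, hh, hinv, rfl⟩ := hx
    exact Submodule.subset_span ⟨e - d + i, j, m * a, h, by omega, hj, by omega,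
      hm'.mul ha, hh, hinv, (mul_assoc _ _ _).symm⟩
  | zero => simp
  | add x y _ _ hx hy => rw [mul_add]; exact Submodule.add_mem _ hx hy
  | smul c x _ hx => rw [mul_smul_comm]; exact Submodule.smul_mem _ _ hx

/-- If every form of degree `d` lies in the Hilbert ideal, then the invariants are generated in
degree at most `d`. -/
theorem invariant_mem_adjoin [Fintype G] (hφ : GradedAct φ) {d : ℕ}
    (h : homogeneousSubmodule σ ℂ d ≤ hilbSpan φ d) (e : ℕ) (f : MvPolynomial σ ℂ)
    (hf : f.IsHomogeneous e) (hinv : ∀ g, φ g f = f) :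
    f ∈ Algebra.adjoin ℂ {f : MvPolynomial σ ℂ | (∀ g, φ g f = f) ∧ f.totalDegree ≤ d} := by
  induction e using Nat.strong_induction_on generalizing f with
  | _ e ih =>
  by_cases hde : e ≤ d
  · exact Algebra.subset_adjoin ⟨hinv, hf.totalDegree_le.trans hde⟩
  · have h1 := homogeneous_le_hilbSpan_of_le (by omega) h f hf
    rw [← reynolds_of_inv f hinv]
    clear hf hinv
    induction h1 using Submodule.span_induction with
    | mem x hx =>
      obtain ⟨i, j, a, h, hij, hj, hjd, ha, hh, hhinv, rfl⟩ := hx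
      rw [reynolds_mul _ _ hhinv]
      exact mul_mem (ih i (by omega) _ (hφ.reynolds_isHomogeneous ha) (fun g => act_reynolds _ _))
        (Algebra.subset_adjoin ⟨hhinv, hh.totalDegree_le.trans hjd⟩)
    | zero => simp
    | add x y _ _ hx hy => rw [map_add]; exact add_mem hx hy
    | smul c x _ hx => rw [map_smul]; exact Subalgebra.smul_mem _ hx _

theorem invariant_mem_adjoin' [Fintype G] (hφ : GradedAct φ) {d : ℕ}
    (h : homogeneousSubmodule σ ℂ d ≤ hilbSpan φ d) (f : MvPolynomial σ ℂ)
    (hinv : ∀ g, φ g f = f) :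
    f ∈ Algebra.adjoin ℂ {f : MvPolynomial σ ℂ | (∀ g, φ g f = f) ∧ f.totalDegree ≤ d} := by
  rw [← sum_homogeneousComponent f]
  refine sum_mem fun i _ => invariant_mem_adjoin hφ h i _ (homogeneousComponent_isHomogeneous i f)
    fun g => ?_
  rw [hφ.homogeneousComponent, hinv]

theorem homogeneousComponent_mul_of_homogeneous {a h : MvPolynomial σ ℂ} {i j D : ℕ}
    (ha : a.IsHomogeneous i) (hh : h.IsHomogeneous j) :
    homogeneousComponent D (a * h) = if D = i + j then a * h else 0 :=
  homogeneousComponent_of_mem (ha.mul hh)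

theorem homogeneousComponent_mem_hilbSpan (hφ : GradedAct φ) {f : MvPolynomial σ ℂ}
    (hf : f ∈ Ideal.span {h : MvPolynomial σ ℂ | constantCoeff h = 0 ∧ ∀ g, φ g h = h}) (D : ℕ) :
    homogeneousComponent D f ∈ hilbSpan φ D := by
  suffices h : ∀ a, homogeneousComponent D (a * f) ∈ hilbSpan φ D by simpa using h 1
  induction hf using Submodule.span_induction with
  | mem h hh =>
    intro a
    rw [← sum_homogeneousComponent a, ← sum_homogeneousComponent h, Finset.sum_mul_sum, map_sum]
    refine Submodule.sum_mem _ fun i _ => ?_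
    rw [map_sum]
    refine Submodule.sum_mem _ fun j _ => ?_
    rw [homogeneousComponent_mul_of_homogeneous (homogeneousComponent_isHomogeneous i a)
      (homogeneousComponent_isHomogeneous j h)]
    split_ifs with hD
    · rcases Nat.eq_zero_or_pos j with rfl | hj
      · rw [homogeneousComponent_zero, ← constantCoeff_eq, hh.1]; simp
      · exact Submodule.subset_span ⟨i, j, _, _, hD.symm, hj, homogeneousComponent_isHomogeneous i a,
          homogeneousComponent_isHomogeneous j h, fun g => by
            rw [hφ.homogeneousComponent, hh.2], rfl⟩
    · exact zero_mem _
  | zero => simp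
  | add x y _ _ hx hy =>
    intro a
    rw [mul_add, map_add]; exact Submodule.add_mem _ (hx a) (hy a)
  | smul c x _ hx =>
    intro a
    rw [smul_eq_mul, ← mul_assoc]; exact hx _

theorem homogeneous_le_hilbSpan_of_absorbs (hφ : GradedAct φ) {d : ℕ} (h : Absorbs G d 1) :
    homogeneousSubmodule σ ℂ d ≤ hilbSpan φ d := by
  rw [← homogeneousSubmodule_one_pow, Submodule.pow_eq_span_pow_set, Submodule.span_le]
  intro f hf
  rw [Set.mem_pow] at hf
  obtain ⟨x, rfl⟩ := hf
  have hc : ∀ g f, constantCoeff (φ g f) = constantCoeff f := fun g f => by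
    have := hφ.homogeneousComponent g f 0
    rw [homogeneousComponent_zero, homogeneousComponent_zero, algHom_C] at this
    exact (C_injective _ _ this).symm
  have h1 := h _ φ (RingHom.ker (constantCoeff (σ := σ) (R := ℂ)))
    (fun g f hf => by rw [RingHom.mem_ker] at *; rw [hc, hf])
    (Multiset.ofList (List.ofFn fun i => (x i : MvPolynomial σ ℂ))) (by simp)
    (fun f hf => by
      simp only [Multiset.mem_coe, List.mem_ofFn] at hf
      obtain ⟨i, rfl⟩ := hf
      rw [RingHom.mem_ker, constantCoeff_eq]
      exact IsHomogeneous.coeff_eq_zero (x i).2 (by simp))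
  rw [pow_one, Multiset.prod_coe] at h1
  have h2 := homogeneousComponent_mem_hilbSpan hφ (f := (List.ofFn fun i =>
    (x i : MvPolynomial σ ℂ)).prod) h1 d
  rwa [homogeneousComponent_eq_self] at h2
  rw [List.prod_ofFn]
  have := IsHomogeneous.prod Finset.univ (fun i => (x i : MvPolynomial σ ℂ)) (fun _ => 1)
    (fun i _ => (x i).2)
  simpa using this

end Hilbert

section Noether

variable {G : Type} [Group G] {n : ℕ}

theorem polySubst_mul (ρ : Representation ℂ G (Fin n → ℂ)) (g h : G) :
    ρ.polySubst (g * h) = (ρ.polySubst h).comp (ρ.polySubst g) := by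
  refine MvPolynomial.algHom_ext fun i => ?_
  simp only [Representation.polySubst, AlgHom.comp_apply, aeval_X, map_sum, map_mul,
    Module.End.mul_eq_comp, LinearMap.toMatrix'_comp, Matrix.mul_apply, algHom_C, algebraMap_eq,
    Finset.sum_mul, Finset.mul_sum]
  rw [Finset.sum_comm]
  simp only [mul_assoc]

theorem polySubst_one (ρ : Representation ℂ G (Fin n → ℂ)) :
    ρ.polySubst 1 = AlgHom.id ℂ _ := by
  refine MvPolynomial.algHom_ext fun i => ?_
  simp only [Representation.polySubst, aeval_X, map_one, Module.End.one_eq_id,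
    LinearMap.toMatrix'_id, AlgHom.id_apply]
  rw [Finset.sum_eq_single i (fun j _ hj => by simp [Matrix.one_apply_ne hj.symm]) (by simp)]
  simp

/-- The left action of `G` on polynomials obtained from the substitution maps. -/
noncomputable def polyAct (ρ : Representation ℂ G (Fin n → ℂ)) :
    G →* (MvPolynomial (Fin n) ℂ →ₐ[ℂ] MvPolynomial (Fin n) ℂ) where
  toFun g := ρ.polySubst g⁻¹
  map_one' := by rw [inv_one, polySubst_one]; rfl
  map_mul' g h := by rw [mul_inv_rev, polySubst_mul]; rfl

theorem polyAct_apply (ρ : Representation ℂ G (Fin n → ℂ)) (g : G) :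
    polyAct ρ g = ρ.polySubst g⁻¹ := rfl

theorem polyAct_graded (ρ : Representation ℂ G (Fin n → ℂ)) : GradedAct (polyAct ρ) := by
  intro g d f hf
  have := hf.aeval (n := 1) (fun i =>
    ∑ j, MvPolynomial.C (LinearMap.toMatrix' (ρ g⁻¹) i j) * MvPolynomial.X j)
    (fun i => IsHomogeneous.sum _ _ _ fun j _ => isHomogeneous_C_mul_X _ _)
  rwa [one_mul] at this

theorem mem_invariantAlgebra (ρ : Representation ℂ G (Fin n → ℂ)) (f : MvPolynomial (Fin n) ℂ) :
    f ∈ ρ.invariantAlgebra ↔ ∀ g, polyAct ρ g f = f := by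
  simp only [Representation.invariantAlgebra, Algebra.mem_iInf, AlgHom.mem_equalizer,
    AlgHom.id_apply, polyAct_apply]
  exact ⟨fun h g => h _, fun h g => by simpa using h g⁻¹⟩

theorem generatedInDegree_of_le_hilbSpan [Finite G] (ρ : Representation ℂ G (Fin n → ℂ)) {d : ℕ}
    (h : homogeneousSubmodule (Fin n) ℂ d ≤ hilbSpan (polyAct ρ) d) :
    ρ.InvariantsGeneratedInDegree d := by
  have := Fintype.ofFinite G
  refine le_antisymm (Algebra.adjoin_le fun f hf => hf.1) fun f hf => ?_
  have := invariant_mem_adjoin' (polyAct_graded ρ) h f ((mem_invariantAlgebra ρ f).1 hf)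
  simpa only [mem_invariantAlgebra] using this

theorem noetherNumber_le_of_absorbs [Finite G] {d : ℕ} (h : Absorbs G d 1) :
    noetherNumber G ≤ d :=
  Nat.sInf_le fun _ ρ => generatedInDegree_of_le_hilbSpan ρ
    (homogeneous_le_hilbSpan_of_absorbs (polyAct_graded ρ) h)

theorem exists_not_le_hilbSpan [Finite G] {d : ℕ} (hd : d < noetherNumber G) :
    ∃ (n : ℕ) (ρ : Representation ℂ G (Fin n → ℂ)),
      ¬ homogeneousSubmodule (Fin n) ℂ d ≤ hilbSpan (polyAct ρ) d := by
  by_contra! h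
  exact absurd (Nat.sInf_le (s := {d : ℕ | ∀ (n : ℕ) (ρ : Representation ℂ G (Fin n → ℂ)),
    ρ.InvariantsGeneratedInDegree d}) fun n ρ => generatedInDegree_of_le_hilbSpan ρ (h n ρ))
    (not_le.2 hd)

theorem noetherNumber_pos (G : Type) [Group G] [Finite G] : 0 < noetherNumber G := by
  have hmem : noetherNumber G ∈ {d : ℕ | ∀ (n : ℕ) (ρ : Representation ℂ G (Fin n → ℂ)),
      ρ.InvariantsGeneratedInDegree d} :=
    Nat.sInf_mem ⟨Nat.card G, fun _ ρ => generatedInDegree_of_le_hilbSpan ρ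
      (homogeneous_le_hilbSpan_of_absorbs (polyAct_graded ρ) (Absorbs.card G))⟩
  by_contra h0
  rw [Nat.eq_zero_of_not_pos h0] at hmem
  let ρ : Representation ℂ G (Fin 1 → ℂ) := 1
  have hX : (X 0 : MvPolynomial (Fin 1) ℂ) ∈ ρ.invariantAlgebra := by
    rw [mem_invariantAlgebra]
    intro g
    simp [polyAct_apply, Representation.polySubst, ρ, Module.End.one_eq_id]
  rw [← hmem 1 ρ] at hX
  have hle : Algebra.adjoin ℂ {f : MvPolynomial (Fin 1) ℂ | f ∈ ρ.invariantAlgebra ∧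
      f.totalDegree ≤ 0} ≤ ⊥ := by
    refine Algebra.adjoin_le fun f hf => ?_
    rw [(totalDegree_eq_zero_iff_eq_C).1 (Nat.le_zero.1 hf.2)]
    exact Subalgebra.algebraMap_mem _ _
  obtain ⟨c, hc⟩ := Algebra.mem_bot.1 (hle hX)
  have := congrArg totalDegree hc
  simp at this

end Noether

end NoetherIndex

namespace NoetherIndex

open scoped Pointwise

/-- Every family of at least `η` elements of `M` contains a nonempty subfamily of at most `l`
elements with sum zero. -/
def ShortZeroSum (M : Type) [AddCommMonoid M] (η l : ℕ) : Prop :=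
  ∀ (ι : Type) (S : Finset ι) (w : ι → M), η ≤ S.card →
    ∃ U ⊆ S, U.Nonempty ∧ U.card ≤ l ∧ ∑ i ∈ U, w i = 0

theorem shortZeroSum_of_card_eq {M : Type} [AddCommMonoid M] {η l : ℕ}
    (h : ∀ (ι : Type) (S : Finset ι) (w : ι → M), S.card = η →
      ∃ U ⊆ S, U.Nonempty ∧ U.card ≤ l ∧ ∑ i ∈ U, w i = 0) : ShortZeroSum M η l := by
  intro ι S w hS
  obtain ⟨S', hS', hc⟩ := Finset.exists_subset_card_eq hS
  obtain ⟨U, hU, h1⟩ := h ι S' w hc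
  exact ⟨U, hU.trans hS', h1⟩

/-- Olson's bound for elementary abelian groups. -/
theorem zeroSum_elementary (p : ℕ) [hp : Fact p.Prime] (r : ℕ) :
    ShortZeroSum (Fin r → ZMod p) (r * (p - 1) + 1) (r * (p - 1) + 1) := by
  classical
  refine shortZeroSum_of_card_eq fun ι S w hS => ?_
  let f : Fin r → MvPolynomial S (ZMod p) := fun j =>
    ∑ i : S, MvPolynomial.C (w i j) * MvPolynomial.X i ^ (p - 1)
  have hdeg : ∑ j, (f j).totalDegree < Fintype.card S := by
    have h1 : ∀ j, (f j).totalDegree ≤ p - 1 := fun j =>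
      (MvPolynomial.IsHomogeneous.sum Finset.univ _ (p - 1) fun i _ =>
        MvPolynomial.isHomogeneous_C_mul_X_pow _ _ _).totalDegree_le
    calc _ ≤ ∑ _j : Fin r, (p - 1) := Finset.sum_le_sum fun j _ => h1 j
      _ < _ := by simp [hS]
  have hdvd := char_dvd_card_solutions_of_fintype_sum_lt p hdeg
  rw [Fintype.card_eq_nat_card] at hdvd
  have h0 : ∀ j, MvPolynomial.eval (0 : S → ZMod p) (f j) = 0 := fun j => by
    simp [f, zero_pow (Nat.sub_ne_zero_of_lt hp.out.one_lt)]
  have hlt : 1 < Nat.card {x : S → ZMod p // ∀ j, MvPolynomial.eval x (f j) = 0} := by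
    have hne : Nonempty {x : S → ZMod p // ∀ j, MvPolynomial.eval x (f j) = 0} := ⟨⟨0, h0⟩⟩
    exact hp.out.one_lt.trans_le (Nat.le_of_dvd Nat.card_pos hdvd)
  have := Finite.one_lt_card_iff_nontrivial.1 hlt
  obtain ⟨⟨x, hx⟩, hne⟩ := exists_ne
    (⟨0, h0⟩ : {x : S → ZMod p // ∀ j, MvPolynomial.eval x (f j) = 0})
  have hx0 : x ≠ 0 := fun h => hne (Subtype.ext h)
  obtain ⟨i₀, hi₀⟩ := Function.ne_iff.1 hx0
  refine ⟨(Finset.univ.filter fun i : S => x i ≠ 0).map (Function.Embedding.subtype _), ?_, ?_, ?_, ?_⟩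
  · intro i hi
    simp only [Finset.mem_map, Finset.mem_filter] at hi
    obtain ⟨a, _, rfl⟩ := hi
    exact a.2
  · exact ⟨i₀, by simpa using hi₀⟩
  · rw [Finset.card_map, ← hS]
    exact (Finset.card_filter_le _ _).trans (by simp)
  · rw [Finset.sum_map]
    funext j
    rw [Finset.sum_apply, Finset.sum_filter]
    have := hx j
    simp only [f, map_sum, map_mul, MvPolynomial.eval_C, map_pow, MvPolynomial.eval_X] at this
    refine Eq.trans ?_ this
    refine Finset.sum_congr rfl fun i _ => ?_
    by_cases h : x i = 0
    · simp [h, zero_pow (Nat.sub_ne_zero_of_lt hp.out.one_lt)]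
    · simp [h, ZMod.pow_card_sub_one_eq_one h]

theorem shortZeroSum_three : ShortZeroSum (Fin 2 → ZMod 3) 7 3 := by
  classical
  have : Fact (Nat.Prime 3) := ⟨Nat.prime_three⟩
  refine shortZeroSum_of_card_eq fun ι S w hS => ?_
  obtain ⟨U, hU, hne, -, hsum⟩ := zeroSum_elementary 3 3 ι S
    (fun i => ![w i 0, w i 1, 1]) (by simp [hS])
  have h0 : ∑ i ∈ U, w i = 0 := by
    funext j
    rw [Finset.sum_apply]
    have h1 := congrFun hsum 0
    have h2 := congrFun hsum 1
    fin_cases j <;> simp_all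
  have h3 : 3 ∣ U.card := by
    have h1 := congrFun hsum 2
    rw [← ZMod.natCast_eq_zero_iff]
    simpa using h1
  have hle : U.card ≤ 7 := hS ▸ Finset.card_le_card hU
  have hpos := hne.card_pos
  by_cases h : U.card ≤ 3
  · exact ⟨U, hU, hne, h, h0⟩
  have h6 : U.card = 6 := by omega
  obtain ⟨V, hV, hVc⟩ := Finset.exists_subset_card_eq (show 5 ≤ U.card by omega)
  obtain ⟨W, hW, hWne, hWc, hWs⟩ := zeroSum_elementary 3 2 ι V w (by simp [hVc])
  by_cases h' : W.card ≤ 3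
  · exact ⟨W, hW.trans (hV.trans hU), hWne, h', hWs⟩
  have hWU := hW.trans hV
  have hWle : W.card ≤ 5 := hVc ▸ Finset.card_le_card hW
  refine ⟨U \ W, Finset.sdiff_subset.trans hU, ?_, ?_, ?_⟩
  · rw [← Finset.card_pos, Finset.card_sdiff_of_subset hWU]; omega
  · rw [Finset.card_sdiff_of_subset hWU]; omega
  · have := Finset.sum_sdiff hWU (f := w)
    rw [hWs, h0, add_zero] at this
    exact this

theorem shortZeroSum_two : ShortZeroSum (Fin 3 → ZMod 2) 8 2 := by
  classical
  refine shortZeroSum_of_card_eq fun ι S w hS => ?_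
  by_cases h : ∃ i ∈ S, w i = 0
  · obtain ⟨i, hi, h0⟩ := h
    exact ⟨{i}, by simpa using hi, by simp, by simp, by simpa using h0⟩
  push Not at h
  obtain ⟨i, hi, j, hj, hij, hw⟩ := Finset.exists_ne_map_eq_of_card_lt_of_maps_to
    (s := S) (t := Finset.univ.erase (0 : Fin 3 → ZMod 2)) (f := w)
    (by rw [hS]; decide) (fun i hi => by simpa using h i hi)
  refine ⟨{i, j}, by simp [Finset.insert_subset_iff, hi, hj], by simp, Finset.card_le_two, ?_⟩
  rw [Finset.sum_pair hij, hw]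
  funext k
  exact CharTwo.add_self_eq_zero _

section Eigen

variable {p r : ℕ} [hp : Fact p.Prime]

theorem addChar_map_sum {ι M R : Type*} [AddCommMonoid M] [CommMonoid R] (ψ : AddChar M R)
    (S : Finset ι) (f : ι → M) : ψ (∑ i ∈ S, f i) = ∏ i ∈ S, ψ (f i) := by
  classical
  induction S using Finset.induction_on with
  | empty => simp
  | insert a S ha ih => rw [Finset.sum_insert ha, Finset.prod_insert ha, AddChar.map_add_eq_mul, ih]

/-- The character of `(ℤ/p)^r` attached to `w`. -/
noncomputable def elemChar (w t : Fin r → ZMod p) : ℂ := ZMod.stdAddChar (w ⬝ᵥ t)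

theorem elemChar_add_left (w w' t : Fin r → ZMod p) :
    elemChar (w + w') t = elemChar w t * elemChar w' t := by
  rw [elemChar, add_dotProduct, AddChar.map_add_eq_mul]; rfl

theorem elemChar_add_right (w t t' : Fin r → ZMod p) :
    elemChar w (t + t') = elemChar w t * elemChar w t' := by
  rw [elemChar, dotProduct_add, AddChar.map_add_eq_mul]; rfl

theorem elemChar_sum_left {ι : Type} (S : Finset ι) (w : ι → Fin r → ZMod p) (t : Fin r → ZMod p) :
    elemChar (∑ i ∈ S, w i) t = ∏ i ∈ S, elemChar (w i) t := by
  classical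
  induction S using Finset.induction_on with
  | empty => simp [elemChar]
  | insert a S ha ih => rw [Finset.sum_insert ha, Finset.prod_insert ha, elemChar_add_left, ih]

theorem sum_elemChar (t : Fin r → ZMod p) :
    ∑ w : Fin r → ZMod p, elemChar w t = if t = 0 then (p : ℂ) ^ r else 0 := by
  have h1 : ∀ w : Fin r → ZMod p, elemChar w t = ∏ i, ZMod.stdAddChar (w i * t i) := fun w => by
    rw [elemChar, dotProduct, addChar_map_sum]
  simp_rw [h1]
  rw [← Fintype.piFinset_univ, ← Finset.prod_univ_sum (fun _ => Finset.univ)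
    (fun i x => (ZMod.stdAddChar (x * t i) : ℂ))]
  simp_rw [AddChar.sum_mulShift _ (ZMod.isPrimitive_stdAddChar p)]
  split_ifs with h
  · simp [h, ZMod.card]
  · obtain ⟨i, hi⟩ := Function.ne_iff.1 h
    exact Finset.prod_eq_zero (Finset.mem_univ i) (by
      rw [if_neg (by simpa using hi)]; simp)

variable {A : Type} [CommRing A] [Algebra ℂ A]
  (φ : Multiplicative (Fin r → ZMod p) →* (A →ₐ[ℂ] A))

/-- The projection to the `w`-eigenspace. -/
noncomputable def eigProj (w : Fin r → ZMod p) (a : A) : A :=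
  ((p : ℂ) ^ r)⁻¹ • ∑ t : Fin r → ZMod p, elemChar w (-t) • φ (Multiplicative.ofAdd t) a

theorem sum_eigProj (a : A) : ∑ w, eigProj φ w a = a := by
  unfold eigProj
  rw [← Finset.smul_sum, Finset.sum_comm]
  simp_rw [← Finset.sum_smul, sum_elemChar, neg_eq_zero]
  rw [Finset.sum_eq_single 0 (fun t _ ht => by simp [ht]) (by simp)]
  rw [if_pos rfl, smul_smul, inv_mul_cancel₀ (pow_ne_zero _ (by exact_mod_cast hp.out.ne_zero)),
    one_smul, ofAdd_zero, act_one]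

theorem act_eigProj (w : Fin r → ZMod p) (s : Fin r → ZMod p) (a : A) :
    φ (Multiplicative.ofAdd s) (eigProj φ w a) = elemChar w s • eigProj φ w a := by
  unfold eigProj
  rw [map_smul, map_sum, smul_comm (elemChar w s), Finset.smul_sum (r := elemChar w s)]
  congr 1
  refine Fintype.sum_equiv (Equiv.addLeft s) _ _ fun t => ?_
  rw [map_smul, ← act_mul, ← ofAdd_add, smul_smul]
  simp only [Equiv.coe_addLeft]
  rw [← elemChar_add_right, show s + -(s + t) = -t by abel]

theorem eigProj_mem {J : Ideal A} (hJ : ∀ t, ∀ a ∈ J, φ t a ∈ J) (w : Fin r → ZMod p) {a : A}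
    (ha : a ∈ J) : eigProj φ w a ∈ J := by
  have hs : ∀ (c : ℂ) (b : A), b ∈ J → c • b ∈ J := fun c b hb => by
    rw [Algebra.smul_def]; exact J.mul_mem_left _ hb
  exact hs _ _ (J.sum_mem fun t _ => hs _ _ (hJ _ _ ha))

variable {φ} in
theorem prod_eigen_mem {J : Ideal A} {η l D c : ℕ}
    (h1 : ShortZeroSum (Fin r → ZMod p) η l) (h2 : ShortZeroSum (Fin r → ZMod p) D D)
    (hη : η ≤ 2 * l + c) (hD : D ≤ l + c)
    (k : ℕ) {ι : Type} (S : Finset ι) (w : ι → Fin r → ZMod p) (f : ι → A)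
    (hf : ∀ i, f i ∈ J)
    (hfw : ∀ i t, φ (Multiplicative.ofAdd t) (f i) = elemChar (w i) t • f i)
    (hS : l * k + c ≤ S.card) : ∏ i ∈ S, f i ∈ invIdeal φ J ^ k := by
  classical
  induction k generalizing S with
  | zero => simp
  | succ k ih =>
    obtain ⟨U, hU, hne, hUc, hsum⟩ : ∃ U ⊆ S, U.Nonempty ∧ (k ≠ 0 → U.card ≤ l) ∧
        ∑ i ∈ U, w i = 0 := by
      rcases Nat.eq_zero_or_pos k with rfl | hk
      · obtain ⟨U, a, b, _, d⟩ := h2 ι S w (by omega)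
        exact ⟨U, a, b, by simp, d⟩
      · obtain ⟨U, a, b, c, d⟩ := h1 ι S w (by nlinarith)
        exact ⟨U, a, b, fun _ => c, d⟩
    rw [← Finset.prod_sdiff hU, pow_succ]
    refine Ideal.mul_mem_mul ?_ (Ideal.subset_span ⟨?_, fun t => ?_⟩)
    · rcases Nat.eq_zero_or_pos k with rfl | hk
      · simp
      · refine ih _ ?_
        rw [Finset.card_sdiff_of_subset hU]
        have := hUc hk.ne'
        have : l * (k + 1) = l * k + l := by ring
        omega
    · obtain ⟨i, hi⟩ := hne
      rw [← Finset.mul_prod_erase _ _ hi]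
      exact J.mul_mem_right _ (hf i)
    · obtain ⟨t, rfl⟩ := Multiplicative.ofAdd.surjective t
      rw [map_prod]
      simp_rw [hfw]
      rw [Finset.prod_smul, ← elemChar_sum_left, hsum]
      simp [elemChar]

theorem absorbs_elementary {η l D c : ℕ}
    (h1 : ShortZeroSum (Fin r → ZMod p) η l) (h2 : ShortZeroSum (Fin r → ZMod p) D D)
    (hη : η ≤ 2 * l + c) (hD : D ≤ l + c) (k : ℕ) :
    Absorbs (Multiplicative (Fin r → ZMod p)) (l * k + c) k := by
  intro A _ _ φ J hJ s hs hsJ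
  induction s using Quotient.inductionOn with
  | h L =>
  have hL : L.length = l * k + c := hs
  have hprod : (Multiset.prod (L : Multiset A)) = ∏ i : Fin L.length, L.get i := by
    rw [Multiset.prod_coe, ← List.prod_ofFn, List.ofFn_get]
  change (Multiset.prod (L : Multiset A)) ∈ _
  rw [hprod, Finset.prod_congr rfl (fun i _ => (sum_eigProj φ (L.get i)).symm),
    Finset.prod_univ_sum]
  refine Ideal.sum_mem _ fun w _ => ?_
  refine prod_eigen_mem h1 h2 hη hD k Finset.univ w _ (fun i => eigProj_mem φ hJ _ (hsJ _ ?_))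
    (fun i t => act_eigProj φ _ _ _) (by simp [hL])
  exact List.get_mem L i

end Eigen

theorem Absorbs.of_mulEquiv {T T' : Type} [Group T] [Group T'] (e : T ≃* T') {d k : ℕ}
    (h : Absorbs T d k) : Absorbs T' d k := by
  intro A _ _ φ J hJ s hs hsJ
  have h1 := h A (φ.comp e.toMonoidHom) J (fun t a ha => hJ _ a ha) s hs hsJ
  have : invIdeal (φ.comp e.toMonoidHom) J = invIdeal φ J := by
    unfold invIdeal
    congr 1
    ext a
    refine and_congr_right fun _ => ⟨fun h t => ?_, fun h t => h _⟩
    simpa using h (e.symm t)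
  rwa [this] at h1

end NoetherIndex

namespace NoetherIndex

section Algebra

variable {B : Type*} [CommRing B] [Algebra ℂ B]

theorem eq_zero_of_natCast_mul {b : B} (n : ℕ) (hn : n ≠ 0) (h : (n : B) * b = 0) : b = 0 := by
  have h1 : (n : ℂ) • b = 0 := by rw [Algebra.smul_def, map_natCast, h]
  simpa [hn] using h1

theorem sum_fin_three_of_ne {M : Type*} [AddCommMonoid M] (f : Fin 3 → M) {i j k : Fin 3}
    (hij : i ≠ j) (hjk : j ≠ k) (hik : i ≠ k) : ∑ l, f l = f i + f j + f k := by
  have : (Finset.univ : Finset (Fin 3)) = {i, j, k} := by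
    revert i j k; decide
  rw [this, Finset.sum_insert (by simp [hij, hik]), Finset.sum_pair hjk, add_assoc]

/-- The relations satisfied by the orbits of two fixed elements modulo traces. -/
structure PairRel (p q : Fin 3 → B) : Prop where
  left : ∑ i, p i = 0
  right : ∑ i, q i = 0
  mul : ∀ j, ∑ i, p i * q (i + j) = 0

namespace PairRel

variable {p q r : Fin 3 → B}

theorem mul_sum (h : PairRel p q) : ∑ i, p i * q i = 0 := by simpa using h.mul 0

theorem mul_comm_index (h : PairRel p q) (i j : Fin 3) : p i * q j = p j * q i := by
  have h1 := h.left
  have h2 := h.right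
  have h3 := h.mul 0
  have h4 := h.mul 1
  have h5 := h.mul 2
  simp only [Fin.sum_univ_three, Fin.isValue, zero_add, add_zero, Fin.reduceAdd] at h1 h2 h3 h4 h5
  have key : p 0 * q 1 = p 1 * q 0 := by
    refine sub_eq_zero.1 (eq_zero_of_natCast_mul 3 (by norm_num) ?_)
    push_cast
    linear_combination h4 - h5 + (q 1 - q 0) * h1 + (p 0 - p 1) * h2
  have key2 : p 0 * q 2 = p 2 * q 0 := by
    linear_combination p 0 * h2 - q 0 * h1 - key
  have key3 : p 1 * q 2 = p 2 * q 1 := by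
    linear_combination p 1 * h2 - q 1 * h1 + key
  fin_cases i <;> fin_cases j <;> first | rfl | assumption | (symm; assumption)

theorem mul_eq (h : PairRel p q) {i j k : Fin 3} (hij : i ≠ j) (hjk : j ≠ k) (hik : i ≠ k) :
    p i * q j = p k * q k := by
  have h1 := h.left
  have h2 := h.right
  have h3 := h.mul_sum
  rw [sum_fin_three_of_ne _ hij hjk hik] at h1 h2 h3
  have e1 := h.mul_comm_index i j
  have e2 := h.mul_comm_index i k
  have e3 := h.mul_comm_index j k
  refine sub_eq_zero.1 (eq_zero_of_natCast_mul 2 (by norm_num) ?_)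
  push_cast
  linear_combination e1 + (q i + q j) * h1 - p k * h2 - h3

theorem symm (h : PairRel p q) : PairRel q p where
  left := h.right
  right := h.left
  mul j := by
    have h0 := h.mul (-j)
    rw [← Equiv.sum_comp (Equiv.addRight j)] at h0
    simpa [mul_comm] using h0

/-- The product of the entries with equal indices three times does not depend on the index. -/
theorem mul_mul_eq (hpq : PairRel p q) (hqr : PairRel q r) (hpr : PairRel p r) (i j : Fin 3) :
    p i * q i * r i = p j * q j * r j := by
  by_cases hij : i = j
  · rw [hij]
  obtain ⟨k, hjk, hik⟩ : ∃ k, j ≠ k ∧ i ≠ k := by revert i j; decide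
  rw [← hpq.mul_eq hjk hik.symm (Ne.symm hij), mul_assoc,
    hqr.symm.symm.mul_eq hik.symm hij hjk.symm, mul_assoc]

theorem distinct_eq (hpq : PairRel p q) (hqr : PairRel q r) (hpr : PairRel p r) {i j k : Fin 3}
    (hij : i ≠ j) (hjk : j ≠ k) (hik : i ≠ k) (l : Fin 3) :
    p i * q j * r k = p l * q l * r l := by
  rw [hpq.mul_eq hij hjk hik]
  exact mul_mul_eq hpq hqr hpr _ _

theorem mul_mul_zero_of_same (hpq : PairRel p q) (hqr : PairRel q r) (hpr : PairRel p r)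
    (h0 : p 0 * q 0 * r 0 = 0) {i j : Fin 3} (hij : i ≠ j) :
    p i * q i * r j = - (p i * q j * r j) := by
  obtain ⟨k, hjk, hik⟩ : ∃ k, j ≠ k ∧ i ≠ k := by revert i j; decide
  have h1 := hqr.left
  rw [sum_fin_three_of_ne _ hij hjk hik] at h1
  have h2 := (hpq.distinct_eq hqr hpr hik hjk.symm hij 0).trans h0
  linear_combination p i * r j * h1 - h2

/-- Three mutually related triples whose triple products have vanishing traces. -/
theorem triple_eq_zero (hpq : PairRel p q) (hqr : PairRel q r) (hpr : PairRel p r)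
    (h : ∀ j k, ∑ i, p i * q (i + j) * r (i + k) = 0) (i j k : Fin 3) :
    p i * q j * r k = 0 := by
  have h0 : p 0 * q 0 * r 0 = 0 := by
    have := h 0 0
    simp only [Fin.sum_univ_three, add_zero] at this
    refine eq_zero_of_natCast_mul 3 (by norm_num) ?_
    push_cast
    linear_combination this + hpq.mul_mul_eq hqr hpr 0 1 + hpq.mul_mul_eq hqr hpr 0 2
  have same : ∀ i, p i * q i * r i = 0 := fun i => (hpq.mul_mul_eq hqr hpr i 0).trans h0
  have anti : ∀ i j, i ≠ j → p i * q i * r j = - (p j * q j * r i) := fun i j hij => by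
    linear_combination hpq.mul_mul_zero_of_same hqr hpr h0 hij - p j * hqr.mul_comm_index i j -
      r j * hpq.mul_comm_index i j
  have row : ∀ i, p i * q i * r 0 + p i * q i * r 1 + p i * q i * r 2 = 0 := fun i => by
    have := hpr.right
    rw [Fin.sum_univ_three] at this
    linear_combination p i * q i * this
  have t := h 0 1
  simp only [Fin.sum_univ_three, add_zero, Fin.isValue, zero_add, Fin.reduceAdd] at t
  have e01 : p 0 * q 0 * r 1 = 0 := by
    refine eq_zero_of_natCast_mul 3 (by norm_num) ?_
    push_cast
    linear_combination t + anti 1 0 (by decide) - row 1 + same 1 - anti 2 0 (by decide) + row 0 -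
      same 0
  have e02 : p 0 * q 0 * r 2 = 0 := by linear_combination row 0 - same 0 - e01
  have e10 : p 1 * q 1 * r 0 = 0 := by linear_combination anti 1 0 (by decide) - e01
  have e20 : p 2 * q 2 * r 0 = 0 := by linear_combination anti 2 0 (by decide) - e02
  have e12 : p 1 * q 1 * r 2 = 0 := by linear_combination row 1 - same 1 - e10
  have e21 : p 2 * q 2 * r 1 = 0 := by linear_combination row 2 - same 2 - e20
  have all : ∀ i j, p i * q i * r j = 0 := by
    intro i j
    fin_cases i <;> fin_cases j <;> first | exact same _ | assumption
  by_cases hij : i = j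
  · rw [hij, all]
  obtain ⟨l, hjl, hil⟩ : ∃ k, j ≠ k ∧ i ≠ k := by revert i j; decide
  rw [hpq.mul_eq hij hjl hil, all]

end PairRel

/-- Relations, modulo invariants of degree at most four, between the weight components of elements
on which the alternating group of degree four acts. -/
structure WeightRel (W B : Type*) [AddCommGroup W] [CommRing B] [Algebra ℂ B] where
  ℓ : Fin 3 → W →+ B
  two : ∀ x y, ∑ i, ℓ i x * ℓ i y = 0
  three : ∀ x y z, ∑ i, ℓ i x * ℓ (i + 1) y * ℓ (i + 2) z = 0
  four : ∀ j x y z w, ∑ i, (ℓ i x * ℓ i y) * (ℓ (i + j) z * ℓ (i + j) w) = 0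

namespace WeightRel

variable {W : Type*} [AddCommGroup W] (R : WeightRel W B)

theorem pairRel (x y z w : W) :
    PairRel (fun i => R.ℓ i x * R.ℓ i y) (fun i => R.ℓ i z * R.ℓ i w) :=
  ⟨R.two x y, R.two z w, fun j => R.four j x y z w⟩

/-- The product of the `i`-th components of a list of elements. -/
def P (i : Fin 3) (l : List W) : B := (l.map (R.ℓ i)).prod

theorem abc (x : W) {i j k : Fin 3} (hij : i ≠ j) (hjk : j ≠ k) (hik : i ≠ k) :
    R.ℓ i x * R.ℓ j x * R.ℓ k x = 0 := by
  have h := R.three x x x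
  simp only [Fin.sum_univ_three, Fin.isValue, zero_add, Fin.reduceAdd] at h
  have h0 : R.ℓ 0 x * R.ℓ 1 x * R.ℓ 2 x = 0 := by
    refine eq_zero_of_natCast_mul 3 (by norm_num) ?_
    push_cast
    linear_combination h
  have := sum_fin_three_of_ne (M := Additive B) (fun i => .ofMul (R.ℓ i x)) hij hjk hik
  rw [Fin.sum_univ_three] at this
  exact (congrArg Additive.toMul this).symm.trans h0

theorem pow_five (x : W) (i : Fin 3) : R.ℓ i x ^ 5 = 0 := by
  obtain ⟨j, k, hij, hjk, hik⟩ : ∃ j k : Fin 3, i ≠ j ∧ j ≠ k ∧ i ≠ k := by revert i; decide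
  have h1 := (R.pairRel x x x x).mul_eq hjk hik.symm (Ne.symm hij)
  have h2 := R.abc x hij hjk hik
  linear_combination - R.ℓ i x * h1 + R.ℓ j x * R.ℓ k x * h2

theorem five (i : Fin 3) (a b c d e : W) :
    R.ℓ i a * R.ℓ i b * R.ℓ i c * R.ℓ i d * R.ℓ i e = 0 := by
  have h := fun x => R.pow_five x i
  generalize R.ℓ i = f at *
  refine eq_zero_of_natCast_mul 120 (by norm_num) ?_
  have h5 := h (a + b + c + d + e)
  have a1 := h (b + c + d + e)
  have a2 := h (a + c + d + e)
  have a3 := h (a + b + d + e)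
  have a4 := h (a + b + c + e)
  have a5 := h (a + b + c + d)
  have b1 := h (a + b + c)
  have b2 := h (a + b + d)
  have b3 := h (a + b + e)
  have b4 := h (a + c + d)
  have b5 := h (a + c + e)
  have b6 := h (a + d + e)
  have b7 := h (b + c + d)
  have b8 := h (b + c + e)
  have b9 := h (b + d + e)
  have b10 := h (c + d + e)
  have c1 := h (a + b)
  have c2 := h (a + c)
  have c3 := h (a + d)
  have c4 := h (a + e)
  have c5 := h (b + c)
  have c6 := h (b + d)
  have c7 := h (b + e)
  have c8 := h (c + d)
  have c9 := h (c + e)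
  have c10 := h (d + e)
  simp only [map_add] at *
  push_cast
  linear_combination h5 - a1 - a2 - a3 - a4 - a5 + b1 + b2 + b3 + b4 + b5 + b6 + b7 + b8 + b9 + b10
    - c1 - c2 - c3 - c4 - c5 - c6 - c7 - c8 - c9 - c10 + h a + h b + h c + h d + h e

theorem two_two_two (a b c d e f : W) (l : Fin 3) :
    (R.ℓ l a * R.ℓ l b) * (R.ℓ l c * R.ℓ l d) * (R.ℓ l e * R.ℓ l f) = 0 := by
  linear_combination R.ℓ l f * R.five l a b c d e

theorem distinct {i j k : Fin 3} (hij : i ≠ j) (hjk : j ≠ k) (hik : i ≠ k) (a b c d e f : W) :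
    (R.ℓ i a * R.ℓ i b) * (R.ℓ j c * R.ℓ j d) * (R.ℓ k e * R.ℓ k f) = 0 :=
  ((R.pairRel a b c d).distinct_eq (R.pairRel c d e f) (R.pairRel a b e f) hij hjk hik 0).trans
    (R.two_two_two a b c d e f 0)

theorem four_three {i j : Fin 3} (hij : i ≠ j) (a b c d e f g : W) :
    (R.ℓ i a * R.ℓ i b) * (R.ℓ i c * R.ℓ i d) * (R.ℓ j e * R.ℓ j f) * R.ℓ j g = 0 := by
  have h := (R.pairRel a b c d).mul_mul_zero_of_same (R.pairRel c d e f) (R.pairRel a b e f)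
    (R.two_two_two a b c d e f 0) hij
  linear_combination R.ℓ j g * h - R.ℓ i a * R.ℓ i b * R.five j c d e f g

theorem mul_four_eq_zero {m n : Fin 3} (hmn : m ≠ n) (x y a b c d : W) (i j : Fin 3) :
    (R.ℓ m x * R.ℓ n y) * ((R.ℓ i a * R.ℓ i b) * (R.ℓ j c * R.ℓ j d)) = 0 := by
  have h := R.pairRel a b c d
  have hm : R.ℓ m x * ((R.ℓ m a * R.ℓ m b) * (R.ℓ m c * R.ℓ m d)) = 0 := by
    linear_combination R.five m x a b c d
  have hn : R.ℓ n y * ((R.ℓ n a * R.ℓ n b) * (R.ℓ n c * R.ℓ n d)) = 0 := by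
    linear_combination R.five n y a b c d
  have same : ∀ k, (R.ℓ m x * R.ℓ n y) * ((R.ℓ k a * R.ℓ k b) * (R.ℓ k c * R.ℓ k d)) = 0 := by
    intro k
    by_cases hkm : k = m
    · subst hkm; linear_combination R.ℓ n y * hm
    by_cases hkn : k = n
    · subst hkn; linear_combination R.ℓ m x * hn
    have h1 := h.mul_sum
    rw [sum_fin_three_of_ne _ (Ne.symm hkm) hkn hmn] at h1
    linear_combination (R.ℓ m x * R.ℓ n y) * h1 - R.ℓ n y * hm - R.ℓ m x * hn
  by_cases hij : i = j
  · subst hij; exact same _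
  obtain ⟨l, hjl, hil⟩ : ∃ k, j ≠ k ∧ i ≠ k := by revert i j; decide
  rw [h.mul_eq hij hjl hil, same]

theorem P_dvd (i : Fin 3) (l : Fin 3 → List W) : R.P i (l i) ∣ ∏ i, R.P i (l i) :=
  Finset.dvd_prod_of_mem _ (Finset.mem_univ i)

theorem P_mul_P_dvd {i j : Fin 3} (hij : i ≠ j) (l : Fin 3 → List W) :
    R.P i (l i) * R.P j (l j) ∣ ∏ i, R.P i (l i) := by
  rw [← Finset.prod_pair (f := fun i => R.P i (l i)) hij]
  exact Finset.prod_dvd_prod_of_subset _ _ _ (Finset.subset_univ _)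

theorem exists_one {i : Fin 3} {l : List W} (h : 1 ≤ l.length) : ∃ a, R.ℓ i a ∣ R.P i l := by
  match l, h with
  | a :: l, _ => exact ⟨a, by simp [P]⟩

theorem exists_two {i : Fin 3} {l : List W} (h : 2 ≤ l.length) :
    ∃ a b, R.ℓ i a * R.ℓ i b ∣ R.P i l := by
  match l, h with
  | a :: b :: l, _ => exact ⟨a, b, Dvd.intro (R.P i l) (by simp [P]; ring)⟩

theorem exists_three {i : Fin 3} {l : List W} (h : 3 ≤ l.length) :
    ∃ a b c, (R.ℓ i a * R.ℓ i b) * R.ℓ i c ∣ R.P i l := by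
  match l, h with
  | a :: b :: c :: l, _ => exact ⟨a, b, c, Dvd.intro (R.P i l) (by simp [P]; ring)⟩

theorem exists_four {i : Fin 3} {l : List W} (h : 4 ≤ l.length) :
    ∃ a b c d, (R.ℓ i a * R.ℓ i b) * (R.ℓ i c * R.ℓ i d) ∣ R.P i l := by
  match l, h with
  | a :: b :: c :: d :: l, _ => exact ⟨a, b, c, d, Dvd.intro (R.P i l) (by simp [P]; ring)⟩

theorem P_eq_zero_of_five {i : Fin 3} {l : List W} (h : 5 ≤ l.length) : R.P i l = 0 := by
  match l, h with
  | a :: b :: c :: d :: e :: l, _ =>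
    simp only [P, List.map_cons, List.prod_cons]
    linear_combination (l.map (R.ℓ i)).prod * R.five i a b c d e

theorem eq_zero_of_eight (l : Fin 3 → List W) (h : 8 ≤ ∑ i, (l i).length) :
    ∏ i, R.P i (l i) = 0 := by
  by_cases h5 : ∃ i, 5 ≤ (l i).length
  · obtain ⟨i, hi⟩ := h5
    exact zero_dvd_iff.1 (R.P_eq_zero_of_five hi ▸ R.P_dvd i l)
  push Not at h5
  by_cases h2 : ∀ i, 2 ≤ (l i).length
  · obtain ⟨a, b, ha⟩ := R.exists_two (i := 0) (h2 0)
    obtain ⟨c, d, hc⟩ := R.exists_two (i := 1) (h2 1)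
    obtain ⟨e, f, he⟩ := R.exists_two (i := 2) (h2 2)
    rw [Fin.prod_univ_three]
    refine zero_dvd_iff.1 ?_
    rw [← R.distinct (i := 0) (j := 1) (k := 2) (by decide) (by decide) (by decide) a b c d e f]
    exact mul_dvd_mul (mul_dvd_mul ha hc) he
  obtain ⟨i, j, hij, hi, hj⟩ : ∃ i j, i ≠ j ∧ 4 ≤ (l i).length ∧ 3 ≤ (l j).length := by
    push Not at h2
    obtain ⟨k, hk⟩ := h2
    obtain ⟨i, j, hij, hjk, hik⟩ : ∃ i j : Fin 3, i ≠ j ∧ j ≠ k ∧ i ≠ k := by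
      clear hk
      revert k; decide
    rw [sum_fin_three_of_ne _ hij hjk hik] at h
    have h5i := h5 i
    have h5j := h5 j
    by_cases h4 : 4 ≤ (l i).length
    · exact ⟨i, j, hij, h4, by omega⟩
    · exact ⟨j, i, hij.symm, by omega, by omega⟩
  obtain ⟨a, b, c, d, h1⟩ := R.exists_four (i := i) hi
  obtain ⟨e, f, g, h2⟩ := R.exists_three (i := j) hj
  refine zero_dvd_iff.1 (dvd_trans ?_ (R.P_mul_P_dvd hij l))
  rw [← R.four_three hij a b c d e f g, mul_assoc]
  exact mul_dvd_mul h1 h2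

theorem eq_zero_of_ten (l : Fin 3 → List W) (t : List B)
    (ht : ∀ a ∈ t, ∀ b ∈ t, ∀ c ∈ t, a * b * c = 0) (h : t.length + ∑ i, (l i).length = 10) :
    t.prod * ∏ i, R.P i (l i) = 0 := by
  match t, h with
  | [], h | [a], h | [a, b], h =>
    simp only [List.length_cons, List.length_nil] at h
    rw [R.eq_zero_of_eight l (by omega), mul_zero]
  | a :: b :: c :: t, h =>
    rw [List.prod_cons, List.prod_cons, List.prod_cons, ← mul_assoc, ← mul_assoc,
      ht a (by simp) b (by simp) c (by simp), zero_mul, zero_mul]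

theorem exists_pair (l : Fin 3 → List W) (h : 4 ≤ ∑ i, (l i).length) :
    ∃ i a b, R.ℓ i a * R.ℓ i b ∣ ∏ i, R.P i (l i) := by
  obtain ⟨i, hi⟩ : ∃ i, 2 ≤ (l i).length := by
    by_contra! hl
    have := hl 0; have := hl 1; have := hl 2
    rw [Fin.sum_univ_three] at h
    omega
  obtain ⟨a, b, hab⟩ := R.exists_two (i := i) hi
  exact ⟨i, a, b, hab.trans (R.P_dvd i l)⟩

theorem exists_sorted (n : Fin 3 → ℕ) :
    ∃ i j k : Fin 3, (i ≠ j ∧ j ≠ k ∧ i ≠ k) ∧ n j ≤ n i ∧ n k ≤ n j := by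
  rcases le_total (n 0) (n 1) with h1 | h1 <;> rcases le_total (n 1) (n 2) with h2 | h2 <;>
    rcases le_total (n 0) (n 2) with h3 | h3
  · exact ⟨2, 1, 0, by decide, h2, h1⟩
  · exact ⟨2, 1, 0, by decide, h2, h1⟩
  · exact ⟨1, 2, 0, by decide, h2, h3⟩
  · exact ⟨1, 0, 2, by decide, h1, h3⟩
  · exact ⟨2, 0, 1, by decide, h3, h1⟩
  · exact ⟨0, 2, 1, by decide, h3, h2⟩
  · exact ⟨0, 1, 2, by decide, h1, h2⟩
  · exact ⟨0, 1, 2, by decide, h1, h2⟩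

theorem exists_perm_of_six (n : Fin 3 → ℕ) (h : ∑ i, n i = 6) (h5 : ∀ i, n i < 5) :
    ∃ i j k : Fin 3, (i ≠ j ∧ j ≠ k ∧ i ≠ k) ∧
      (4 ≤ n i ∧ 2 ≤ n j ∨ 3 ≤ n i ∧ 3 ≤ n j ∨ 3 ≤ n i ∧ 2 ≤ n j ∧ 1 ≤ n k ∨
        4 ≤ n i ∧ 1 ≤ n j ∧ 1 ≤ n k ∨ 2 ≤ n i ∧ 2 ≤ n j ∧ 2 ≤ n k) := by
  obtain ⟨i, j, k, hd, h1, h2⟩ := exists_sorted n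
  rw [sum_fin_three_of_ne _ hd.1 hd.2.1 hd.2.2] at h
  have := h5 i
  exact ⟨i, j, k, hd, by omega⟩

theorem exists_perm_of_five (n : Fin 3 → ℕ) (h : ∑ i, n i = 5) :
    ∃ i j k : Fin 3, (i ≠ j ∧ j ≠ k ∧ i ≠ k) ∧
      (4 ≤ n i ∨ 2 ≤ n i ∧ 2 ≤ n j ∨ 3 ≤ n i ∧ 1 ≤ n j ∧ 1 ≤ n k) := by
  obtain ⟨i, j, k, hd, h1, h2⟩ := exists_sorted n
  rw [sum_fin_three_of_ne _ hd.1 hd.2.1 hd.2.2] at h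
  exact ⟨i, j, k, hd, by omega⟩

theorem P_mul_P_mul_P (l : Fin 3 → List W) {i j k : Fin 3} (hij : i ≠ j) (hjk : j ≠ k)
    (hik : i ≠ k) : ∏ i, R.P i (l i) = R.P i (l i) * R.P j (l j) * R.P k (l k) :=
  congrArg Additive.toMul
    (sum_fin_three_of_ne (M := Additive B) (fun i => .ofMul (R.P i (l i))) hij hjk hik)

theorem eq_zero_of_six (l : Fin 3 → List W) (t : List B)
    (ht : ∀ a ∈ t, ∀ b ∈ t, ∀ c ∈ t, a * b * c = 0)
    (ht2 : ∀ a ∈ t, ∀ b ∈ t, ∀ i x y, a * b * (R.ℓ i x * R.ℓ i y) = 0)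
    (ht1 : ∀ a ∈ t, ∀ i j x y z w, a * (R.ℓ i x * R.ℓ i y) * (R.ℓ j z * R.ℓ j w) = 0)
    (ht1' : ∀ a ∈ t, ∀ i u v w x y,
      a * (R.ℓ i x * R.ℓ i y) * (R.ℓ 0 u * R.ℓ 1 v * R.ℓ 2 w) = 0)
    (ht0 : ∀ i j k u v w x y z, (R.ℓ i u * R.ℓ i v) * (R.ℓ j w * R.ℓ j x) *
      (R.ℓ k y * R.ℓ k z) = 0)
    (h : t.length + ∑ i, (l i).length = 6) :
    t.prod * ∏ i, R.P i (l i) = 0 := by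
  by_cases h5 : ∃ i, 5 ≤ (l i).length
  · obtain ⟨i, hi⟩ := h5
    have := R.P_dvd i l
    rw [R.P_eq_zero_of_five hi, zero_dvd_iff] at this
    rw [this, mul_zero]
  push Not at h5
  refine zero_dvd_iff.1 ?_
  match t, h with
  | [], h =>
    simp only [List.length_nil, zero_add, List.prod_nil, one_mul] at h ⊢
    obtain ⟨i, j, k, ⟨hij, hjk, hik⟩, H⟩ := exists_perm_of_six (fun i => (l i).length) h h5
    rw [R.P_mul_P_mul_P l hij hjk hik]
    rcases H with ⟨h1, h2⟩ | ⟨h1, h2⟩ | ⟨h1, h2, h3⟩ | ⟨h1, h2, h3⟩ | ⟨h1, h2, h3⟩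
    · obtain ⟨a, b, c, d, e1⟩ := R.exists_four (i := i) h1
      obtain ⟨e, f, e2⟩ := R.exists_two (i := j) h2
      rw [← ht0 i i j a b c d e f]
      exact (mul_dvd_mul e1 e2).mul_right _
    · obtain ⟨a, b, c, e1⟩ := R.exists_three (i := i) h1
      obtain ⟨d, e, f, e2⟩ := R.exists_three (i := j) h2
      rw [← R.mul_four_eq_zero hij c f a b d e i j]
      refine dvd_trans (dvd_of_eq ?_) ((mul_dvd_mul e1 e2).mul_right _)
      ring
    · obtain ⟨a, b, c, e1⟩ := R.exists_three (i := i) h1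
      obtain ⟨d, e, e2⟩ := R.exists_two (i := j) h2
      obtain ⟨f, e3⟩ := R.exists_one (i := k) h3
      rw [← R.mul_four_eq_zero hik c f a b d e i j]
      refine dvd_trans (dvd_of_eq ?_) (mul_dvd_mul (mul_dvd_mul e1 e2) e3)
      ring
    · obtain ⟨a, b, c, d, e1⟩ := R.exists_four (i := i) h1
      obtain ⟨e, e2⟩ := R.exists_one (i := j) h2
      obtain ⟨f, e3⟩ := R.exists_one (i := k) h3
      rw [← R.mul_four_eq_zero hjk e f a b c d i i]
      refine dvd_trans (dvd_of_eq ?_) (mul_dvd_mul (mul_dvd_mul e1 e2) e3)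
      ring
    · obtain ⟨a, b, e1⟩ := R.exists_two (i := i) h1
      obtain ⟨c, d, e2⟩ := R.exists_two (i := j) h2
      obtain ⟨e, f, e3⟩ := R.exists_two (i := k) h3
      rw [← ht0 i j k a b c d e f]
      exact mul_dvd_mul (mul_dvd_mul e1 e2) e3
  | [a], h =>
    simp only [List.length_cons, List.length_nil, zero_add, List.prod_singleton] at h ⊢
    obtain ⟨i, j, k, ⟨hij, hjk, hik⟩, H⟩ :=
      exists_perm_of_five (fun i => (l i).length) (by omega)
    rcases H with h1 | ⟨h1, h2⟩ | ⟨h1, h2, h3⟩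
    · obtain ⟨b, c, d, e, e1⟩ := R.exists_four (i := i) h1
      rw [← ht1 a (by simp) i i b c d e, mul_assoc]
      exact mul_dvd_mul_left _ (e1.trans (R.P_dvd i l))
    · obtain ⟨b, c, e1⟩ := R.exists_two (i := i) h1
      obtain ⟨d, e, e2⟩ := R.exists_two (i := j) h2
      rw [← ht1 a (by simp) i j b c d e, mul_assoc]
      exact mul_dvd_mul_left _ ((mul_dvd_mul e1 e2).trans (R.P_mul_P_dvd hij l))
    · obtain ⟨b, c, d, e1⟩ := R.exists_three (i := i) h1
      obtain ⟨e, e2⟩ := R.exists_one (i := j) h2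
      obtain ⟨f, e3⟩ := R.exists_one (i := k) h3
      rw [R.P_mul_P_mul_P l hij hjk hik]
      suffices h : a * ((R.ℓ i b * R.ℓ i c) * R.ℓ i d * R.ℓ j e * R.ℓ k f) = 0 by
        rw [← h]
        exact mul_dvd_mul_left _ (mul_dvd_mul (mul_dvd_mul e1 e2) e3)
      obtain ⟨u, v, w, hp⟩ : ∃ u v w, R.ℓ i d * R.ℓ j e * R.ℓ k f =
          R.ℓ 0 u * R.ℓ 1 v * R.ℓ 2 w := by
        let g : Fin 3 → W := fun l => if l = i then d else if l = j then e else f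
        refine ⟨g 0, g 1, g 2, ?_⟩
        have := sum_fin_three_of_ne (M := Additive B) (fun i => .ofMul (R.ℓ i (g i))) hij hjk hik
        rw [Fin.sum_univ_three] at this
        simp only [g, hij.symm, hjk.symm, hik.symm, if_true, if_false] at this
        exact (congrArg Additive.toMul this).symm
      linear_combination ht1' a (by simp) i u v w b c + a * (R.ℓ i b * R.ℓ i c) * hp
  | [a, b], h =>
    simp only [List.length_cons, List.length_nil] at h
    obtain ⟨i, x, y, hxy⟩ := R.exists_pair l (by omega)
    rw [← ht2 a (by simp) b (by simp) i x y]
    exact mul_dvd_mul (by simp) hxy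
  | a :: b :: c :: t, h =>
    rw [List.prod_cons, List.prod_cons, List.prod_cons, ← mul_assoc, ← mul_assoc,
      ht a (by simp) b (by simp) c (by simp), zero_mul, zero_mul]

end WeightRel
end Algebra
end NoetherIndex

namespace NoetherIndex

/-- Endomorphisms of an algebra satisfying the relations of the alternating group of degree four,
together with a stable subspace `J` and an ideal `I` containing the invariants in the first `m`
powers of `J`. -/
structure AltSetup (A : Type*) [CommRing A] [Algebra ℂ A] where
  s₁ : A →ₐ[ℂ] A
  s₂ : A →ₐ[ℂ] A
  γ : A →ₐ[ℂ] A
  J : Submodule ℂ A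
  I : Ideal A
  m : ℕ
  four_le : 4 ≤ m
  s₁_s₁ : ∀ a, s₁ (s₁ a) = a
  s₂_s₂ : ∀ a, s₂ (s₂ a) = a
  s₁_s₂ : ∀ a, s₁ (s₂ a) = s₂ (s₁ a)
  γ_γ_γ : ∀ a, γ (γ (γ a)) = a
  γ_s₁ : ∀ a, γ (s₁ a) = s₂ (γ a)
  γ_s₂ : ∀ a, γ (s₂ a) = s₁ (s₂ (γ a))
  s₁_mem : ∀ a ∈ J, s₁ a ∈ J
  s₂_mem : ∀ a ∈ J, s₂ a ∈ J
  γ_mem : ∀ a ∈ J, γ a ∈ J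
  inv_mem : ∀ d, 1 ≤ d → d ≤ m → ∀ a ∈ J ^ d, s₁ a = a → s₂ a = a → γ a = a → a ∈ I

namespace AltSetup

variable {A : Type*} [CommRing A] [Algebra ℂ A] (X : AltSetup A)

/-- Elements of the `d`-th power of `J` fixed by the Klein four-group. -/
def Fixed (d : ℕ) (a : A) : Prop := a ∈ X.J ^ d ∧ X.s₁ a = a ∧ X.s₂ a = a

/-- The elements of `J` lying in a given nontrivial eigenspace of the Klein four-group. -/
def wt : AddSubgroup A where
  carrier := {a | a ∈ X.J ∧ X.s₁ a = a ∧ X.s₂ a = -a}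
  add_mem' := fun ha hb => ⟨add_mem ha.1 hb.1, by rw [map_add, ha.2.1, hb.2.1],
    by rw [map_add, ha.2.2, hb.2.2, neg_add]⟩
  zero_mem' := by simp
  neg_mem' := fun ha => ⟨neg_mem ha.1, by rw [map_neg, ha.2.1], by rw [map_neg, ha.2.2]⟩

/-- The iterates of `γ`. -/
def rot (i : Fin 3) : A →ₐ[ℂ] A := X.γ ^ (i : ℕ)

theorem rot_zero (a : A) : X.rot 0 a = a := rfl

theorem rot_one (a : A) : X.rot 1 a = X.γ a := rfl

theorem rot_two (a : A) : X.rot 2 a = X.γ (X.γ a) := rfl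

theorem rot_add (i j : Fin 3) (a : A) : X.rot (i + j) a = X.rot i (X.rot j a) := by
  fin_cases i <;> fin_cases j <;>
    simp [rot_zero, rot_one, rot_two, X.γ_γ_γ, show (1 + 1 : Fin 3) = 2 from rfl,
      show (1 + 2 : Fin 3) = 0 from rfl, show (2 + 1 : Fin 3) = 0 from rfl,
      show (2 + 2 : Fin 3) = 1 from rfl]

theorem γ_mem_pow (d : ℕ) {a : A} (h : a ∈ X.J ^ d) : X.γ a ∈ X.J ^ d := by
  have h1 : Submodule.map X.γ.toLinearMap X.J ≤ X.J := by
    rintro _ ⟨b, hb, rfl⟩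
    exact X.γ_mem b hb
  have h2 : Submodule.map X.γ.toLinearMap (X.J ^ d) ≤ X.J ^ d := by
    rw [Submodule.map_pow]
    exact pow_le_pow_left' h1 d
  exact h2 ⟨a, h, rfl⟩

theorem rot_mem (i : Fin 3) {a : A} (h : a ∈ X.J) : X.rot i a ∈ X.J := by
  fin_cases i
  · exact h
  · exact X.γ_mem _ h
  · exact X.γ_mem _ (X.γ_mem _ h)

variable {X}

theorem Fixed.γ {d : ℕ} {a : A} (h : X.Fixed d a) : X.Fixed d (X.γ a) := by
  obtain ⟨h0, h1, h2⟩ := h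
  have h3 : X.s₂ (X.γ a) = X.γ a := by rw [← X.γ_s₁, h1]
  refine ⟨X.γ_mem_pow d h0, ?_, h3⟩
  have := X.γ_s₂ a
  rw [h2, h3] at this
  exact this.symm

theorem Fixed.rot {d : ℕ} {a : A} (h : X.Fixed d a) (i : Fin 3) : X.Fixed d (X.rot i a) := by
  fin_cases i
  · exact h
  · exact h.γ
  · exact h.γ.γ

theorem Fixed.mul {d e : ℕ} {a b : A} (ha : X.Fixed d a) (hb : X.Fixed e b) :
    X.Fixed (d + e) (a * b) :=
  ⟨pow_add X.J d e ▸ Submodule.mul_mem_mul ha.1 hb.1, by rw [map_mul, ha.2.1, hb.2.1],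
    by rw [map_mul, ha.2.2, hb.2.2]⟩

/-- The class of the `i`-th rotation modulo `I`. -/
def cls (X : AltSetup A) (i : Fin 3) : A →+* A ⧸ X.I :=
  (Ideal.Quotient.mk X.I).comp (X.rot i).toRingHom

theorem cls_apply (i : Fin 3) (a : A) : X.cls i a = Ideal.Quotient.mk X.I (X.rot i a) := rfl

theorem cls_rot (i j : Fin 3) (a : A) : X.cls i (X.rot j a) = X.cls (i + j) a := by
  rw [cls_apply, cls_apply, rot_add]

theorem Fixed.sum_cls {d : ℕ} {a : A} (h : X.Fixed d a) (h1 : 1 ≤ d) (hm : d ≤ X.m) :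
    ∑ i, X.cls i a = 0 := by
  simp only [cls_apply]
  rw [← map_sum, Ideal.Quotient.eq_zero_iff_mem, Fin.sum_univ_three]
  have ha := h.1
  have hb := h.γ
  have hc := h.γ.γ
  refine X.inv_mem d h1 hm _ (add_mem (add_mem h.1 hb.1) hc.1) ?_ ?_ ?_
  · simp only [rot_zero, rot_one, rot_two, map_add, h.2.1, hb.2.1, hc.2.1]
  · simp only [rot_zero, rot_one, rot_two, map_add, h.2.2, hb.2.2, hc.2.2]
  · simp only [rot_zero, rot_one, rot_two, map_add, X.γ_γ_γ]; ring

theorem Fixed.pairRel {d e : ℕ} {a b : A} (ha : X.Fixed d a) (hb : X.Fixed e b) (hd : 1 ≤ d)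
    (he : 1 ≤ e) (hm : d + e ≤ X.m) :
    PairRel (fun i => X.cls i a) (fun i => X.cls i b) where
  left := ha.sum_cls hd (by omega)
  right := hb.sum_cls he (by omega)
  mul j := by
    simpa only [map_mul, cls_rot] using (ha.mul (hb.rot j)).sum_cls (by omega) hm

theorem Fixed.mul_mul_eq_zero {d e f : ℕ} {a b c : A} (ha : X.Fixed d a) (hb : X.Fixed e b)
    (hc : X.Fixed f c) (hd : 1 ≤ d) (he : 1 ≤ e) (hf : 1 ≤ f) (hm : d + e + f ≤ X.m)
    (i j k : Fin 3) : X.cls i a * X.cls j b * X.cls k c = 0 :=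
  PairRel.triple_eq_zero (ha.pairRel hb hd he (by omega)) (hb.pairRel hc he hf (by omega))
    (ha.pairRel hc hd hf (by omega)) (fun j k => by
      simpa only [map_mul, cls_rot] using
        ((ha.mul (hb.rot j)).mul (hc.rot k)).sum_cls (by omega) hm) i j k

theorem wt_mul {a b : A} (ha : a ∈ X.wt) (hb : b ∈ X.wt) : X.Fixed 2 (a * b) :=
  ⟨pow_two X.J ▸ Submodule.mul_mem_mul ha.1 hb.1, by rw [map_mul, ha.2.1, hb.2.1],
    by rw [map_mul, ha.2.2, hb.2.2]; ring⟩

theorem wt_γ {a : A} (h : a ∈ X.wt) : X.s₁ (X.γ a) = -X.γ a ∧ X.s₂ (X.γ a) = X.γ a := by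
  have h3 : X.s₂ (X.γ a) = X.γ a := by rw [← X.γ_s₁, h.2.1]
  refine ⟨?_, h3⟩
  have := X.γ_s₂ a
  rw [h.2.2, h3, map_neg] at this
  exact this.symm

theorem wt_γ_γ {a : A} (h : a ∈ X.wt) :
    X.s₁ (X.γ (X.γ a)) = -X.γ (X.γ a) ∧ X.s₂ (X.γ (X.γ a)) = -X.γ (X.γ a) := by
  obtain ⟨h1, h2⟩ := wt_γ h
  have h3 : X.s₂ (X.γ (X.γ a)) = -X.γ (X.γ a) := by rw [← X.γ_s₁, h1, map_neg]
  refine ⟨?_, h3⟩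
  have := X.γ_s₂ (X.γ a)
  rw [h2, h3, map_neg] at this
  exact (neg_eq_iff_eq_neg.2 this).symm ▸ rfl

theorem wt_triple {a b c : A} (ha : a ∈ X.wt) (hb : b ∈ X.wt) (hc : c ∈ X.wt) :
    X.Fixed 3 (a * X.rot 1 b * X.rot 2 c) := by
  refine ⟨?_, ?_, ?_⟩
  · rw [pow_succ, pow_two]
    exact Submodule.mul_mem_mul (Submodule.mul_mem_mul ha.1 (X.rot_mem _ hb.1)) (X.rot_mem _ hc.1)
  · rw [map_mul, map_mul, rot_one, rot_two, ha.2.1, (wt_γ hb).1, (wt_γ_γ hc).1]; ring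
  · rw [map_mul, map_mul, rot_one, rot_two, ha.2.2, (wt_γ hb).2, (wt_γ_γ hc).2]; ring

/-- The relations between the weight components modulo `I`. -/
noncomputable def weightRel (X : AltSetup A) : WeightRel X.wt (A ⧸ X.I) where
  ℓ i := (X.cls i).toAddMonoidHom.comp X.wt.subtype
  two x y := by
    simpa using (wt_mul x.2 y.2).sum_cls (by norm_num) (by have := X.four_le; omega)
  three x y z := by
    simpa [cls_rot] using (wt_triple x.2 y.2 z.2).sum_cls (by norm_num)
      (by have := X.four_le; omega)
  four j x y z w := by
    simpa [cls_rot] using ((wt_mul x.2 y.2).mul ((wt_mul z.2 w.2).rot j)).sum_cls (by norm_num)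
      X.four_le

theorem weightRel_ℓ (i : Fin 3) (x : X.wt) : X.weightRel.ℓ i x = X.cls i x := rfl

theorem exists_decomposition {a : A} (h : a ∈ X.J) :
    ∃ (b : A) (x : Fin 3 → X.wt), X.Fixed 1 b ∧
      Ideal.Quotient.mk X.I a = X.cls 0 b + ∑ i, X.weightRel.ℓ i (x i) := by
  have h1 := X.s₁_mem a h
  have h2 := X.s₂_mem a h
  have h3 := X.s₁_mem _ h2
  have g1 : ∀ c, X.s₁ (X.γ c) = X.γ (X.s₁ (X.s₂ c)) := fun c => by
    rw [X.γ_s₁, X.γ_s₂, ← X.s₁_s₂, X.s₂_s₂]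
  have g2 : ∀ c, X.s₂ (X.γ c) = X.γ (X.s₁ c) := fun c => (X.γ_s₁ c).symm
  let b := (1 / 4 : ℂ) • (a + X.s₁ a + X.s₂ a + X.s₁ (X.s₂ a))
  let x := (1 / 4 : ℂ) • (a + X.s₁ a - X.s₂ a - X.s₁ (X.s₂ a))
  let y := (1 / 4 : ℂ) • (a - X.s₁ a + X.s₂ a - X.s₁ (X.s₂ a))
  let z := (1 / 4 : ℂ) • (a - X.s₁ a - X.s₂ a + X.s₁ (X.s₂ a))
  have hb : X.Fixed 1 b := by
    refine ⟨?_, ?_, ?_⟩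
    · rw [pow_one]
      exact X.J.smul_mem _ (add_mem (add_mem (add_mem h h1) h2) h3)
    · simp only [b, map_smul, map_add, X.s₁_s₁]; congr 1; abel
    · simp only [b, map_smul, map_add, X.s₂_s₂, ← X.s₁_s₂]; congr 1; abel
  have hx : x ∈ X.wt := by
    refine ⟨X.J.smul_mem _ (sub_mem (sub_mem (add_mem h h1) h2) h3), ?_, ?_⟩
    · simp only [x, map_smul, map_add, map_sub, X.s₁_s₁]; congr 1; abel
    · simp only [x, map_smul, map_add, map_sub, X.s₂_s₂, ← X.s₁_s₂, ← smul_neg]; congr 1; abel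
  have hyJ : y ∈ X.J := X.J.smul_mem _ (sub_mem (add_mem (sub_mem h h1) h2) h3)
  have hzJ : z ∈ X.J := X.J.smul_mem _ (add_mem (sub_mem (sub_mem h h1) h2) h3)
  have hy1 : X.s₁ y = -y := by
    simp only [y, map_smul, map_add, map_sub, X.s₁_s₁, ← smul_neg]; congr 1; abel
  have hy2 : X.s₂ y = y := by
    simp only [y, map_smul, map_add, map_sub, X.s₂_s₂, ← X.s₁_s₂]; congr 1; abel
  have hz1 : X.s₁ z = -z := by
    simp only [z, map_smul, map_add, map_sub, X.s₁_s₁, ← smul_neg]; congr 1; abel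
  have hz2 : X.s₂ z = -z := by
    simp only [z, map_smul, map_add, map_sub, X.s₂_s₂, ← X.s₁_s₂, ← smul_neg]; congr 1; abel
  have hy : X.γ (X.γ y) ∈ X.wt := by
    refine ⟨X.γ_mem _ (X.γ_mem _ hyJ), ?_, ?_⟩
    · rw [g1, g2, g1, ← X.s₁_s₂, X.s₁_s₁, hy2]
    · rw [g2, g1, hy2, hy1, map_neg, map_neg]
  have hz : X.γ z ∈ X.wt := by
    refine ⟨X.γ_mem _ hzJ, ?_, ?_⟩
    · rw [g1, hz2, map_neg, hz1, neg_neg]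
    · rw [g2, hz1, map_neg]
  refine ⟨b, ![⟨x, hx⟩, ⟨_, hy⟩, ⟨_, hz⟩], hb, ?_⟩
  simp only [weightRel_ℓ, Fin.sum_univ_three, cls_apply, rot_zero, Matrix.cons_val_zero,
    Matrix.cons_val_one, Matrix.cons_val, rot_one, rot_two, X.γ_γ_γ, ← map_add]
  congr 1
  simp only [b, x, y, z]
  module

theorem prod_mem_of_forall {n : ℕ} (f : Fin n → A) (hf : ∀ k, f k ∈ X.J)
    (H : ∀ (l : Fin 3 → List X.wt) (t : List (A ⧸ X.I)),
      (∀ a ∈ t, ∃ b, X.Fixed 1 b ∧ X.cls 0 b = a) → t.length + ∑ i, (l i).length = n →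
      t.prod * ∏ i, X.weightRel.P i (l i) = 0) :
    ∏ k, f k ∈ X.I := by
  choose b x hb hx using fun k => X.exists_decomposition (hf k)
  rw [← Ideal.Quotient.eq_zero_iff_mem, map_prod]
  simp only [hx]
  let e : Fin n → Option (Fin 3) → A ⧸ X.I := fun k o =>
    o.elim (X.cls 0 (b k)) (fun i => X.weightRel.ℓ i (x k i))
  have he : ∀ k, X.cls 0 (b k) + ∑ i, X.weightRel.ℓ i (x k i) = ∑ o, e k o := fun k => by
    rw [Fintype.sum_option]; rfl
  simp only [he]
  rw [Finset.prod_univ_sum]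
  refine Finset.sum_eq_zero fun c _ => ?_
  have h1 := Finset.prod_fiberwise (s := Finset.univ) c (fun k => e k (c k))
  have h2 := Finset.card_eq_sum_card_fiberwise (s := (Finset.univ : Finset (Fin n)))
    (t := Finset.univ) (f := c) (by simp)
  rw [Fintype.sum_option] at h2
  rw [Fintype.prod_option] at h1
  rw [← h1]
  have h3 := H (fun i => (Finset.univ.filter (c · = some i)).toList.map (x · i))
    ((Finset.univ.filter (c · = none)).toList.map fun k => X.cls 0 (b k))
    (by simpa using fun k _ => ⟨b k, hb k, rfl⟩) (by simpa using h2.symm)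
  rw [← h3, Finset.prod_map_toList]
  congr 1
  · exact Finset.prod_congr rfl fun k hk => by simp [e, (Finset.mem_filter.1 hk).2]
  · refine Finset.prod_congr rfl fun i _ => ?_
    rw [WeightRel.P, List.map_map, Finset.prod_map_toList]
    exact Finset.prod_congr rfl fun k hk => by simp [e, (Finset.mem_filter.1 hk).2]

theorem prod_ten_mem (f : Fin 10 → A) (hf : ∀ k, f k ∈ X.J) : ∏ k, f k ∈ X.I := by
  refine prod_mem_of_forall f hf fun l t ht hc => X.weightRel.eq_zero_of_ten l t ?_ hc
  intro a ha b hb c hc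
  obtain ⟨a, ha', rfl⟩ := ht a ha
  obtain ⟨b, hb', rfl⟩ := ht b hb
  obtain ⟨c, hc', rfl⟩ := ht c hc
  exact ha'.mul_mul_eq_zero hb' hc' le_rfl le_rfl le_rfl (by have := X.four_le; omega) _ _ _

theorem prod_six_mem (hm : 6 ≤ X.m) (f : Fin 6 → A) (hf : ∀ k, f k ∈ X.J) :
    ∏ k, f k ∈ X.I := by
  have hℓ : ∀ i (x y : X.wt), X.weightRel.ℓ i x * X.weightRel.ℓ i y = X.cls i (x * y : A) :=
    fun i x y => by
      rw [weightRel_ℓ, weightRel_ℓ, ← map_mul]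
  refine prod_mem_of_forall f hf fun l t ht hc =>
    X.weightRel.eq_zero_of_six l t ?_ ?_ ?_ ?_ ?_ hc
  · intro a ha b hb c hc
    obtain ⟨a, ha', rfl⟩ := ht a ha
    obtain ⟨b, hb', rfl⟩ := ht b hb
    obtain ⟨c, hc', rfl⟩ := ht c hc
    exact ha'.mul_mul_eq_zero hb' hc' le_rfl le_rfl le_rfl (by omega) _ _ _
  · intro a ha b hb i x y
    obtain ⟨a, ha', rfl⟩ := ht a ha
    obtain ⟨b, hb', rfl⟩ := ht b hb
    rw [hℓ]
    exact ha'.mul_mul_eq_zero hb' (wt_mul x.2 y.2) le_rfl le_rfl (by omega) (by omega) _ _ _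
  · intro a ha i j x y z w
    obtain ⟨a, ha', rfl⟩ := ht a ha
    rw [hℓ, hℓ]
    exact ha'.mul_mul_eq_zero (wt_mul x.2 y.2) (wt_mul z.2 w.2) le_rfl (by omega) (by omega)
      (by omega) _ _ _
  · intro a ha i u v w x y
    obtain ⟨a, ha', rfl⟩ := ht a ha
    have h3 : X.weightRel.ℓ 0 u * X.weightRel.ℓ 1 v * X.weightRel.ℓ 2 w =
        X.cls 0 (u * X.rot 1 v * X.rot 2 w : A) := by
      simp only [map_mul, cls_rot, weightRel_ℓ, zero_add]
    rw [hℓ, h3]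
    exact ha'.mul_mul_eq_zero (wt_mul x.2 y.2) (wt_triple u.2 v.2 w.2) le_rfl (by omega) (by omega)
      (by omega) _ _ _
  · intro i j k u v w x y z
    rw [hℓ, hℓ, hℓ]
    exact (wt_mul u.2 v.2).mul_mul_eq_zero (wt_mul w.2 x.2) (wt_mul y.2 z.2) (by omega) (by omega)
      (by omega) (by omega) _ _ _

end AltSetup
end NoetherIndex

namespace NoetherIndex

open Polynomial in
/-- The endomorphism of the Rees algebra induced by an endomorphism preserving the ideal. -/
noncomputable def reesMap {A : Type*} [CommRing A] [Algebra ℂ A] {J : Ideal A} (ψ : A →ₐ[ℂ] A)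
    (h : ∀ a ∈ J, ψ a ∈ J) : reesAlgebra J →ₐ[ℂ] reesAlgebra J where
  toFun p := ⟨p.1.map ψ, fun i => by
    have h1 : (J ^ i).map ψ.toRingHom ≤ J ^ i := by
      rw [Ideal.map_pow]
      exact Ideal.pow_right_mono (Ideal.map_le_iff_le_comap.2 h) i
    rw [coeff_map]
    exact h1 (Ideal.mem_map_of_mem _ (p.2 i))⟩
  map_one' := Subtype.ext (by simp)
  map_mul' p q := Subtype.ext (by simp)
  map_zero' := Subtype.ext (by simp)
  map_add' p q := Subtype.ext (by simp)
  commutes' c := Subtype.ext (by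
    change Polynomial.map _ (algebraMap ℂ A[X] c) = algebraMap ℂ A[X] c
    rw [Polynomial.algebraMap_apply, map_C]
    simp)

theorem reesMap_coeff {A : Type*} [CommRing A] [Algebra ℂ A] {J : Ideal A} (ψ : A →ₐ[ℂ] A)
    (h : ∀ a ∈ J, ψ a ∈ J) (p : reesAlgebra J) (n : ℕ) :
    (reesMap ψ h p).1.coeff n = ψ (p.1.coeff n) :=
  Polynomial.coeff_map _ _

section Rees

variable {A : Type*} [CommRing A] [Algebra ℂ A] (J I : Ideal A)

open Polynomial

theorem rees_ext {p q : reesAlgebra J} (h : ∀ n, p.1.coeff n = q.1.coeff n) : p = q :=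
  Subtype.ext (Polynomial.ext h)

/-- The elements of the Rees algebra whose coefficients lie in products of `I` and powers of
`J`. -/
def reesIdeal (m : ℕ) : Ideal (reesAlgebra J) where
  carrier := {p | ∀ n, p.1.coeff n ∈ I * J ^ (n - m)}
  add_mem' hp hq n := by
    change (_ + _ : A[X]).coeff n ∈ _
    rw [coeff_add]; exact add_mem (hp n) (hq n)
  zero_mem' n := by simp
  smul_mem' r p hp n := by
    change (r.1 * p.1).coeff n ∈ _
    rw [coeff_mul]
    refine Ideal.sum_mem _ fun x hx => ?_
    have h1 := Ideal.mul_mem_mul (r.2 x.1) (hp x.2)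
    rw [mul_left_comm, ← pow_add] at h1
    have hx := Finset.HasAntidiagonal.mem_antidiagonal.1 hx
    exact Ideal.mul_mono_right (Ideal.pow_le_pow_right (by omega)) h1

/-- The component of degree `d` of the Rees algebra. -/
def reesDeg (d : ℕ) : Submodule ℂ (reesAlgebra J) where
  carrier := {p | ∀ n, n ≠ d → p.1.coeff n = 0}
  add_mem' hp hq n hn := by
    change (_ + _ : A[X]).coeff n = 0
    rw [coeff_add, hp n hn, hq n hn, add_zero]
  zero_mem' n _ := by simp
  smul_mem' c p hp n hn := by
    change (c • p.1).coeff n = 0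
    rw [coeff_smul, hp n hn, smul_zero]

theorem reesDeg_pow_le (d : ℕ) : reesDeg J 1 ^ d ≤ reesDeg J d := by
  induction d with
  | zero =>
    rw [pow_zero, Submodule.one_le]
    intro n hn
    simp [coeff_one, hn]
  | succ d ih =>
    rw [pow_succ, Submodule.mul_le]
    intro p hp q hq n hn
    change (p.1 * q.1).coeff n = 0
    rw [coeff_mul]
    refine Finset.sum_eq_zero fun x hx => ?_
    have hx := Finset.HasAntidiagonal.mem_antidiagonal.1 hx
    by_cases h1 : x.1 = d
    · rw [hq x.2 (by omega), mul_zero]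
    · rw [ih hp x.1 h1, zero_mul]

end Rees

/-- Generators of a group satisfying the relations of the alternating group of degree four. -/
structure AltGenerators {T : Type*} [Group T] (v w g : T) : Prop where
  v_mul_v : v * v = 1
  w_mul_w : w * w = 1
  v_mul_w : v * w = w * v
  g_pow : g * g * g = 1
  g_mul_v : g * v = w * g
  g_mul_w : g * w = v * (w * g)
  closure_eq : Subgroup.closure {v, w, g} = ⊤

variable {T : Type} [Group T] {v w g : T}

theorem AltGenerators.invariant (h : AltGenerators v w g) {A : Type} [CommRing A] [Algebra ℂ A]
    (φ : T →* (A →ₐ[ℂ] A)) {a : A} (hv : φ v a = a) (hw : φ w a = a) (hg : φ g a = a) (t : T) :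
    φ t a = a := by
  have ht : t ∈ Subgroup.closure {v, w, g} := h.closure_eq ▸ Subgroup.mem_top t
  induction ht using Subgroup.closure_induction with
  | mem x hx => rcases hx with rfl | rfl | rfl <;> assumption
  | one => exact act_one φ a
  | mul x y _ _ hx hy => rw [act_mul, hy, hx]
  | inv x _ hx => rw [← hx, ← act_mul, inv_mul_cancel, act_one, hx]

theorem AltGenerators.six_mem (h : AltGenerators v w g) {A : Type} [CommRing A] [Algebra ℂ A]
    (φ : T →* (A →ₐ[ℂ] A)) (J : Ideal A) (hJ : ∀ t, ∀ a ∈ J, φ t a ∈ J) (f : Fin 6 → A)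
    (hf : ∀ k, f k ∈ J) : ∏ k, f k ∈ invIdeal φ J := by
  have hle : ∀ d, 1 ≤ d → (J.restrictScalars ℂ) ^ d ≤ J.restrictScalars ℂ := by
    intro d hd
    obtain ⟨e, rfl⟩ := Nat.exists_eq_add_of_le' hd
    rw [pow_succ, Submodule.mul_le]
    exact fun a _ b hb => J.mul_mem_left a hb
  let X : AltSetup A :=
    { s₁ := φ v, s₂ := φ w, γ := φ g, J := J.restrictScalars ℂ, I := invIdeal φ J, m := 6
      four_le := by norm_num
      s₁_s₁ := fun a => by rw [← act_mul, h.v_mul_v, act_one]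
      s₂_s₂ := fun a => by rw [← act_mul, h.w_mul_w, act_one]
      s₁_s₂ := fun a => by rw [← act_mul, h.v_mul_w, act_mul]
      γ_γ_γ := fun a => by rw [← act_mul, ← act_mul, h.g_pow, act_one]
      γ_s₁ := fun a => by rw [← act_mul, h.g_mul_v, act_mul]
      γ_s₂ := fun a => by rw [← act_mul, h.g_mul_w, act_mul, act_mul]
      s₁_mem := fun a => hJ v a
      s₂_mem := fun a => hJ w a
      γ_mem := fun a => hJ g a
      inv_mem := fun d hd _ a ha hv hw hg =>
        Ideal.subset_span ⟨hle d hd ha, h.invariant φ hv hw hg⟩ }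
  exact X.prod_six_mem le_rfl f hf

theorem AltGenerators.ten_mem (h : AltGenerators v w g) {A : Type} [CommRing A] [Algebra ℂ A]
    (φ : T →* (A →ₐ[ℂ] A)) (J : Ideal A) (hJ : ∀ t, ∀ a ∈ J, φ t a ∈ J) (f : Fin 10 → A)
    (hf : ∀ k, f k ∈ J) : ∏ k, f k ∈ invIdeal φ J * J ^ 6 := by
  have hdeg : ∀ t, ∀ p ∈ reesDeg J 1, reesMap (φ t) (hJ t) p ∈ reesDeg J 1 := fun t p hp n hn => by
    rw [reesMap_coeff, hp n hn, map_zero]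
  let X : AltSetup (reesAlgebra J) :=
    { s₁ := reesMap (φ v) (hJ v), s₂ := reesMap (φ w) (hJ w), γ := reesMap (φ g) (hJ g)
      J := reesDeg J 1, I := reesIdeal J (invIdeal φ J) 4, m := 4
      four_le := le_rfl
      s₁_s₁ := fun a => rees_ext J fun n => by
        simp only [reesMap_coeff]; rw [← act_mul, h.v_mul_v, act_one]
      s₂_s₂ := fun a => rees_ext J fun n => by
        simp only [reesMap_coeff]; rw [← act_mul, h.w_mul_w, act_one]
      s₁_s₂ := fun a => rees_ext J fun n => by
        simp only [reesMap_coeff]; rw [← act_mul, h.v_mul_w, act_mul]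
      γ_γ_γ := fun a => rees_ext J fun n => by
        simp only [reesMap_coeff]; rw [← act_mul, ← act_mul, h.g_pow, act_one]
      γ_s₁ := fun a => rees_ext J fun n => by
        simp only [reesMap_coeff]; rw [← act_mul, h.g_mul_v, act_mul]
      γ_s₂ := fun a => rees_ext J fun n => by
        simp only [reesMap_coeff]; rw [← act_mul, h.g_mul_w, act_mul, act_mul]
      s₁_mem := hdeg v
      s₂_mem := hdeg w
      γ_mem := hdeg g
      inv_mem := fun d hd hd4 p hp hv hw hg n => by
        by_cases hn : n = d
        · subst hn
          rw [Nat.sub_eq_zero_of_le hd4, pow_zero, mul_one]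
          refine Ideal.subset_span ⟨?_, h.invariant φ ?_ ?_ ?_⟩
          · exact Ideal.pow_le_self (by omega) (p.2 n)
          · rw [← reesMap_coeff (φ v) (hJ v), hv]
          · rw [← reesMap_coeff (φ w) (hJ w), hw]
          · rw [← reesMap_coeff (φ g) (hJ g), hg]
        · rw [reesDeg_pow_le J d hp n hn]
          exact zero_mem _ }
  let F : Fin 10 → reesAlgebra J := fun k =>
    ⟨Polynomial.monomial 1 (f k), reesAlgebra.monomial_mem.2 (by simpa using hf k)⟩
  have h1 : ∏ k, F k ∈ X.I := X.prod_ten_mem F fun k n hn => by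
    simp [F, Polynomial.coeff_monomial, hn.symm]
  have h2 := h1 10
  have h3 : (∏ k, F k).1 = Polynomial.monomial 10 (∏ k, f k) := by
    rw [← Subalgebra.coe_val, map_prod]
    simp [F, ← Polynomial.C_mul_X_pow_eq_monomial, Finset.prod_mul_distrib]
  rwa [h3, Polynomial.coeff_monomial, if_pos rfl] at h2

/-- Every product of `n` elements is an element of the `n`-th power. -/
theorem multiset_prod_mem_pow {A : Type*} [CommRing A] {J : Ideal A} {s : Multiset A}
    (h : ∀ a ∈ s, a ∈ J) : s.prod ∈ J ^ s.card := by
  induction s using Multiset.induction_on with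
  | empty => simp
  | cons a s ih =>
    rw [Multiset.prod_cons, Multiset.card_cons, pow_succ']
    exact Ideal.mul_mem_mul (h a (by simp)) (ih fun b hb => h b (by simp [hb]))

open scoped Pointwise in
theorem ideal_pow_le_of_forall {A : Type*} [CommRing A] {J K : Ideal A} {n : ℕ}
    (h : ∀ f : Fin n → A, (∀ k, f k ∈ J) → ∏ k, f k ∈ K) : J ^ n ≤ K := by
  have : J ^ n = Ideal.span ((J : Set A) ^ n) := by
    rw [← ideal_span_pow, Ideal.span_eq]
  rw [this, Ideal.span_le]
  intro a ha
  obtain ⟨f, rfl⟩ := Set.mem_pow.1 ha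
  rw [List.prod_ofFn]
  exact h _ fun k => (f k).2

theorem AltGenerators.absorbs (h : AltGenerators v w g) {k : ℕ} (hk : k ≠ 0) :
    Absorbs T (4 * k + 2) k := by
  intro A _ _ φ J hJ s hs hsJ
  have h6 : J ^ 6 ≤ invIdeal φ J := ideal_pow_le_of_forall (h.six_mem φ J hJ)
  have h10 : J ^ 10 ≤ invIdeal φ J * J ^ 6 := ideal_pow_le_of_forall (h.ten_mem φ J hJ)
  have key : ∀ k, J ^ (4 * (k + 1) + 2) ≤ invIdeal φ J ^ (k + 1) := by
    intro k
    induction k with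
    | zero => simpa using h6
    | succ k ih =>
      calc J ^ (4 * (k + 1 + 1) + 2) = J ^ 10 * J ^ (4 * k) := by rw [← pow_add]; congr 1; ring
        _ ≤ invIdeal φ J * J ^ 6 * J ^ (4 * k) := Ideal.mul_mono_left h10
        _ = invIdeal φ J * J ^ (4 * (k + 1) + 2) := by
          rw [mul_assoc, ← pow_add]; congr 2; ring
        _ ≤ invIdeal φ J * invIdeal φ J ^ (k + 1) := Ideal.mul_mono_right ih
        _ = _ := (pow_succ' _ _).symm
  obtain ⟨k, rfl⟩ := Nat.exists_eq_succ_of_ne_zero hk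
  exact key k (hs ▸ multiset_prod_mem_pow hsJ)

end NoetherIndex

namespace NoetherIndex

/-- Products of few elements of a stable ideal are absorbed, with `27 / 10` of the trivial rate. -/
def Reduces (T : Type) [Group T] (k : ℕ) : Prop :=
  ∃ d, Absorbs T d k ∧ 27 * d < 10 * k * Nat.card T

theorem Reduces.of_quotient {T : Type} [Group T] [Finite T] (K : Subgroup T) [K.Normal] {k : ℕ}
    (h : Reduces (T ⧸ K) k) : Reduces T k := by
  obtain ⟨d, hd, hlt⟩ := h
  refine ⟨_, Absorbs.of_quotient K hd, ?_⟩
  have h0 : 0 < Nat.card K := Nat.card_pos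
  rw [Subgroup.card_eq_card_quotient_mul_card_subgroup K]
  nlinarith [Nat.mul_lt_mul_of_pos_right hlt h0]

theorem Reduces.of_mulEquiv {T T' : Type} [Group T] [Group T'] (e : T ≃* T') {k : ℕ}
    (h : Reduces T k) : Reduces T' k := by
  obtain ⟨d, hd, hlt⟩ := h
  exact ⟨d, Absorbs.of_mulEquiv e hd, by rwa [← Nat.card_congr e.toEquiv]⟩

theorem Reduces.of_surjective {T T' : Type} [Group T] [Group T'] [Finite T] {f : T →* T'}
    (hf : Function.Surjective f) {k : ℕ} (h : Reduces T' k) : Reduces T k :=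
  Reduces.of_quotient f.ker (h.of_mulEquiv (QuotientGroup.quotientKerEquivOfSurjective f hf).symm)

theorem Reduces.of_subgroup {T : Type} [Group T] [Finite T] (H : Subgroup T)
    (h : Reduces H H.index) : Reduces T 1 := by
  obtain ⟨d, hd, hlt⟩ := h
  refine ⟨d, Absorbs.of_subgroup H hd, ?_⟩
  rw [mul_assoc, mul_comm H.index, Subgroup.card_mul_index] at hlt
  simpa using hlt

theorem Reduces.of_one {T : Type} [Group T] (h : Reduces T 1) {m : ℕ} (hm : m ≠ 0) :
    Reduces T m := by
  obtain ⟨d, hd, hlt⟩ := h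
  refine ⟨_, hd.mul m, ?_⟩
  nlinarith [Nat.mul_lt_mul_of_pos_right hlt (Nat.pos_of_ne_zero hm)]

theorem card_elementary (p r : ℕ) [Fact p.Prime] :
    Nat.card (Multiplicative (Fin r → ZMod p)) = p ^ r := by
  simp [Nat.card_eq_fintype_card, ZMod.card]

theorem reduces_rank_two {p : ℕ} [Fact p.Prime] (hp : 5 ≤ p) {k : ℕ} (hk : k ≠ 0) :
    Reduces (Multiplicative (Fin 2 → ZMod p)) k := by
  have h := zeroSum_elementary p 2
  refine ⟨_, absorbs_elementary (c := 0) h h (by omega) (by omega) k, ?_⟩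
  rw [card_elementary]
  obtain ⟨q, rfl⟩ := Nat.exists_eq_add_of_le hp
  have e : 2 * (5 + q - 1) + 1 = 9 + 2 * q := by omega
  rw [e]
  have : 27 * (9 + 2 * q) < 10 * (5 + q) ^ 2 := by nlinarith
  nlinarith [Nat.mul_lt_mul_of_pos_right this (Nat.pos_of_ne_zero hk)]

theorem reduces_rank_two_three {k : ℕ} (hk : 7 ≤ k) :
    Reduces (Multiplicative (Fin 2 → ZMod 3)) k := by
  have h := zeroSum_elementary 3 2
  have : Fact (Nat.Prime 3) := ⟨Nat.prime_three⟩
  refine ⟨_, absorbs_elementary (c := 2) shortZeroSum_three h (by omega) (by omega) k, ?_⟩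
  rw [card_elementary]
  omega

theorem reduces_rank_three_two {k : ℕ} (hk : 5 ≤ k) :
    Reduces (Multiplicative (Fin 3 → ZMod 2)) k := by
  have h := zeroSum_elementary 2 3
  refine ⟨_, absorbs_elementary (c := 4) shortZeroSum_two h (by omega) (by omega) k, ?_⟩
  rw [card_elementary]
  omega

theorem AltGenerators.reduces {T : Type} [Group T] {v w g : T} (h : AltGenerators v w g)
    (hT : 12 ≤ Nat.card T) {k : ℕ} (hk : 5 ≤ k) : Reduces T k :=
  ⟨_, h.absorbs (by omega), by nlinarith⟩

theorem exists_surjective_of_smul_eq_zero {A : Type*} [AddCommGroup A] [Finite A] {p : ℕ}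
    [hp : Fact p.Prime] (h : ∀ x : A, p • x = 0) {r : ℕ} (hr : p ^ r ≤ Nat.card A) :
    ∃ f : A →+ (Fin r → ZMod p), Function.Surjective f := by
  obtain ⟨_⟩ : Nonempty (Module (ZMod p) A) := ⟨AddCommGroup.zmodModule h⟩
  have hle : r ≤ Module.finrank (ZMod p) A := by
    rw [← Nat.pow_le_pow_iff_right hp.out.one_lt]
    convert hr
    rw [Module.natCard_eq_pow_finrank (K := ZMod p) (V := A), Nat.card_zmod]
  let b := Module.finBasis (ZMod p) A
  have h1 := LinearMap.funLeft_surjective_of_injective (ZMod p) (ZMod p) _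
      (Fin.castLE_injective hle)
  exact ⟨((LinearMap.funLeft (ZMod p) (ZMod p) (Fin.castLE hle)).comp
    b.equivFun.toLinearMap).toAddMonoidHom, h1.comp b.equivFun.surjective⟩

theorem exists_surjective_elementary {H : Type} [Group H] [Finite H] {p : ℕ} [Fact p.Prime]
    (N : Subgroup H) [N.Normal] (hpow : ∀ x : H, x ^ p ∈ N) (hcomm : commutator H ≤ N) {r : ℕ}
    (hr : p ^ r ≤ N.index) :
    ∃ f : H →* Multiplicative (Fin r → ZMod p), Function.Surjective f := by
  have hc : IsMulCommutative (H ⧸ N) :=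
    Subgroup.Normal.quotient_commutative_iff_commutator_le.mpr hcomm
  letI : CommGroup (H ⧸ N) := { mul_comm := hc.is_comm.comm }
  obtain ⟨L, hL⟩ := exists_surjective_of_smul_eq_zero (A := Additive (H ⧸ N)) (p := p) (r := r) (by
    intro x
    obtain ⟨y, hy⟩ := QuotientGroup.mk_surjective (s := N) x.toMul
    have : x = Additive.ofMul (y : H ⧸ N) := by rw [hy]; rfl
    rw [this, ← ofMul_pow, ← QuotientGroup.mk_pow, (QuotientGroup.eq_one_iff _).2 (hpow y)]
    rfl) hr
  refine ⟨(AddMonoidHom.toMultiplicativeRight L).comp (QuotientGroup.mk' N), ?_⟩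
  intro y
  obtain ⟨x, hx⟩ := hL y.toAdd
  obtain ⟨z, hz⟩ := QuotientGroup.mk_surjective (s := N) x.toMul
  refine ⟨z, ?_⟩
  change Multiplicative.ofAdd (L (Additive.ofMul (z : H ⧸ N))) = y
  rw [hz]
  simp [hx]

end NoetherIndex

namespace NoetherIndex

theorem coatom_of_isPGroup {P : Type} [Group P] [Finite P] {p : ℕ} [hp : Fact p.Prime]
    (hP : IsPGroup p P) {M : Subgroup P} (hM : IsCoatom M) :
    (∀ x : P, x ^ p ∈ M) ∧ commutator P ≤ M := by
  have hn : Group.IsNilpotent P := hP.isNilpotent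
  have hnor : M.Normal :=
    Subgroup.NormalizerCondition.normal_of_coatom M Group.normalizerCondition_of_isNilpotent hM
  have hQ : IsPGroup p (P ⧸ M) := hP.to_quotient M
  have hnt : Nontrivial (P ⧸ M) := (QuotientGroup.nontrivial_iff).2 hM.1
  have hdvd : p ∣ Nat.card (P ⧸ M) := by
    obtain ⟨n, hn0, hn⟩ := hQ.nontrivial_iff_card.1 hnt
    rw [hn]; exact dvd_pow_self p hn0.ne'
  obtain ⟨z, hz⟩ := exists_prime_orderOf_dvd_card' p hdvd
  have htop : Subgroup.zpowers z = ⊤ := by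
    have hle : M ≤ (Subgroup.zpowers z).comap (QuotientGroup.mk' M) := by
      intro x hx
      have : (QuotientGroup.mk' M) x = 1 := (QuotientGroup.eq_one_iff x).2 hx
      rw [Subgroup.mem_comap, this]
      exact one_mem _
    have hsurj := QuotientGroup.mk'_surjective M
    rcases hle.eq_or_lt with h | h
    · exfalso
      have h1 : Subgroup.zpowers z = ⊥ := by
        rw [← Subgroup.map_comap_eq_self_of_surjective hsurj (Subgroup.zpowers z), ← h]
        simp
      rw [Subgroup.zpowers_eq_bot] at h1
      rw [h1, orderOf_one] at hz
      exact hp.out.one_lt.ne hz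
    · have := hM.2 _ h
      rw [← Subgroup.map_comap_eq_self_of_surjective hsurj (Subgroup.zpowers z), this]
      exact Subgroup.map_top_of_surjective _ hsurj
  have hc : ∀ x : P ⧸ M, ∃ i : ℤ, z ^ i = x := fun x =>
    Subgroup.mem_zpowers_iff.1 (htop ▸ Subgroup.mem_top x)
  constructor
  · intro x
    rw [← QuotientGroup.eq_one_iff, QuotientGroup.mk_pow]
    obtain ⟨i, hi⟩ := hc x
    rw [← hi, ← zpow_natCast, ← zpow_mul, mul_comm, zpow_mul, zpow_natCast, ← hz, pow_orderOf_eq_one,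
      one_zpow]
  · rw [← Subgroup.Normal.quotient_commutative_iff_commutator_le]
    refine ⟨⟨fun a b => ?_⟩⟩
    obtain ⟨i, rfl⟩ := hc a
    obtain ⟨j, rfl⟩ := hc b
    rw [← zpow_add, ← zpow_add, add_comm]

theorem le_frattini {P : Type} [Group P] {K : Subgroup P} (h : ∀ M : Subgroup P, IsCoatom M → K ≤ M) :
    K ≤ frattini P := by
  rw [frattini, Order.radical]
  exact le_iInf₂ h

theorem pow_mem_frattini {P : Type} [Group P] [Finite P] {p : ℕ} [hp : Fact p.Prime]
    (hP : IsPGroup p P) (x : P) : x ^ p ∈ frattini P := by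
  have : Subgroup.zpowers (x ^ p) ≤ frattini P := le_frattini fun M hM => by
    simpa using (coatom_of_isPGroup hP hM).1 x
  simpa using this

theorem commutator_le_frattini {P : Type} [Group P] [Finite P] {p : ℕ} [hp : Fact p.Prime]
    (hP : IsPGroup p P) : commutator P ≤ frattini P :=
  le_frattini fun _ hM => (coatom_of_isPGroup hP hM).2

theorem isCyclic_of_isCyclic_quotient_frattini {P : Type} [Group P] [Finite P]
    (h : IsCyclic (P ⧸ frattini P)) : IsCyclic P := by
  obtain ⟨z, hz⟩ := h.exists_generator
  obtain ⟨x, rfl⟩ := QuotientGroup.mk_surjective z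
  refine ⟨x, ?_⟩
  have : Subgroup.zpowers x ⊔ frattini P = ⊤ := by
    rw [eq_top_iff]
    intro y _
    obtain ⟨i, hi⟩ := Subgroup.mem_zpowers_iff.1 (hz y)
    rw [← QuotientGroup.mk_zpow, QuotientGroup.eq] at hi
    have := Subgroup.mul_mem_sup (Subgroup.zpow_mem _ (Subgroup.mem_zpowers x) i) hi
    simpa using this
  have h2 := frattini_nongenerating this
  intro y
  change y ∈ Subgroup.zpowers x
  rw [h2]; trivial

theorem sq_le_index_frattini {P : Type} [Group P] [Finite P] {p : ℕ} [hp : Fact p.Prime]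
    (hP : IsPGroup p P) (hc : ¬ IsCyclic P) : p ^ 2 ≤ (frattini P).index := by
  obtain ⟨n, hn⟩ := (hP.to_quotient (frattini P)).exists_card_eq
  change (frattini P).index = _ at hn
  rw [hn]
  apply Nat.pow_le_pow_right hp.out.pos
  by_contra! hlt
  apply hc
  apply isCyclic_of_isCyclic_quotient_frattini
  apply isCyclic_of_card_dvd_prime (p := p)
  change (frattini P).index ∣ p
  rw [hn]
  interval_cases n <;> simp

theorem card_dvd_factorial_index {G : Type} [Group G] [Finite G] [IsSimpleGroup G]
    {H : Subgroup G} (hH : H ≠ ⊤) : Nat.card G ∣ H.index.factorial := by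
  have hb : H.normalCore = ⊥ := by
    rcases (Subgroup.normalCore_normal H).eq_bot_or_eq_top with h | h
    · exact h
    · exact absurd (top_le_iff.1 (h ▸ H.normalCore_le)) hH
  rw [Subgroup.normalCore_eq_ker, MonoidHom.ker_eq_bot_iff] at hb
  have := Subgroup.card_dvd_of_injective _ hb
  rwa [Nat.card_perm] at this

theorem reduces_of_odd_sylow {G : Type} [Group G] [Finite G] [IsSimpleGroup G]
    (hG : ¬ Group.IsSolvable G) {p : ℕ} [hp : Fact p.Prime] (hp2 : p ≠ 2) (P : Sylow p G)
    (hc : ¬ IsCyclic P) : Reduces G 1 := by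
  have hsq := sq_le_index_frattini P.2 hc
  obtain ⟨f, hf⟩ := exists_surjective_elementary (frattini P) (pow_mem_frattini P.2)
    (commutator_le_frattini P.2) hsq
  apply Reduces.of_subgroup (P : Subgroup G)
  have hP : (P : Subgroup G) ≠ ⊤ := by
    intro h
    apply hG
    have h1 : IsPGroup p (⊤ : Subgroup G) := h ▸ P.2
    have h2 : IsPGroup p G := h1.of_equiv Subgroup.topEquiv
    have := h2.isNilpotent
    infer_instance
  have hk : (P : Subgroup G).index ≠ 0 := Subgroup.index_ne_zero_of_finite
  have hpd : ¬ p ∣ (P : Subgroup G).index := P.not_dvd_index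
  have h3 : 3 ≤ p := by
    have := hp.out.two_le
    omega
  refine Reduces.of_surjective hf ?_
  by_cases h5 : 5 ≤ p
  · exact reduces_rank_two h5 hk
  have hp3 : p = 3 := by
    have : p ≠ 4 := by rintro rfl; exact absurd hp.out (by norm_num)
    omega
  subst hp3
  apply reduces_rank_two_three
  have hd : 9 ∣ (P : Subgroup G).index.factorial := by
    obtain ⟨n, hn⟩ := (IsPGroup.to_quotient P.2 (frattini P)).exists_card_eq
    change (frattini P).index = _ at hn
    have h9 : 3 ^ 2 ∣ (frattini P).index := by
      rw [hn] at hsq ⊢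
      exact Nat.pow_dvd_pow _ ((Nat.pow_le_pow_iff_right (by norm_num)).1 hsq)
    exact (h9.trans (frattini P).index_dvd_card).trans
      ((Subgroup.card_subgroup_dvd_card _).trans (card_dvd_factorial_index hP))
  generalize (P : Subgroup G).index = k at hd hpd
  by_contra! hlt
  interval_cases k <;> revert hd hpd <;> decide

end NoetherIndex

namespace NoetherIndex

theorem eq_pow_of_odd_orderOf {T : Type*} [Group T] {y : T} (h : Odd (orderOf y)) :
    ∃ m, (y ^ 2) ^ m = y := by
  obtain ⟨j, hj⟩ := h
  refine ⟨j + 1, ?_⟩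
  rw [← pow_mul, show 2 * (j + 1) = orderOf y + 1 by omega, pow_succ, pow_orderOf_eq_one, one_mul]

theorem reduces_of_four_group {T : Type} [Group T] [Finite T] (V : Subgroup T) [hV : V.Normal]
    (hcard : Nat.card V = 4) (hsq : ∀ v ∈ V, v * v = 1) {y : T} (hy : Odd (orderOf y))
    (htop : V ⊔ Subgroup.zpowers y = ⊤) (hne : ∃ v ∈ V, y * v * y⁻¹ ≠ v) :
    12 ≤ Nat.card T ∧ ∀ k, 5 ≤ k → Reduces T k := by
  obtain ⟨v, hv, hvw⟩ := hne
  obtain ⟨w, hw_def⟩ : ∃ w, w = y * v * y⁻¹ := ⟨_, rfl⟩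
  have hw : w ∈ V := hw_def ▸ hV.conj_mem v hv y
  rw [← hw_def] at hvw
  have hyv : y * v = w * y := by rw [hw_def]; group
  have hv1 : v ≠ 1 := by
    rintro rfl; apply hvw; rw [hw_def]; simp
  have hw1 : w ≠ 1 := by
    intro h; apply hv1
    have := hyv; rw [h, one_mul] at this
    simpa using this
  have hcomm : v * w = w * v := by
    have h := hsq _ (mul_mem hv hw)
    calc v * w = (w * w) * (v * w) * (v * v) := by rw [hsq w hw, hsq v hv]; simp
      _ = w * (w * v) * (w * v) * v := by group
      _ = w * ((w * v) * (w * v)) * v := by group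
      _ = w * v := by rw [hsq _ (mul_mem hw hv)]; simp
  have hVset : ({1, v, w, v * w} : Set T) = V := by
    apply Set.eq_of_subset_of_ncard_le
    · intro x hx
      simp only [Set.mem_insert_iff, Set.mem_singleton_iff] at hx
      rcases hx with rfl | rfl | rfl | rfl
      · exact one_mem V
      · exact hv
      · exact hw
      · exact mul_mem hv hw
    · have h1 : (V : Set T).ncard = 4 := hcard
      rw [h1]
      have hvw1 : v * w ≠ 1 := by
        intro h; apply hvw
        calc w = v * v * w := by rw [hsq v hv, one_mul]
          _ = v * (v * w) := by group
          _ = v := by rw [h, mul_one]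
      rw [Set.ncard_insert_of_notMem, Set.ncard_insert_of_notMem, Set.ncard_pair]
      · simpa using hv1
      · simp [hvw.symm, hw1]
      · simp [hv1.symm, hw1.symm, hvw1.symm]
    · exact Set.toFinite _
  have hyw : y * w = v * w * y := by
    have hmem : y * w * y⁻¹ ∈ V := hV.conj_mem w hw y
    rw [← SetLike.mem_coe, ← hVset] at hmem
    simp only [Set.mem_insert_iff, Set.mem_singleton_iff] at hmem
    rcases hmem with h | h | h | h
    · exact absurd (conj_eq_one_iff.1 h) hw1
    · exfalso
      have h2 : Commute (y ^ 2) v := by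
        rw [mul_inv_eq_iff_eq_mul] at h
        change y ^ 2 * v = v * y ^ 2
        rw [pow_two, mul_assoc, hyv, ← mul_assoc, h, mul_assoc]
      obtain ⟨m, hm⟩ := eq_pow_of_odd_orderOf hy
      have h3 : Commute y v := hm ▸ h2.pow_left m
      apply hvw
      rw [hw_def, h3.eq]; group
    · exfalso
      apply hvw
      rw [mul_inv_eq_iff_eq_mul, ← hyv] at h
      exact mul_left_cancel h
    · rw [mul_inv_eq_iff_eq_mul] at h
      exact h
  have hyvw : y * (v * w) = v * y := by
    rw [← mul_assoc, hyv, mul_assoc, hyw, ← mul_assoc, ← mul_assoc, ← hcomm, mul_assoc v, hsq w hw,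
      mul_one]
  have h3v : Commute (y ^ 3) v := by
    change y ^ 3 * v = v * y ^ 3
    rw [pow_succ, mul_assoc, hyv, pow_two, mul_assoc, ← mul_assoc y w, hyw, mul_assoc _ y,
      ← mul_assoc y, hyvw]
    group
  have h3w : Commute (y ^ 3) w := by
    change y ^ 3 * w = w * y ^ 3
    rw [pow_succ, mul_assoc, hyw, pow_two, mul_assoc, ← mul_assoc y (v * w), hyvw, mul_assoc _ y,
      ← mul_assoc y, hyv]
    group
  have h3V : ∀ x ∈ V, Commute (y ^ 3) x := by
    intro x hx
    rw [← SetLike.mem_coe, ← hVset] at hx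
    simp only [Set.mem_insert_iff, Set.mem_singleton_iff] at hx
    rcases hx with rfl | rfl | rfl | rfl
    · exact Commute.one_right _
    · exact h3v
    · exact h3w
    · exact h3v.mul_right h3w
  obtain ⟨K, hK⟩ : ∃ K, K = Subgroup.zpowers (y ^ 3) := ⟨_, rfl⟩
  have hKc : K ≤ Subgroup.center T := by
    rw [hK, Subgroup.zpowers_le, Subgroup.mem_center_iff]
    have : (⊤ : Subgroup T) ≤ Subgroup.centralizer {y ^ 3} := by
      rw [← htop, sup_le_iff, Subgroup.zpowers_le]
      constructor
      · intro x hx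
        rw [Subgroup.mem_centralizer_singleton_iff]
        exact (h3V x hx).eq.symm
      · rw [Subgroup.mem_centralizer_singleton_iff]
        exact ((Commute.refl y).pow_right 3).eq
    intro g
    exact Subgroup.mem_centralizer_singleton_iff.1 (this (Subgroup.mem_top g))
  have hKn : K.Normal := ⟨fun n hn g => by
    rw [Subgroup.mem_center_iff.1 (hKc hn) g, mul_inv_cancel_right]
    exact hn⟩
  have hVK : ∀ x ∈ V, x ∈ K → x = 1 := by
    intro x hx hxK
    rw [hK] at hxK
    have h1 : orderOf x ∣ orderOf y := (orderOf_dvd_of_mem_zpowers hxK).trans (orderOf_pow_dvd 3)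
    have h2 : orderOf x ∣ 2 := orderOf_dvd_of_pow_eq_one (by rw [pow_two, hsq x hx])
    have h4 : orderOf x ∣ 1 := by
      have : Nat.gcd (orderOf y) 2 = 1 := (Nat.coprime_two_right.2 hy)
      exact this ▸ Nat.dvd_gcd h1 h2
    exact orderOf_eq_one_iff.1 (Nat.dvd_one.1 h4)
  let q := QuotientGroup.mk' K
  have hgen : AltGenerators (q v) (q w) (q y) := by
    refine ⟨?_, ?_, ?_, ?_, ?_, ?_, ?_⟩
    · rw [← map_mul, hsq v hv, map_one]
    · rw [← map_mul, hsq w hw, map_one]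
    · rw [← map_mul, hcomm, map_mul]
    · rw [← map_mul, ← map_mul, ← pow_two, ← pow_succ]
      exact (QuotientGroup.eq_one_iff _).2 (hK ▸ Subgroup.mem_zpowers _)
    · rw [← map_mul, hyv, map_mul]
    · rw [← map_mul, hyw, map_mul, map_mul, mul_assoc]
    · have h1 : ({q v, q w, q y} : Set (T ⧸ K)) = q '' {v, w, y} := by
        simp [Set.image_insert_eq]
      rw [h1, ← MonoidHom.map_closure]
      have h2 : Subgroup.closure {v, w, y} = ⊤ := by
        rw [eq_top_iff, ← htop, sup_le_iff, Subgroup.zpowers_le]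
        have hv' : v ∈ Subgroup.closure {v, w, y} := Subgroup.subset_closure (by simp)
        have hw' : w ∈ Subgroup.closure {v, w, y} := Subgroup.subset_closure (by simp)
        refine ⟨?_, Subgroup.subset_closure (by simp)⟩
        intro x hx
        rw [← SetLike.mem_coe, ← hVset] at hx
        simp only [Set.mem_insert_iff, Set.mem_singleton_iff] at hx
        rcases hx with rfl | rfl | rfl | rfl
        · exact one_mem _
        · exact hv'
        · exact hw'
        · exact mul_mem hv' hw'
      rw [h2]
      exact Subgroup.map_top_of_surjective q (QuotientGroup.mk'_surjective K)
  have h12 : 12 ≤ Nat.card (T ⧸ K) := by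
    have h4 : 4 ∣ Nat.card (T ⧸ K) := by
      have := Subgroup.card_dvd_of_injective (q.comp V.subtype) (by
        rw [injective_iff_map_eq_one]
        rintro ⟨x, hx⟩ h
        exact Subtype.ext (hVK x hx ((QuotientGroup.eq_one_iff _).1 h)))
      rwa [hcard] at this
    have h3 : 3 ∣ Nat.card (T ⧸ K) := by
      have hn : q y ≠ 1 := by
        intro h
        have h1 := hgen.g_mul_v
        rw [h, one_mul, mul_one] at h1
        have h2 : v⁻¹ * w ∈ K := QuotientGroup.eq.1 h1
        have h3 := hVK _ (mul_mem (inv_mem hv) hw) h2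
        exact hvw (inv_mul_eq_one.1 h3).symm
      have : orderOf (q y) = 3 := orderOf_eq_prime (by rw [← hgen.g_pow, pow_succ, pow_two]) hn
      rw [← this]
      exact orderOf_dvd_natCard _
    have : 12 ∣ Nat.card (T ⧸ K) := by omega
    exact Nat.le_of_dvd Nat.card_pos this
  exact ⟨h12.trans (Nat.le_of_dvd Nat.card_pos K.index_dvd_card),
    fun k hk => Reduces.of_quotient K (hgen.reduces h12 hk)⟩

end NoetherIndex

namespace NoetherIndex

theorem conj_mem_map_of_characteristic {G : Type} [Group G] {Q : Subgroup G} (F : Subgroup Q)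
    [hF : F.Characteristic] {y : G} (hy : y ∈ Subgroup.normalizer (Q : Set G)) {x : G}
    (hx : x ∈ F.map Q.subtype) : y * x * y⁻¹ ∈ F.map Q.subtype := by
  obtain ⟨z, hz, rfl⟩ := hx
  refine ⟨Q.normalizerMonoidHom ⟨y, hy⟩ z, ?_, rfl⟩
  have := Subgroup.characteristic_iff_comap_eq.1 hF (Q.normalizerMonoidHom ⟨y, hy⟩)
  rw [← this] at hz
  exact hz

theorem mem_normalizer_map_of_characteristic {G : Type} [Group G] {Q : Subgroup G} (F : Subgroup Q)
    [hF : F.Characteristic] {y : G} (hy : y ∈ Subgroup.normalizer (Q : Set G)) :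
    y ∈ Subgroup.normalizer (F.map Q.subtype : Set G) := by
  rw [Subgroup.mem_normalizer_iff]
  refine fun x => ⟨conj_mem_map_of_characteristic F hy, fun h => ?_⟩
  have := conj_mem_map_of_characteristic F (inv_mem hy) h
  simpa [mul_assoc] using this

theorem index_ge_five {k m c : ℕ} (hk : k ≠ 0) (hm : 8 ≤ m) (h : k * m ∣ k.factorial * c)
    (hc : c = 1) : 5 ≤ k := by
  subst hc
  rw [mul_one] at h
  have h1 := Nat.le_of_dvd (Nat.factorial_pos k) h
  have h2 : k * 8 ≤ k.factorial := le_trans (Nat.mul_le_mul_left k hm) h1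
  by_contra! hlt
  interval_cases k <;> simp_all [Nat.factorial]

theorem index_ge_five_of_card {G : Type} [Group G] [Finite G] [IsSimpleGroup G] {H : Subgroup G}
    (hH : H ≠ ⊤) (h : 8 ≤ Nat.card H) : 5 ≤ H.index := by
  refine index_ge_five Subgroup.index_ne_zero_of_finite h (c := 1) ?_ rfl
  rw [mul_comm, Subgroup.card_mul_index, mul_one]
  exact card_dvd_factorial_index hH

theorem exists_commutator_notMem {G : Type} [Group G] {Q Φ : Subgroup G}
    (hQ : IsPGroup 2 Q) {y : G} (hy : Odd (orderOf y)) (hΦQ : Φ ≤ Q)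
    (hΦ : ∀ x ∈ Φ, y * x * y⁻¹ = x) (hc : ∃ x ∈ Q, y * x * y⁻¹ ≠ x) :
    ∃ x ∈ Q, y * x * y⁻¹ * x⁻¹ ∉ Φ := by
  by_contra! hcon
  obtain ⟨x, hx, hne⟩ := hc
  obtain ⟨f, hf⟩ : ∃ f, f = y * x * y⁻¹ * x⁻¹ := ⟨_, rfl⟩
  have hfΦ : f ∈ Φ := hf ▸ hcon x hx
  have hfc : Commute y f := by
    have := hΦ f hfΦ
    rwa [mul_inv_eq_iff_eq_mul] at this
  have hyx : y * x = f * x * y := by rw [hf]; group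
  have hpow : ∀ n : ℕ, y ^ n * x = f ^ n * x * y ^ n := by
    intro n
    induction n with
    | zero => simp
    | succ n ih =>
      rw [pow_succ', mul_assoc, ih, pow_succ' f, ← mul_assoc, ← mul_assoc, (hfc.pow_right n).eq,
        mul_assoc _ y, hyx]
      rw [← pow_succ' f, pow_succ f]
      simp only [mul_assoc]
  have h1 := hpow (orderOf y)
  rw [pow_orderOf_eq_one, one_mul, mul_one] at h1
  have h2 : f ^ orderOf y = 1 := by simpa using h1.symm
  have h3 : orderOf f ∣ orderOf y := orderOf_dvd_of_pow_eq_one h2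
  obtain ⟨j, hj⟩ := hQ ⟨f, hΦQ hfΦ⟩
  have h4 : f ^ 2 ^ j = 1 := by simpa using congrArg Subtype.val hj
  have h5 : orderOf f ∣ 2 ^ j := orderOf_dvd_of_pow_eq_one h4
  have h6 : orderOf f ∣ 1 := by
    have : Nat.gcd (orderOf y) (2 ^ j) = 1 := (Nat.coprime_two_right.2 hy).pow_right j
    exact this ▸ Nat.dvd_gcd h3 h5
  have h7 : f = 1 := orderOf_eq_one_iff.1 (Nat.dvd_one.1 h6)
  apply hne
  rw [h7, one_mul] at hyx
  rw [hyx]; group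

theorem reduces_of_two_subgroup {G : Type} [Group G] [Finite G] [IsSimpleGroup G]
    (hG : ¬ Group.IsSolvable G) {y : G} (hy : Odd (orderOf y)) (Q : Subgroup G)
    (hQ : IsPGroup 2 Q) (hn : y ∈ Subgroup.normalizer (Q : Set G))
    (hc : ∃ x ∈ Q, y * x * y⁻¹ ≠ x) : Reduces G 1 := by
  obtain ⟨N, hN⟩ : ∃ N, Nat.card Q = N := ⟨_, rfl⟩
  induction N using Nat.strong_induction_on generalizing Q with
  | _ N ih =>
  obtain ⟨Φ, hΦ⟩ : ∃ Φ, Φ = (frattini Q).map Q.subtype := ⟨_, rfl⟩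
  have hΦQ : Φ ≤ Q := hΦ ▸ Subgroup.map_subtype_le _
  have hyΦ : y ∈ Subgroup.normalizer (Φ : Set G) := hΦ ▸ mem_normalizer_map_of_characteristic _ hn
  have hindex : (frattini Q).index = Φ.relIndex Q := by
    rw [hΦ, Subgroup.relIndex, Subgroup.subgroupOf,
      Subgroup.comap_map_eq_self_of_injective Q.subtype_injective]
  have hmul : Φ.relIndex Q * Nat.card Φ = Nat.card Q := by
    have h1 := Subgroup.card_mul_index (frattini Q)
    have h2 : Nat.card Φ = Nat.card (frattini Q) := by
      rw [hΦ]; exact Subgroup.card_map_of_injective Q.subtype_injective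
    rw [← hindex, h2, mul_comm]; exact h1
  by_cases hcΦ : ∃ x ∈ Φ, y * x * y⁻¹ ≠ x
  · by_cases hlt : Nat.card Φ < N
    · exact ih _ hlt Φ (hQ.to_le hΦQ) hyΦ hcΦ rfl
    · exfalso
      have h1 : (frattini Q).index = 1 := by
        rw [hindex]
        have h0 : 0 < Nat.card Φ := Nat.card_pos
        have h2 : 0 < Nat.card Q := Nat.card_pos
        by_contra hne
        have h3 : Φ.relIndex Q ≠ 0 := by
          intro h; rw [h, zero_mul] at hmul; omega
        have h4 : 2 ≤ Φ.relIndex Q := by omega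
        nlinarith
      rw [Subgroup.index_eq_one] at h1
      have h3 : (⊥ : Subgroup Q) = ⊤ := frattini_nongenerating (by rw [h1]; simp)
      obtain ⟨x, hx, hne⟩ := hc
      have h4 : (⟨x, hx⟩ : Q) ∈ (⊥ : Subgroup Q) := h3 ▸ Subgroup.mem_top _
      rw [Subgroup.mem_bot] at h4
      have h5 : x = 1 := congrArg Subtype.val h4
      apply hne
      rw [h5]; simp
  push Not at hcΦ
  obtain ⟨x, hx, hxΦ⟩ := exists_commutator_notMem hQ hy hΦQ hcΦ hc
  have hQtop : ¬ Q.Normal := by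
    intro h
    rcases h.eq_bot_or_eq_top with h | h
    · apply hxΦ
      rw [h, Subgroup.mem_bot] at hx
      rw [hx]; simp
    · apply hG
      have h1 : IsPGroup 2 (⊤ : Subgroup G) := h ▸ hQ
      have h2 : IsPGroup 2 G := h1.of_equiv Subgroup.topEquiv
      have := h2.isNilpotent
      infer_instance
  obtain ⟨j, hj⟩ := (IsPGroup.to_quotient hQ (frattini Q)).exists_card_eq
  change (frattini Q).index = _ at hj
  have hyx : y * x * y⁻¹ ∈ Q := (Subgroup.mem_normalizer_iff.1 hn x).1 hx
  have hxF : (⟨y * x * y⁻¹, hyx⟩ * ⟨x, hx⟩⁻¹ : Q) ∉ frattini Q := by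
    intro h
    apply hxΦ
    rw [hΦ]
    exact ⟨_, h, rfl⟩
  have hj2 : 2 ≤ j := by
    by_contra! hlt
    have hcase : j = 0 ∨ j = 1 := by omega
    rcases hcase with rfl | rfl
    · rw [pow_zero, Subgroup.index_eq_one] at hj
      exact hxF (hj ▸ Subgroup.mem_top _)
    · rw [pow_one] at hj
      apply hxF
      rw [Subgroup.mul_mem_iff_of_index_two hj, inv_mem_iff]
      have h1 : (⟨x, hx⟩ : Q) ∈ frattini Q ↔ x ∈ Φ := by
        rw [hΦ]
        constructor
        · intro h; exact ⟨_, h, rfl⟩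
        · rintro ⟨z, hz, hzx⟩
          have : z = ⟨x, hx⟩ := Subtype.ext hzx
          exact this ▸ hz
      have h2 : (⟨y * x * y⁻¹, hyx⟩ : Q) ∈ frattini Q ↔ y * x * y⁻¹ ∈ Φ := by
        rw [hΦ]
        constructor
        · intro h; exact ⟨_, h, rfl⟩
        · rintro ⟨z, hz, hzx⟩
          have : z = ⟨y * x * y⁻¹, hyx⟩ := Subtype.ext hzx
          exact this ▸ hz
      rw [h1, h2]
      exact (Subgroup.mem_normalizer_iff.1 hyΦ x).symm
  by_cases hj3 : 3 ≤ j
  · obtain ⟨f, hf⟩ := exists_surjective_elementary (frattini Q) (pow_mem_frattini hQ)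
      (commutator_le_frattini hQ) (r := 3) (by rw [hj]; exact Nat.pow_le_pow_right (by norm_num) hj3)
    apply Reduces.of_subgroup Q
    refine Reduces.of_surjective hf (reduces_rank_three_two ?_)
    refine index_ge_five_of_card (fun h => hQtop (h ▸ inferInstance)) ?_
    have h1 : (frattini Q).index ≤ Nat.card Q := Nat.le_of_dvd Nat.card_pos (Subgroup.index_dvd_card _)
    have h2 : 2 ^ 3 ≤ 2 ^ j := Nat.pow_le_pow_right (by norm_num) hj3
    omega
  have hj4 : j = 2 := by omega
  subst hj4
  obtain ⟨H, hH⟩ : ∃ H, H = Q ⊔ Subgroup.zpowers y := ⟨_, rfl⟩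
  have hQH : Q ≤ H := hH ▸ le_sup_left
  have hyH : y ∈ H := hH ▸ (le_sup_right (a := Q)) (Subgroup.mem_zpowers y)
  have hHQ : H ≤ Subgroup.normalizer (Q : Set G) := by
    rw [hH, sup_le_iff, Subgroup.zpowers_le]
    exact ⟨Subgroup.le_normalizer, hn⟩
  have hHΦ : H ≤ Subgroup.normalizer (Φ : Set G) := fun g hg =>
    hΦ ▸ mem_normalizer_map_of_characteristic _ (hHQ hg)
  have hHtop : H ≠ ⊤ := by
    intro h
    apply hQtop
    rw [← Subgroup.normalizer_eq_top_iff, eq_top_iff, ← h]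
    exact hHQ
  have hn1 : (Φ.subgroupOf H).Normal :=
    (Subgroup.normal_subgroupOf_iff_le_normalizer (hΦQ.trans hQH)).2 hHΦ
  have hn2 : (Q.subgroupOf H).Normal :=
    (Subgroup.normal_subgroupOf_iff_le_normalizer hQH).2 hHQ
  have hsurj := QuotientGroup.mk'_surjective (Φ.subgroupOf H)
  obtain ⟨q, hq⟩ : ∃ q, q = QuotientGroup.mk' (Φ.subgroupOf H) := ⟨_, rfl⟩
  rw [← hq] at hsurj
  have hker : ∀ z : H, q z = 1 ↔ (z : G) ∈ Φ := by
    intro z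
    rw [hq]
    exact (QuotientGroup.eq_one_iff z).trans Subgroup.mem_subgroupOf
  have hVn : ((Q.subgroupOf H).map q).Normal := hn2.map q hsurj
  have hmain := reduces_of_four_group ((Q.subgroupOf H).map q) (y := q ⟨y, hyH⟩) ?_ ?_ ?_ ?_ ?_
  · have h12 : 12 ≤ Nat.card H :=
      hmain.1.trans (Nat.le_of_dvd Nat.card_pos (Subgroup.index_dvd_card _))
    apply Reduces.of_subgroup H
    apply Reduces.of_quotient (Φ.subgroupOf H)
    exact hmain.2 _ (index_ge_five_of_card hHtop (by omega))
  · rw [← Subgroup.relIndex_ker, hq, QuotientGroup.ker_mk', Subgroup.relIndex_subgroupOf hQH,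
      ← hindex, hj]
    norm_num
  · rintro _ ⟨z, hz, rfl⟩
    rw [← map_mul, hker, hΦ, ← pow_two]
    have hzQ : (z : G) ∈ Q := hz
    exact ⟨_, pow_mem_frattini hQ ⟨(z : G), hzQ⟩, rfl⟩
  · have h1 : orderOf (q ⟨y, hyH⟩) ∣ orderOf y := by
      have := orderOf_map_dvd q ⟨y, hyH⟩
      rwa [Subgroup.orderOf_mk] at this
    exact hy.of_dvd_nat h1
  · rw [← MonoidHom.map_zpowers, ← Subgroup.map_sup]
    have h1 : Q.subgroupOf H ⊔ Subgroup.zpowers (⟨y, hyH⟩ : H) = ⊤ := by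
      apply Subgroup.map_injective H.subtype_injective
      rw [Subgroup.map_sup, MonoidHom.map_zpowers, Subgroup.map_subgroupOf_eq_of_le hQH]
      rw [← MonoidHom.range_eq_map, Subgroup.range_subtype]
      exact hH.symm
    rw [h1]
    exact Subgroup.map_top_of_surjective q hsurj
  · refine ⟨q ⟨x, hQH hx⟩, ⟨_, hx, rfl⟩, fun h => hxΦ ?_⟩
    rw [← mul_inv_eq_one, ← map_mul, ← map_inv, ← map_mul, ← map_inv, ← map_mul, hker] at h
    exact h

end NoetherIndex

namespace NoetherIndex

open scoped Pointwise commutatorElement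

/-- Every element of order prime to `p` normalizing a `p`-subgroup centralizes it. -/
def LocallyCentral (G : Type) [Group G] (p : ℕ) : Prop :=
  ∀ (Q : Subgroup G), IsPGroup p Q → ∀ y ∈ Subgroup.normalizer (Q : Set G),
    ¬ p ∣ orderOf y → ∀ x ∈ Q, y * x * y⁻¹ = x

theorem sup_sylow_eq_top {N : Type} [Group N] [Finite N] {p : ℕ} [hp : Fact p.Prime]
    (C : Subgroup N) [C.Normal] (hC : ∀ y : N, ¬ p ∣ orderOf y → y ∈ C) (S : Sylow p N) :
    C ⊔ (S : Subgroup N) = ⊤ := by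
  have hq : IsPGroup p (N ⧸ C) := by
    intro z
    obtain ⟨n, rfl⟩ := QuotientGroup.mk_surjective z
    obtain ⟨a, m, hm, ham⟩ := Nat.exists_eq_pow_mul_and_not_dvd (orderOf_pos n).ne' p hp.out.ne_one
    refine ⟨a, ?_⟩
    rw [← QuotientGroup.mk_pow, QuotientGroup.eq_one_iff]
    apply hC
    rw [orderOf_pow_of_dvd (pow_ne_zero _ hp.out.ne_zero) (by rw [ham]; exact dvd_mul_right _ _), ham,
      Nat.mul_div_cancel_left _ (pow_pos hp.out.pos _)]
    exact hm
  obtain ⟨j, hj⟩ := hq.exists_card_eq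
  change C.index = _ at hj
  have h1 : (C ⊔ (S : Subgroup N)).index ∣ p ^ j := hj ▸ Subgroup.index_dvd_of_le le_sup_left
  have h2 : (C ⊔ (S : Subgroup N)).index ∣ (S : Subgroup N).index :=
    Subgroup.index_dvd_of_le le_sup_right
  have h3 : Nat.Coprime (p ^ j) (S : Subgroup N).index :=
    Nat.Coprime.pow_left _ ((Nat.Prime.coprime_iff_not_dvd hp.out).2 S.not_dvd_index)
  rw [← Subgroup.index_eq_one]
  exact Nat.eq_one_of_dvd_coprimes h3 h1 h2

variable {G : Type} [Group G] [Finite G] {p : ℕ} [hp : Fact p.Prime]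

theorem LocallyCentral.exists_mul (h : LocallyCentral G p) {D : Subgroup G} (hD : IsPGroup p D)
    (S : Sylow p (Subgroup.normalizer (D : Set G))) (n : Subgroup.normalizer (D : Set G)) :
    ∃ c s : Subgroup.normalizer (D : Set G), (c : G) ∈ Subgroup.centralizer (D : Set G) ∧ s ∈ S ∧
      n = c * s := by
  have h1 := sup_sylow_eq_top D.normalizerMonoidHom.ker (fun y hy => by
    rw [MonoidHom.mem_ker]
    ext x
    exact h D hD y y.2 (by rwa [Subgroup.orderOf_coe]) x x.2) S
  obtain ⟨c, hc, s, hs, rfl⟩ := Subgroup.mem_sup_of_normal_left.1 (h1 ▸ Subgroup.mem_top n)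
  refine ⟨c, s, ?_, hs, rfl⟩
  rw [Subgroup.mem_centralizer_iff]
  intro x hx
  have h2 : D.normalizerMonoidHom c ⟨x, hx⟩ = ⟨x, hx⟩ := by
    rw [MonoidHom.mem_ker.1 hc]; rfl
  have h3 : (c : G) * x * (c : G)⁻¹ = x := congrArg Subtype.val h2
  exact (mul_inv_eq_iff_eq_mul.1 h3).symm

theorem exists_mem_normalizer_notMem {P D : Subgroup G} (hP : IsPGroup p P) (hD : D < P) :
    ∃ x ∈ P, x ∈ Subgroup.normalizer (D : Set G) ∧ x ∉ D := by
  have hn := hP.isNilpotent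
  have h1 : D.subgroupOf P < ⊤ := by
    rw [lt_top_iff_ne_top, Ne, Subgroup.subgroupOf_eq_top]
    exact hD.not_ge
  have h2 := Group.normalizerCondition_of_isNilpotent _ h1
  obtain ⟨x, hx, hxD⟩ := SetLike.exists_of_lt h2
  rw [← Subgroup.subgroupOf_normalizer_eq hD.le] at hx
  exact ⟨x, x.2, hx, hxD⟩

theorem LocallyCentral.exists_conj (h : LocallyCentral G p) (P R : Sylow p G) :
    ∃ c ∈ Subgroup.centralizer ((P ⊓ R : Subgroup G) : Set G), c • P = R := by
  obtain ⟨m, hm⟩ : ∃ m, Nat.card G - Nat.card (P ⊓ R : Subgroup G) = m := ⟨_, rfl⟩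
  induction m using Nat.strong_induction_on generalizing P R with
  | _ m ih =>
  obtain ⟨D, hD⟩ : ∃ D : Subgroup G, D = (P : Subgroup G) ⊓ R := ⟨_, rfl⟩
  rw [← hD]
  rw [← hD] at hm
  have hDP : D ≤ P := hD ▸ inf_le_left
  have hDR : D ≤ R := hD ▸ inf_le_right
  have hDp : IsPGroup p D := P.2.to_le hDP
  rcases hDP.eq_or_lt with hP | hP
  · refine ⟨1, one_mem _, ?_⟩
    rw [one_smul]
    exact (Sylow.ext (P.3 R.2 (hP ▸ hDR))).symm
  rcases hDR.eq_or_lt with hR | hR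
  · refine ⟨1, one_mem _, ?_⟩
    rw [one_smul]
    exact Sylow.ext (R.3 P.2 (hR ▸ hDP))
  have hlt : ∀ A B : Sylow p G, (∃ x ∈ (A : Subgroup G), x ∈ Subgroup.normalizer (D : Set G) ∧ x ∉ D) →
      (∀ x ∈ (A : Subgroup G), x ∈ Subgroup.normalizer (D : Set G) → x ∈ (B : Subgroup G)) →
      D ≤ A → ∃ c ∈ Subgroup.centralizer (D : Set G), c • A = B := by
    rintro A B ⟨x, hxA, hxN, hxD⟩ hAB hDA
    have hle : D ≤ (A ⊓ B : Subgroup G) :=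
      le_inf hDA fun y hy => hAB y (hDA hy) (Subgroup.le_normalizer hy)
    have hlt : D < (A ⊓ B : Subgroup G) :=
      lt_of_le_of_ne hle fun heq => hxD (heq ▸ ⟨hxA, hAB x hxA hxN⟩)
    have hcard : Nat.card D < Nat.card (A ⊓ B : Subgroup G) :=
      Set.ncard_lt_ncard (SetLike.coe_ssubset_coe.2 hlt) (Set.toFinite _)
    have hcard2 : Nat.card (A ⊓ B : Subgroup G) ≤ Nat.card G :=
      Nat.le_of_dvd Nat.card_pos (Subgroup.card_subgroup_dvd_card _)
    obtain ⟨c, hc, hcAB⟩ := ih _ (by omega) A B rfl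
    exact ⟨c, Subgroup.centralizer_le hle hc, hcAB⟩
  obtain ⟨N, hN⟩ : ∃ N, N = Subgroup.normalizer (D : Set G) := ⟨_, rfl⟩
  obtain ⟨SP, hSP⟩ := (P.2.comap_subtype (H := (P : Subgroup G)) (K := Subgroup.normalizer (D : Set G))).exists_le_sylow
  obtain ⟨SR, hSR⟩ := (R.2.comap_subtype (H := (R : Subgroup G)) (K := Subgroup.normalizer (D : Set G))).exists_le_sylow
  obtain ⟨n, hn⟩ := MulAction.exists_smul_eq (Subgroup.normalizer (D : Set G)) SP SR
  obtain ⟨c, s, hc, hs, rfl⟩ := h.exists_mul hDp SP n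
  obtain ⟨P1, hP1⟩ := (SP.2.map (Subgroup.normalizer (D : Set G)).subtype).exists_le_sylow
  obtain ⟨c1, hc1, hP⟩ := hlt P P1 (exists_mem_normalizer_notMem P.2 hP)
    (fun x hx hxN => hP1 ⟨⟨x, hxN⟩, hSP hx, rfl⟩) hDP
  have hRle : ∀ x ∈ (R : Subgroup G), x ∈ Subgroup.normalizer (D : Set G) →
      x ∈ (((c : G) • P1 : Sylow p G) : Subgroup G) := by
    intro x hx hxN
    have h1 : (⟨x, hxN⟩ : Subgroup.normalizer (D : Set G)) ∈ SR := hSR hx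
    rw [← hn] at h1
    have h2 : (c * s)⁻¹ * ⟨x, hxN⟩ * (c * s) ∈ SP := by
      rw [← SetLike.mem_coe, ← Sylow.coe_coe, SetLike.mem_coe, Sylow.coe_subgroup_smul,
        Subgroup.mem_pointwise_smul_iff_inv_smul_mem] at h1
      change _ ∈ (SP : Subgroup (Subgroup.normalizer (D : Set G)))
      simpa [MulAut.smul_def, mul_assoc] using h1
    have h3 : c⁻¹ * ⟨x, hxN⟩ * c ∈ SP := by
      have := mul_mem (mul_mem hs h2) (inv_mem hs)
      convert this using 1
      group
    rw [Sylow.coe_subgroup_smul, Subgroup.mem_pointwise_smul_iff_inv_smul_mem]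
    have h4 := hP1 ⟨_, h3, rfl⟩
    simpa [MulAut.smul_def] using h4
  obtain ⟨c2, hc2, hR⟩ := hlt R (c • P1) (exists_mem_normalizer_notMem R.2 hR) hRle hDR
  refine ⟨c2⁻¹ * c * c1, mul_mem (mul_mem (inv_mem hc2) hc) hc1, ?_⟩
  rw [mul_smul, mul_smul, hP, inv_smul_eq_iff, hR]
  rfl

theorem LocallyCentral.conj_eq (h : LocallyCentral G p) (P : Sylow p G) {x g : G}
    (hx : x ∈ P) (hgx : g * x * g⁻¹ ∈ P) : ∃ u ∈ P, g * x * g⁻¹ = u * x * u⁻¹ := by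
  obtain ⟨c, hc, hcP⟩ := h.exists_conj P (g • P)
  have hmem : g * x * g⁻¹ ∈ (P ⊓ (g • P : Sylow p G) : Subgroup G) := by
    refine Subgroup.mem_inf.2 ⟨hgx, ?_⟩
    rw [Sylow.coe_subgroup_smul, Subgroup.mem_pointwise_smul_iff_inv_smul_mem]
    have hx' : x ∈ (P : Subgroup G) := hx
    simpa [MulAut.smul_def, mul_assoc] using hx'
  have hcx := Subgroup.mem_centralizer_iff.1 hc _ hmem
  have hw : c⁻¹ * g ∈ Subgroup.normalizer (P : Set G) := by
    rw [← Sylow.smul_eq_iff_mem_normalizer, mul_smul, inv_smul_eq_iff, hcP]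
  obtain ⟨c', s, hc', hs, hcs⟩ := h.exists_mul (D := (P : Subgroup G)) P.2
    (P.subtype Subgroup.le_normalizer) ⟨_, hw⟩
  have hs' : (s : G) ∈ P := hs
  refine ⟨s, hs', ?_⟩
  have h1 : c⁻¹ * g = c' * s := congrArg Subtype.val hcs
  have h2 : (s : G) * x * (s : G)⁻¹ ∈ P := mul_mem (mul_mem hs' hx) (inv_mem hs')
  have h3 := Subgroup.mem_centralizer_iff.1 hc' _ h2
  calc g * x * g⁻¹ = c⁻¹ * (c * (g * x * g⁻¹)) := by group
    _ = (c⁻¹ * g) * x * (c⁻¹ * g)⁻¹ := by rw [← hcx]; group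
    _ = (c' * (s * x * (s : G)⁻¹)) * (c' : G)⁻¹ := by rw [h1]; group
    _ = s * x * (s : G)⁻¹ := by rw [← h3]; group

theorem LocallyCentral.sylow_eq_bot (h : LocallyCentral G p) (hG : commutator G = ⊤)
    (P : Sylow p G) : (P : Subgroup G) = ⊥ := by
  have h1 := Subgroup.commutator_inf_eq_focalSubgroup P
  have h2 : (P : Subgroup G).focalSubgroup ≤ ⁅(P : Subgroup G), (P : Subgroup G)⁆ := by
    rw [Subgroup.focalSubgroup_def, Subgroup.closure_le]
    rintro _ ⟨hm, x, hx, u, rfl⟩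
    have hu : u * x⁻¹ * u⁻¹ ∈ (P : Subgroup G) := by
      have := mul_mem (inv_mem hx) hm
      simpa [commutatorElement_def, mul_assoc] using this
    obtain ⟨v, hv, hvu⟩ := h.conj_eq P (inv_mem hx) hu
    have : ⁅x, u⁆ = ⁅x, v⁆ := by
      rw [commutatorElement_def, commutatorElement_def, mul_assoc, mul_assoc, ← mul_assoc u, hvu]
      group
    rw [this]
    exact Subgroup.commutator_mem_commutator hx hv
  rw [hG, top_inf_eq] at h1
  have hn := P.2.isNilpotent
  by_contra hne
  have hnt : Nontrivial P := (Subgroup.nontrivial_iff_ne_bot _).2 hne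
  have h3 := Group.IsSolvable.commutator_lt_top_of_nontrivial P
  apply h3.ne
  apply Subgroup.map_injective (P : Subgroup G).subtype_injective
  rw [Subgroup.map_subtype_commutator, ← MonoidHom.range_eq_map, Subgroup.range_subtype]
  exact le_antisymm (Subgroup.commutator_le_self _) (h1.le.trans h2)

end NoetherIndex

namespace NoetherIndex

open scoped commutatorElement

theorem reduces_of_simple {G : Type} [Group G] [Finite G] [IsSimpleGroup G]
    (hG : ¬ Group.IsSolvable G) : Reduces G 1 := by
  by_contra hcon
  have hodd : ∀ p : ℕ, p.Prime → p ≠ 2 → ∀ P : Sylow p G, IsCyclic P := by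
    intro p hp hp2 P
    have := Fact.mk hp
    by_contra hc
    exact hcon (reduces_of_odd_sylow hG hp2 P hc)
  have hcomm : commutator G = ⊤ := by
    rcases (inferInstance : (commutator G).Normal).eq_bot_or_eq_top with h | h
    · exact absurd (Group.isSolvable_of_comm fun a b => by
        have : ⁅a, b⁆ ∈ commutator G :=
          Subgroup.commutator_mem_commutator (Subgroup.mem_top _) (Subgroup.mem_top _)
        rw [h, Subgroup.mem_bot] at this
        exact commutatorElement_eq_one_iff_mul_comm.1 this) hG
    · exact h
  have hloc : LocallyCentral G 2 := by
    intro Q hQ y hy hy2 x hx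
    by_contra hne
    exact hcon (reduces_of_two_subgroup hG (Nat.odd_iff.2 (by omega)) Q hQ hy ⟨x, hx, hne⟩)
  have hZ : IsZGroup G := by
    refine ⟨fun p hp P => ?_⟩
    by_cases hp2 : p = 2
    · subst hp2
      have hb : (P : Subgroup G) = ⊥ := hloc.sylow_eq_bot hcomm P
      have : Subsingleton P := by
        rw [hb]; infer_instance
      infer_instance
    · exact hodd p hp hp2 P
  exact hG inferInstance

theorem reduces_of_not_isSolvable (G : Type) [Group G] [Finite G] (hG : ¬ Group.IsSolvable G) :
    Reduces G 1 := by
  obtain ⟨N, hN⟩ : ∃ N, Nat.card G = N := ⟨_, rfl⟩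
  induction N using Nat.strong_induction_on generalizing G with
  | _ N ih =>
  by_cases hs : ∃ K : Subgroup G, K.Normal ∧ K ≠ ⊥ ∧ K ≠ ⊤
  · obtain ⟨K, hK, hbot, htop⟩ := hs
    have hmul := Subgroup.card_mul_index K
    have h1 : Nat.card K ≠ 1 := fun h => hbot (Subgroup.card_eq_one.1 h)
    have h2 : K.index ≠ 1 := fun h => htop (Subgroup.index_eq_one.1 h)
    have h3 : K.index ≠ 0 := Subgroup.index_ne_zero_of_finite
    have h4 : Nat.card K ≠ 0 := Nat.card_pos.ne'
    by_cases hKs : Group.IsSolvable K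
    · by_cases hQs : Group.IsSolvable (G ⧸ K)
      · exact absurd (Group.isSolvable_of_ker_le_range K.subtype (QuotientGroup.mk' K) (by simp)) hG
      · apply Reduces.of_quotient K
        refine ih _ ?_ _ hQs rfl
        change K.index < N
        have : 2 ≤ Nat.card K := by omega
        have : 1 ≤ K.index := by omega
        nlinarith
    · apply Reduces.of_subgroup K
      refine Reduces.of_one (ih _ ?_ _ hKs rfl) h3
      have : 2 ≤ K.index := by omega
      have : 1 ≤ Nat.card K := by omega
      nlinarith
  · push Not at hs
    have hnt : Nontrivial G := by
      by_contra h
      rw [not_nontrivial_iff_subsingleton] at h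
      exact hG inferInstance
    have : IsSimpleGroup G := ⟨fun K hK => or_iff_not_imp_left.2 (hs K hK)⟩
    exact reduces_of_simple hG

theorem noetherIndex_gt (G : Type) [Group G] [Finite G] (hG : ¬ Group.IsSolvable G) :
    2.7 < noetherIndex G := by
  obtain ⟨d, hd, hlt⟩ := reduces_of_not_isSolvable G hG
  have h1 := noetherNumber_le_of_absorbs hd
  have h2 := noetherNumber_pos G
  unfold noetherIndex
  rw [lt_div_iff₀ (by exact_mod_cast h2)]
  have h3 : 27 * noetherNumber G < 10 * Nat.card G := by omega
  have h4 : (27 * noetherNumber G : ℝ) < 10 * Nat.card G := by exact_mod_cast h3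
  linarith

end NoetherIndex

namespace NoetherIndex

open Subgroup

section ChermakDelgado

variable {G : Type*} [Group G]

theorem card_inf_mul_relIndex (A B : Subgroup G) :
    Nat.card ↥(A ⊓ B) * B.relIndex A = Nat.card A := by
  have := relIndex_mul_relIndex (⊥ : Subgroup G) (A ⊓ B) A bot_le inf_le_left
  rwa [relIndex_bot_left, relIndex_bot_left, inf_relIndex_left] at this

variable [Finite G]

theorem relIndex_mono_right (B : Subgroup G) {A C : Subgroup G} (hA : A ≤ C) :
    B.relIndex A ≤ B.relIndex C :=
  relIndex_le_of_le_right hA (index_ne_zero_of_finite (H := B.subgroupOf C))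

theorem card_mul_card_le (A B C : Subgroup G) (hA : A ≤ C) (hB : B ≤ C) :
    Nat.card A * Nat.card B ≤ Nat.card ↥(A ⊓ B) * Nat.card C := by
  have h1 := card_inf_mul_relIndex A B
  have h2 := card_inf_mul_relIndex C B
  rw [inf_eq_right.2 hB] at h2
  have h3 : B.relIndex A ≤ B.relIndex C := relIndex_mono_right B hA
  calc _ = Nat.card ↥(A ⊓ B) * (Nat.card B * B.relIndex A) := by rw [← h1]; ring
    _ ≤ Nat.card ↥(A ⊓ B) * (Nat.card B * B.relIndex C) := by gcongr
    _ = _ := by rw [h2]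

/-- The Chermak–Delgado measure of a subgroup. -/
noncomputable def cdMeasure (H : Subgroup G) : ℕ :=
  Nat.card H * Nat.card (centralizer (H : Set G))

theorem cdMeasure_mul_le (H K : Subgroup G) :
    cdMeasure H * cdMeasure K ≤ cdMeasure (H ⊓ K) * cdMeasure (H ⊔ K) := by
  have h1 := card_mul_card_le H K (H ⊔ K) le_sup_left le_sup_right
  have h2 := card_mul_card_le (centralizer (H : Set G)) (centralizer (K : Set G))
    (centralizer ((H ⊓ K : Subgroup G) : Set G)) (centralizer_le inf_le_left)
    (centralizer_le inf_le_right)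
  have h3 : centralizer (H : Set G) ⊓ centralizer (K : Set G) ≤
      centralizer ((H ⊔ K : Subgroup G) : Set G) := by
    exact le_centralizer_iff.1 (sup_le (le_centralizer_iff.1 inf_le_left)
      (le_centralizer_iff.1 inf_le_right))
  have h4 : Nat.card ↥(centralizer (H : Set G) ⊓ centralizer (K : Set G)) ≤
      Nat.card (centralizer ((H ⊔ K : Subgroup G) : Set G)) :=
    Nat.card_mono (Set.toFinite _) h3
  unfold cdMeasure
  calc _ = (Nat.card H * Nat.card K) *
        (Nat.card (centralizer (H : Set G)) * Nat.card (centralizer (K : Set G))) := by ring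
    _ ≤ _ := Nat.mul_le_mul h1 (h2.trans (Nat.mul_le_mul_right _ h4))
    _ = _ := by ring

theorem cdMeasure_map (f : G ≃* G) (H : Subgroup G) :
    cdMeasure (H.map f.toMonoidHom) = cdMeasure H := by
  have h1 : ∀ H : Subgroup G, Nat.card (H.map f.toMonoidHom) = Nat.card H := fun H =>
    Nat.card_congr (H.equivMapOfInjective _ f.injective).toEquiv.symm
  have h2 : centralizer ((H.map f.toMonoidHom : Subgroup G) : Set G) =
      (centralizer (H : Set G)).map f.toMonoidHom := by
    ext x
    obtain ⟨y, rfl⟩ := f.surjective x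
    simp [mem_centralizer_iff, Subgroup.mem_map, ← map_mul]
  rw [cdMeasure, h2, h1, h1, cdMeasure]

/-- A finite group with an abelian subgroup of index `m` has a characteristic abelian subgroup of
index at most `m ^ 2`. -/
theorem exists_characteristic_abelian (A : Subgroup G) (hA : A ≤ centralizer (A : Set G)) :
    ∃ M : Subgroup G, M.Characteristic ∧ M ≤ centralizer (M : Set G) ∧ M.index ≤ A.index ^ 2 := by
  obtain ⟨H₀, hH₀⟩ := Finite.exists_max (cdMeasure (G := G))
  obtain ⟨M, hM, hmin⟩ := Set.exists_min_image {M : Subgroup G | cdMeasure M = cdMeasure H₀}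
    (fun M => Nat.card M) (Set.toFinite _) ⟨H₀, rfl⟩
  simp only [Set.mem_ofPred_eq] at hM hmin
  have hle : ∀ K : Subgroup G, cdMeasure K = cdMeasure H₀ → M ≤ K := by
    intro K hK
    have h1 := cdMeasure_mul_le M K
    rw [hM, hK] at h1
    have hpos : 0 < cdMeasure H₀ := by
      refine lt_of_lt_of_le ?_ (hH₀ ⊥)
      exact Nat.mul_pos Nat.card_pos Nat.card_pos
    have h2 : cdMeasure (M ⊓ K) = cdMeasure H₀ := by
      refine le_antisymm (hH₀ _) ?_
      have := h1.trans (Nat.mul_le_mul_left _ (hH₀ (M ⊔ K)))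
      exact Nat.le_of_mul_le_mul_right this hpos
    have h3 := hmin _ h2
    have h4 : M ⊓ K = M := Subgroup.eq_of_le_of_card_ge inf_le_left h3
    exact inf_eq_left.1 h4
  refine ⟨M, ?_, hle _ ?_, ?_⟩
  · rw [characteristic_iff_le_map]
    exact fun f => hle _ ((cdMeasure_map f M).trans hM)
  · refine le_antisymm (hH₀ _) ?_
    rw [← hM, cdMeasure, cdMeasure, mul_comm]
    exact Nat.mul_le_mul_left _ (Nat.card_mono (Set.toFinite _) (le_centralizer_iff.1 le_rfl))
  · have h1 : Nat.card A * Nat.card A ≤ Nat.card M * Nat.card G := by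
      calc _ ≤ cdMeasure A := Nat.mul_le_mul_left _ (Nat.card_mono (Set.toFinite _) hA)
        _ ≤ cdMeasure H₀ := hH₀ A
        _ = cdMeasure M := hM.symm
        _ ≤ _ := Nat.mul_le_mul_left _ (card_le_card_group _)
    have hm := A.card_mul_index
    have hM' := M.card_mul_index
    have hN : 0 < Nat.card G := Nat.card_pos
    have h2 : Nat.card G * (Nat.card M * M.index) ≤ Nat.card G * (Nat.card M * A.index ^ 2) := by
      calc _ = (Nat.card A * Nat.card A) * A.index ^ 2 := by rw [hM', ← hm]; ring
        _ ≤ (Nat.card M * Nat.card G) * A.index ^ 2 := Nat.mul_le_mul_right _ h1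
        _ = _ := by ring
    exact Nat.le_of_mul_le_mul_left (Nat.le_of_mul_le_mul_left h2 hN) Nat.card_pos

/-- A finite group with a cyclic subgroup of index `m` has a characteristic cyclic subgroup of
index at most `m ^ 4`. -/
theorem exists_characteristic_cyclic (A : Subgroup G) [IsCyclic A] :
    ∃ C : Subgroup G, C.Characteristic ∧ IsCyclic C ∧ C.index ≤ A.index ^ 4 := by
  have hcommA : A ≤ centralizer (A : Set G) := by
    letI := IsCyclic.commGroup (α := A)
    intro x hx y hy
    exact congrArg Subtype.val (mul_comm (⟨y, hy⟩ : A) ⟨x, hx⟩)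
  obtain ⟨M, hMc, hMab, hMi⟩ := exists_characteristic_abelian A hcommA
  have hcomm : ∀ x y : M, (x : G) * y = y * x := fun x y => hMab y.2 x x.2
  set A' := A.subgroupOf M
  set i := A'.index with hi
  have hi0 : 0 < i := Nat.pos_of_ne_zero index_ne_zero_of_finite
  have hiA : i ≤ A.index := by
    have : A.relIndex M ≤ A.relIndex ⊤ := relIndex_mono_right _ le_top
    rwa [relIndex_top_right] at this
  have hA'n : A'.Normal := ⟨fun n hn g => by
    have : g * n * g⁻¹ = n := by
      apply Subtype.ext
      simp [hcomm g n]
    rwa [this]⟩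
  let f : M →* G := MonoidHom.mk' (fun x => (x : G) ^ i) fun x y => by
    rw [coe_mul]; exact Commute.mul_pow (hcomm x y) i
  have hfA : f.range ≤ A := by
    rintro _ ⟨x, rfl⟩
    exact (A'.pow_index_mem x : _)
  refine ⟨f.range, ?_, ?_, ?_⟩
  · rw [characteristic_iff_map_le]
    rintro φ _ ⟨_, ⟨x, rfl⟩, rfl⟩
    refine ⟨⟨φ x, ?_⟩, by simp [f]⟩
    have := characteristic_iff_map_le.1 hMc φ
    exact this ⟨x, x.2, rfl⟩
  · exact isCyclic_of_injective (inclusion hfA) (inclusion_injective hfA)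
  · have hker : Nat.card f.ker ≤ i * i := by
      rw [← card_inf_mul_relIndex f.ker A']
      refine Nat.mul_le_mul ?_ ?_
      · classical
        have := Fintype.ofFinite A
        refine le_trans ?_ (IsCyclic.card_pow_eq_one_le (α := A) hi0)
        have hc : (Finset.univ.filter fun a : A => a ^ i = 1).card =
            Nat.card {a : A // a ^ i = 1} := by
          rw [Nat.card_eq_fintype_card, Fintype.card_subtype]
        rw [hc]
        refine Nat.card_le_card_of_injective (fun x => ⟨⟨x.1.1, x.2.2⟩, ?_⟩) ?_
        · have : f x.1 = 1 := x.2.1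
          exact Subtype.ext this
        · intro x y hxy
          simp only [Subtype.mk.injEq] at hxy
          exact Subtype.ext (Subtype.ext (congrArg (fun z : A => (z : G)) hxy))
      · have : A'.relIndex f.ker ≤ A'.relIndex ⊤ := relIndex_mono_right _ le_top
        rwa [relIndex_top_right] at this
    have h1 := f.ker.card_mul_index
    rw [index_ker] at h1
    have h2 := M.card_mul_index
    have h3 := f.range.card_mul_index
    have hpos : 0 < Nat.card f.range := Nat.card_pos
    refine Nat.le_of_mul_le_mul_left (?_ : Nat.card f.range * _ ≤ Nat.card f.range * _) hpos
    rw [h3, ← h2, ← h1]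
    calc _ = Nat.card f.range * (Nat.card f.ker * M.index) := by ring
      _ ≤ Nat.card f.range * ((A.index * A.index) * A.index ^ 2) := by
        gcongr
        exact hker.trans (Nat.mul_le_mul hiA hiA)
      _ = _ := by ring

end ChermakDelgado

end NoetherIndex

namespace NoetherIndex

open MvPolynomial

section Macaulay

/-- `x` is a nonzerodivisor modulo the ideal `I`. -/
def RegularMod {R : Type*} [CommRing R] (I : Ideal R) (x : R) : Prop := ∀ r, x * r ∈ I → r ∈ I

theorem RegularMod.sup_span {R : Type*} [CommRing R] {I : Ideal R} {x f : R}
    (hx : RegularMod I x) (hf : RegularMod (I ⊔ Ideal.span {x}) f) :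
    RegularMod (I ⊔ Ideal.span {f}) x := by
  intro r hr
  obtain ⟨b, hb, c, hc, hbc⟩ := Submodule.mem_sup.1 hr
  obtain ⟨s, rfl⟩ := Ideal.mem_span_singleton'.1 hc
  have h1 : f * s ∈ I ⊔ Ideal.span {x} := by
    have : f * s = -b + r * x := by linear_combination hbc
    rw [this]
    exact Submodule.add_mem_sup (neg_mem hb) (Ideal.mul_mem_left _ _ (Ideal.mem_span_singleton_self x))
  obtain ⟨b', hb', c', hc', hs⟩ := Submodule.mem_sup.1 (hf s h1)
  obtain ⟨s', rfl⟩ := Ideal.mem_span_singleton'.1 hc'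
  have h2 : x * (r - f * s') ∈ I := by
    have : x * (r - f * s') = b + f * b' := by linear_combination -f * hs - hbc
    rw [this]
    exact add_mem hb (Ideal.mul_mem_left _ _ hb')
  have : r = (r - f * s') + s' * f := by ring
  rw [this]
  exact Submodule.add_mem_sup (hx _ h2) (Ideal.mul_mem_left _ _ (Ideal.mem_span_singleton_self f))

theorem RegularMod.pow {R : Type*} [CommRing R] {I : Ideal R} {x : R}
    (hx : RegularMod I x) (n : ℕ) : RegularMod I (x ^ n) := by
  induction n with
  | zero => intro r hr; simpa using hr
  | succ n ih =>
    intro r hr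
    refine ih r (hx _ ?_)
    rwa [← mul_assoc, ← pow_succ']

/-- An ideal stable under taking homogeneous components. -/
def GradedIdeal {σ : Type*} (I : Ideal (MvPolynomial σ ℂ)) : Prop :=
  ∀ f ∈ I, ∀ k, homogeneousComponent k f ∈ I

theorem homogeneousComponent_homogeneous_mul {σ : Type*} {a : MvPolynomial σ ℂ} {n : ℕ}
    (ha : a.IsHomogeneous n) (r : MvPolynomial σ ℂ) (k : ℕ) :
    homogeneousComponent (n + k) (a * r) = a * homogeneousComponent k r := by
  conv_lhs => rw [← sum_homogeneousComponent r, Finset.mul_sum, map_sum]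
  rw [Finset.sum_congr rfl (fun i _ => homogeneousComponent_of_mem (m := n + k)
    (ha.mul (homogeneousComponent_isHomogeneous i r)))]
  simp only [add_right_inj]
  rw [Finset.sum_ite_eq]
  split_ifs with h
  · rfl
  · rw [homogeneousComponent_eq_zero, mul_zero]
    simpa using h

theorem homogeneousComponent_homogeneous_mul_of_lt {σ : Type*} {a : MvPolynomial σ ℂ} {n : ℕ}
    (ha : a.IsHomogeneous n) (r : MvPolynomial σ ℂ) {k : ℕ} (hk : k < n) :
    homogeneousComponent k (a * r) = 0 := by
  conv_lhs => rw [← sum_homogeneousComponent r, Finset.mul_sum, map_sum]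
  refine Finset.sum_eq_zero fun i _ => ?_
  rw [homogeneousComponent_of_mem (m := k) (ha.mul (homogeneousComponent_isHomogeneous i r)),
    if_neg (by omega)]

theorem GradedIdeal.span {σ : Type*} {S : Set (MvPolynomial σ ℂ)}
    (hS : ∀ f ∈ S, ∃ n, f.IsHomogeneous n) : GradedIdeal (Ideal.span S) := by
  intro f hf k
  induction hf using Submodule.span_induction generalizing k with
  | mem h hh =>
    obtain ⟨n, hn⟩ := hS h hh
    rw [homogeneousComponent_of_mem hn]
    split_ifs
    · exact Ideal.subset_span hh
    · exact zero_mem _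
  | zero => simp
  | add x y _ _ hx hy => rw [map_add]; exact add_mem (hx k) (hy k)
  | smul c x _ hx =>
    rw [smul_eq_mul, ← sum_homogeneousComponent c, Finset.sum_mul, map_sum]
    refine sum_mem fun i _ => ?_
    rcases lt_or_ge k i with hk | hk
    · rw [homogeneousComponent_homogeneous_mul_of_lt (homogeneousComponent_isHomogeneous i c) _ hk]
      exact zero_mem _
    · obtain ⟨k, rfl⟩ := Nat.exists_eq_add_of_le hk
      rw [homogeneousComponent_homogeneous_mul (homogeneousComponent_isHomogeneous i c)]
      exact Ideal.mul_mem_left _ _ (hx k)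

theorem GradedIdeal.sup {σ : Type*} {I K : Ideal (MvPolynomial σ ℂ)} (hI : GradedIdeal I)
    (hK : GradedIdeal K) : GradedIdeal (I ⊔ K) := by
  intro f hf k
  obtain ⟨a, ha, b, hb, rfl⟩ := Submodule.mem_sup.1 hf
  rw [map_add]
  exact Submodule.add_mem_sup (hI a ha k) (hK b hb k)

variable {d : ℕ}

/-- The ideal generated by the variables with index at least `l`. -/
noncomputable def tailIdeal (d l : ℕ) : Ideal (MvPolynomial (Fin d) ℂ) :=
  Ideal.span (X '' {j : Fin d | l ≤ j})

theorem tailIdeal_graded (l : ℕ) : GradedIdeal (tailIdeal d l) :=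
  GradedIdeal.span (by rintro _ ⟨j, _, rfl⟩; exact ⟨1, isHomogeneous_X _ _⟩)

theorem tailIdeal_eq_sup (l : Fin d) : tailIdeal d l = tailIdeal d (l + 1) ⊔ Ideal.span {X l} := by
  rw [tailIdeal, tailIdeal, ← Ideal.span_union]
  congr 1
  ext p
  constructor
  · rintro ⟨j, hj, rfl⟩
    rcases eq_or_lt_of_le (show l ≤ j from hj) with h | h
    · right; rw [h]; rfl
    · left; exact ⟨j, h, rfl⟩
  · rintro (⟨j, hj, rfl⟩ | h)
    · exact ⟨j, (Nat.le_succ _).trans hj, rfl⟩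
    · rw [Set.mem_singleton_iff.1 h]; exact ⟨l, le_refl (l : ℕ), rfl⟩

theorem tailIdeal_regularMod (l : Fin d) : RegularMod (tailIdeal d (l + 1)) (X l) := by
  intro r hr
  rw [tailIdeal, mem_ideal_span_X_image] at hr ⊢
  intro m hm
  obtain ⟨i, hi, h⟩ := hr (Finsupp.single l 1 + m) (by
    rw [mem_support_iff, coeff_X_mul]; exact mem_support_iff.1 hm)
  refine ⟨i, hi, ?_⟩
  have hne : l ≠ i := by
    rintro rfl
    exact absurd (show (l : ℕ) + 1 ≤ l from hi) (by omega)
  simpa [Finsupp.single_apply, hne] using h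

theorem tailIdeal_of_le {l : ℕ} (h : d ≤ l) : tailIdeal d l = ⊥ := by
  rw [tailIdeal, Ideal.span_eq_bot]
  rintro _ ⟨j, hj, rfl⟩
  exact absurd (show l ≤ j from hj) (by omega)

/-- Hilbert's Nullstellensatz for forms with no common zero. -/
theorem X_mem_of_isPrime {J : Submodule ℂ (MvPolynomial (Fin d) ℂ)}
    (hJ : ∀ u : Fin d → ℂ, (∀ f ∈ J, eval u f = 0) → u = 0) {P : Ideal (MvPolynomial (Fin d) ℂ)}
    [hP : P.IsPrime] (hJP : ∀ f ∈ J, f ∈ P) (l : Fin d) : X l ∈ P := by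
  have h : (X l : MvPolynomial (Fin d) ℂ) ∈ vanishingIdeal ℂ (zeroLocus ℂ P) := by
    rw [mem_vanishingIdeal_iff]
    intro u hu
    rw [mem_zeroLocus_iff] at hu
    rw [hJ u fun f hf => hu f (hJP f hf)]
    simp
  rwa [vanishingIdeal_zeroLocus_eq_radical, hP.isRadical.radical] at h

theorem exists_mem_forall_regularMod {J : Submodule ℂ (MvPolynomial (Fin d) ℂ)}
    (hJ : ∀ u : Fin d → ℂ, (∀ f ∈ J, eval u f = 0) → u = 0) {s : Finset (Fin d)}
    (I : Fin d → Ideal (MvPolynomial (Fin d) ℂ)) (hI : ∀ l ∈ s, RegularMod (I l) (X l)) :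
    ∃ f ∈ J, ∀ l ∈ s, RegularMod (I l) f := by
  classical
  set R := MvPolynomial (Fin d) ℂ
  let A : Set (Ideal R) := ⋃ l ∈ s, associatedPrimes R (R ⧸ I l)
  have hA : A.Finite := Set.Finite.biUnion s.finite_toSet fun l _ => associatedPrimes.finite _ _
  have hAJ : ∀ P ∈ A, ∃ f ∈ J, f ∉ P := by
    intro P hP
    obtain ⟨l, hl, hP⟩ := Set.mem_iUnion₂.1 hP
    by_contra! hcon
    have : P.IsPrime := hP.isPrime
    have hX := X_mem_of_isPrime hJ hcon l
    have : X l ∈ ⋃ p ∈ associatedPrimes R (R ⧸ I l), (p : Set R) := Set.mem_biUnion hP hX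
    rw [biUnion_associatedPrimes_eq_zero_divisors] at this
    obtain ⟨y, hy0, hy⟩ := this
    obtain ⟨r, rfl⟩ := Ideal.Quotient.mk_surjective y
    rw [← Ideal.Quotient.mk_eq_mk, ← Submodule.Quotient.mk_smul, Submodule.Quotient.mk_eq_zero] at hy
    exact hy0 ((Ideal.Quotient.eq_zero_iff_mem).2 (hI l hl r hy))
  let S : Finset (Subspace ℂ J) := hA.toFinset.image fun P =>
    (P.restrictScalars ℂ).comap J.subtype
  have hS : (⊤ : Subspace ℂ J) ∉ S := by
    intro h
    obtain ⟨P, hP, hPt⟩ := Finset.mem_image.1 h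
    obtain ⟨f, hf, hfP⟩ := hAJ P (hA.mem_toFinset.1 hP)
    have : (⟨f, hf⟩ : J) ∈ (⊤ : Subspace ℂ J) := trivial
    rw [← hPt] at this
    exact hfP this
  obtain ⟨f, hf⟩ := (Set.ne_univ_iff_exists_notMem _).1 (Subspace.biUnion_ne_univ_of_top_notMem hS)
  refine ⟨f, f.2, fun l hl r hr => ?_⟩
  by_contra hrI
  have : (f : R) ∈ ⋃ p ∈ associatedPrimes R (R ⧸ I l), (p : Set R) := by
    rw [biUnion_associatedPrimes_eq_zero_divisors]
    refine ⟨Ideal.Quotient.mk _ r, fun h => hrI ((Ideal.Quotient.eq_zero_iff_mem).1 h), ?_⟩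
    rw [← Ideal.Quotient.mk_eq_mk, ← Submodule.Quotient.mk_smul, Submodule.Quotient.mk_eq_zero]
    exact hr
  obtain ⟨P, hP, hfP⟩ := Set.mem_iUnion₂.1 this
  refine hf (Set.mem_biUnion (x := (P.restrictScalars ℂ).comap J.subtype) ?_ hfP)
  exact Finset.mem_coe.2 (Finset.mem_image_of_mem _ (hA.mem_toFinset.2 (Set.mem_biUnion hl hP)))

theorem homogeneous_mul_induction {σ : Type*} {a b : ℕ} {h : MvPolynomial σ ℂ}
    (hh : h.IsHomogeneous (a + b)) (V : Submodule ℂ (MvPolynomial σ ℂ))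
    (hV : ∀ f g : MvPolynomial σ ℂ, f.IsHomogeneous a → g.IsHomogeneous b → f * g ∈ V) : h ∈ V := by
  have hf' : h ∈ homogeneousSubmodule σ ℂ a * homogeneousSubmodule σ ℂ b := by
    rw [← homogeneousSubmodule_one_pow (σ := σ) (R := ℂ) a,
      ← homogeneousSubmodule_one_pow (σ := σ) (R := ℂ) b, ← pow_add, homogeneousSubmodule_one_pow]
    exact hh
  exact Submodule.mul_induction_on hf' (fun m hm n hn => hV m n hm hn)
    (fun x y hx hy => add_mem hx hy)

theorem exists_mul_of_homogeneous {I : Ideal (MvPolynomial (Fin d) ℂ)} (hI : GradedIdeal I)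
    {x : MvPolynomial (Fin d) ℂ} (hx : x.IsHomogeneous 1) {j : ℕ}
    (h : ∀ f : MvPolynomial (Fin d) ℂ, f.IsHomogeneous (j + 1) → f ∈ I ⊔ Ideal.span {x}) (k : ℕ) :
    ∀ f : MvPolynomial (Fin d) ℂ, f.IsHomogeneous (j + k) →
      ∃ r : MvPolynomial (Fin d) ℂ, r.IsHomogeneous j ∧ f - x ^ k * r ∈ I := by
  induction k with
  | zero => exact fun f hf => ⟨f, hf, by simp⟩
  | succ k ih =>
    intro f hf
    let V : Submodule ℂ (MvPolynomial (Fin d) ℂ) := I.restrictScalars ℂ ⊔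
      (homogeneousSubmodule (Fin d) ℂ j).map (LinearMap.mulLeft ℂ (x ^ (k + 1)))
    have hmem : ∀ f, f ∈ V ↔ ∃ r : MvPolynomial (Fin d) ℂ, r.IsHomogeneous j ∧
        f - x ^ (k + 1) * r ∈ I := by
      intro f
      rw [Submodule.mem_sup]
      constructor
      · rintro ⟨a, ha, _, ⟨r, hr, rfl⟩, rfl⟩
        refine ⟨r, hr, ?_⟩
        simpa using ha
      · rintro ⟨r, hr, h⟩
        exact ⟨_, h, _, ⟨r, hr, rfl⟩, by simp⟩
    rw [← hmem]
    refine homogeneous_mul_induction (a := 1) (b := j + k) (by convert hf using 1; ring) V ?_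
    intro a b ha hb
    obtain ⟨r, hr, hrI⟩ := ih b hb
    obtain ⟨p, hp, q, hq, hpq⟩ := Submodule.mem_sup.1 (h (a * r)
      (by rw [add_comm]; exact ha.mul hr))
    obtain ⟨s, rfl⟩ := Ideal.mem_span_singleton'.1 hq
    rw [hmem]
    refine ⟨homogeneousComponent j s, homogeneousComponent_isHomogeneous _ _, ?_⟩
    have h1 : a * r = homogeneousComponent (1 + j) p + x * homogeneousComponent j s := by
      rw [← homogeneousComponent_homogeneous_mul hx, mul_comm x, ← map_add, hpq,
        homogeneousComponent_of_mem (ha.mul hr), if_pos rfl]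
    have h2 : a * b - x ^ (k + 1) * homogeneousComponent j s =
        a * (b - x ^ k * r) + x ^ k * homogeneousComponent (1 + j) p := by
      linear_combination x ^ k * h1
    rw [h2]
    exact add_mem (Ideal.mul_mem_left _ _ hrI) (Ideal.mul_mem_left _ _ (hI p hp _))

theorem homogeneous_mem_sup_of_regularMod {I : Ideal (MvPolynomial (Fin d) ℂ)} (hI : GradedIdeal I)
    {x f : MvPolynomial (Fin d) ℂ} (hx : x.IsHomogeneous 1) {j m : ℕ} (hf : f.IsHomogeneous m)
    (h : ∀ f : MvPolynomial (Fin d) ℂ, f.IsHomogeneous (j + 1) → f ∈ I ⊔ Ideal.span {x})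
    (hxI : RegularMod I x) (hfI : RegularMod I f) (p : MvPolynomial (Fin d) ℂ)
    (hp : p.IsHomogeneous (j + m)) : p ∈ I ⊔ Ideal.span {f} := by
  have : FiniteDimensional ℂ (homogeneousSubmodule (Fin d) ℂ j) :=
    Module.Finite.iff_fg.2 (homogeneousSubmodule_fg _ _ j)
  let Q : MvPolynomial (Fin d) ℂ →ₗ[ℂ] (MvPolynomial (Fin d) ℂ ⧸ I.restrictScalars ℂ) :=
    Submodule.mkQ (I.restrictScalars ℂ)
  let A (a : MvPolynomial (Fin d) ℂ) := Q ∘ₗ LinearMap.mulLeft ℂ a ∘ₗ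
    (homogeneousSubmodule (Fin d) ℂ j).subtype
  have hker : ∀ a, RegularMod I a → (A a).ker =
      (I.restrictScalars ℂ).comap (homogeneousSubmodule (Fin d) ℂ j).subtype := by
    intro a ha
    ext r
    have : A a r = Q (a * r) := rfl
    rw [LinearMap.mem_ker, this, Submodule.mkQ_apply, Submodule.Quotient.mk_eq_zero]
    exact ⟨fun hr => ha r hr, fun hr => Ideal.mul_mem_left _ _ hr⟩
  have hle : (A f).range ≤ (A (x ^ m)).range := by
    rintro _ ⟨r, rfl⟩
    obtain ⟨s, hs, hsI⟩ := exists_mul_of_homogeneous hI hx h m (f * r)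
      (by rw [add_comm]; exact hf.mul r.2)
    refine ⟨⟨s, hs⟩, ?_⟩
    change Q (x ^ m * s) = Q (f * r)
    rw [eq_comm, ← sub_eq_zero, ← map_sub, Submodule.mkQ_apply, Submodule.Quotient.mk_eq_zero]
    exact hsI
  have heq : (A f).range = (A (x ^ m)).range := by
    refine Submodule.eq_of_le_of_finrank_eq hle ?_
    have h1 := (A f).finrank_range_add_finrank_ker
    have h2 := (A (x ^ m)).finrank_range_add_finrank_ker
    rw [hker _ hfI] at h1
    rw [hker _ (hxI.pow m)] at h2
    omega
  obtain ⟨s, hs, hsI⟩ := exists_mul_of_homogeneous hI hx h m p hp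
  have : Q (x ^ m * s) ∈ (A f).range := by
    rw [heq]; exact ⟨⟨s, hs⟩, rfl⟩
  obtain ⟨r, hr⟩ := this
  change Q (f * r) = Q (x ^ m * s) at hr
  rw [eq_comm, ← sub_eq_zero, ← map_sub, Submodule.mkQ_apply, Submodule.Quotient.mk_eq_zero] at hr
  have hpe : p = (p - x ^ m * s + (x ^ m * s - f * r)) + r * f := by ring
  rw [hpe]
  exact Submodule.add_mem_sup (add_mem hsI hr)
    (Ideal.mul_mem_left _ _ (Ideal.mem_span_singleton_self f))

/-- Macaulay's bound: if forms of degree `m` in `d` variables have no nontrivial common zero, then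
the ideal they generate contains all forms of degree `d * (m - 1) + 1`. -/
theorem macaulay_bound {m : ℕ} {J : Submodule ℂ (MvPolynomial (Fin d) ℂ)}
    (hJm : ∀ f ∈ J, f.IsHomogeneous (m + 1))
    (hJ : ∀ u : Fin d → ℂ, (∀ f ∈ J, eval u f = 0) → u = 0) (p : MvPolynomial (Fin d) ℂ)
    (hp : p.IsHomogeneous (d * m + 1)) : p ∈ Ideal.span (J : Set (MvPolynomial (Fin d) ℂ)) := by
  have key : ∀ i ≤ d, ∃ F : Ideal (MvPolynomial (Fin d) ℂ), GradedIdeal F ∧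
      F ≤ Ideal.span (J : Set (MvPolynomial (Fin d) ℂ)) ∧
      (∀ l : Fin d, i ≤ l → RegularMod (tailIdeal d (l + 1) ⊔ F) (X l)) ∧
      ∀ p : MvPolynomial (Fin d) ℂ, p.IsHomogeneous (i * m + 1) → p ∈ tailIdeal d i ⊔ F := by
    intro i
    induction i with
    | zero =>
      refine fun _ => ⟨⊥, ?_, bot_le, ?_, ?_⟩
      · intro f hf k
        rw [Ideal.mem_bot.1 hf, map_zero]; exact zero_mem _
      · intro l _
        rw [sup_bot_eq]; exact tailIdeal_regularMod l
      · intro p hp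
        rw [zero_mul, zero_add, ← mem_homogeneousSubmodule, homogeneousSubmodule_one_eq_span_X] at hp
        rw [sup_bot_eq]
        refine (Submodule.span_le (p := (tailIdeal d 0).restrictScalars ℂ)).2 ?_ hp
        rintro _ ⟨j, rfl⟩
        exact Ideal.subset_span ⟨j, Nat.zero_le _, rfl⟩
    | succ i ih =>
      intro hi
      obtain ⟨F, hF, hFJ, hreg, hmem⟩ := ih (by omega)
      obtain ⟨f, hfJ, hf⟩ := exists_mem_forall_regularMod hJ
        (s := Finset.univ.filter fun l : Fin d => i ≤ l) (fun l => tailIdeal d (l + 1) ⊔ F)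
        (fun l hl => hreg l (Finset.mem_filter.1 hl).2)
      replace hf : ∀ l : Fin d, i ≤ l → RegularMod (tailIdeal d (l + 1) ⊔ F) f := fun l hl =>
        hf l (Finset.mem_filter.2 ⟨Finset.mem_univ _, hl⟩)
      refine ⟨F ⊔ Ideal.span {f}, hF.sup (GradedIdeal.span ?_), sup_le hFJ ?_, ?_, ?_⟩
      · rintro _ rfl
        exact ⟨_, hJm _ hfJ⟩
      · rw [Ideal.span_singleton_le_iff_mem]
        exact Ideal.subset_span hfJ
      · intro l hl
        rw [← sup_assoc]
        refine (hreg l (by omega)).sup_span ?_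
        have h1 := hf ⟨l - 1, by omega⟩ (by simp only; omega)
        rwa [show ((⟨l - 1, by omega⟩ : Fin d) : ℕ) + 1 = l by simp only; omega, tailIdeal_eq_sup,
          sup_right_comm] at h1
      · intro p hp
        rw [← sup_assoc]
        let l : Fin d := ⟨i, hi⟩
        refine homogeneous_mem_sup_of_regularMod (x := X l) ((tailIdeal_graded _).sup hF)
          (isHomogeneous_X _ _) (hJm f hfJ) (j := i * m) ?_ (hreg l le_rfl) (hf l le_rfl) p
          (by convert hp using 1; ring)
        intro q hq
        have := hmem q hq
        rwa [show i = (l : ℕ) from rfl, tailIdeal_eq_sup, sup_right_comm] at this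
  obtain ⟨F, -, hFJ, -, hmem⟩ := key d le_rfl
  have := hmem p hp
  rw [tailIdeal_of_le le_rfl, bot_sup_eq] at this
  exact hFJ this

end Macaulay

end NoetherIndex

namespace NoetherIndex

open MvPolynomial

section Orbit

open scoped ComplexOrder in
theorem eq_zero_of_star_dotProduct_self {d : ℕ} {v : Fin d → ℂ} (h : star v ⬝ᵥ v = 0) : v = 0 :=
  dotProduct_star_self_eq_zero.1 h

variable {G : Type} [Group G] {d : ℕ} (ρ : Representation ℂ G (Fin d → ℂ))

theorem eval_polySubst (g : G) (v : Fin d → ℂ) (p : MvPolynomial (Fin d) ℂ) :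
    eval v (ρ.polySubst g p) = eval (ρ g v) p := by
  have h : (aeval v).comp (ρ.polySubst g) = aeval (R := ℂ) (ρ g v) := by
    refine MvPolynomial.algHom_ext fun i => ?_
    simp only [AlgHom.comp_apply, Representation.polySubst, aeval_X, map_sum, map_mul, aeval_C,
      Algebra.algebraMap_self, RingHom.id_apply]
    conv_rhs => rw [← LinearMap.toMatrix'_mulVec (ρ g) v]
    rfl
  have := DFunLike.congr_fun h p
  simpa [aeval_eq_eval] using this

theorem eval_polyAct (g : G) (v : Fin d → ℂ) (p : MvPolynomial (Fin d) ℂ) :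
    eval v (polyAct ρ g p) = eval (ρ g⁻¹ v) p :=
  eval_polySubst ρ g⁻¹ v p

theorem polyAct_eq_self_iff {p : MvPolynomial (Fin d) ℂ} {g : G} :
    polyAct ρ g p = p ↔ ∀ v, eval (ρ g⁻¹ v) p = eval v p := by
  simp_rw [← eval_polyAct]
  exact ⟨fun h v => by rw [h], fun h => MvPolynomial.funext h⟩

/-- Restriction of polynomials to the orbit of `u`, as functions on the group. -/
noncomputable def orbitEval (u : Fin d → ℂ) : MvPolynomial (Fin d) ℂ →ₐ[ℂ] (G → ℂ) :=
  AlgHom.pi fun g => aeval (ρ g u)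

theorem orbitEval_apply (u : Fin d → ℂ) (p : MvPolynomial (Fin d) ℂ) (g : G) :
    orbitEval ρ u p g = eval (ρ g u) p := by
  simp [orbitEval, aeval_eq_eval]

/-- Functions on the orbit of `u` given by polynomials of degree less than `k`. -/
noncomputable def orbitFilt (u : Fin d → ℂ) : ℕ → Submodule ℂ (G → ℂ)
  | 0 => ⊥
  | k + 1 => orbitFilt u k ⊔ (homogeneousSubmodule (Fin d) ℂ k).map (orbitEval ρ u).toLinearMap

variable (u : Fin d → ℂ)

theorem orbitFilt_mono : Monotone (orbitFilt ρ u) :=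
  monotone_nat_of_le_succ fun _ => le_sup_left

theorem orbitEval_mem_orbitFilt {k l : ℕ} (hkl : k < l) {f : MvPolynomial (Fin d) ℂ}
    (hf : f.IsHomogeneous k) : orbitEval ρ u f ∈ orbitFilt ρ u l :=
  orbitFilt_mono ρ u (Nat.succ_le_of_lt hkl) (Submodule.mem_sup_right ⟨f, hf, rfl⟩)

theorem exists_of_mem_orbitFilt {k : ℕ} {φ : G → ℂ} (h : φ ∈ orbitFilt ρ u (k + 1)) :
    ∃ p : MvPolynomial (Fin d) ℂ, p.totalDegree ≤ k ∧ orbitEval ρ u p = φ := by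
  induction k generalizing φ with
  | zero =>
    obtain ⟨a, ha, _, ⟨p, hp, rfl⟩, rfl⟩ := Submodule.mem_sup.1 h
    rw [(Submodule.mem_bot ℂ).1 ha, zero_add]
    exact ⟨p, IsHomogeneous.totalDegree_le hp, rfl⟩
  | succ k ih =>
    obtain ⟨a, ha, _, ⟨p, hp, rfl⟩, rfl⟩ := Submodule.mem_sup.1 h
    obtain ⟨q, hq, rfl⟩ := ih ha
    refine ⟨q + p, (totalDegree_add _ _).trans (max_le (hq.trans (Nat.le_succ _))
      (IsHomogeneous.totalDegree_le hp)), map_add _ _ _⟩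

theorem orbitFilt_mul {a k : ℕ} {f : MvPolynomial (Fin d) ℂ} (hf : f.IsHomogeneous a) {φ : G → ℂ}
    (h : φ ∈ orbitFilt ρ u k) : orbitEval ρ u f * φ ∈ orbitFilt ρ u (a + k) := by
  induction k generalizing φ with
  | zero =>
    rw [(Submodule.mem_bot ℂ).1 h, mul_zero]; exact zero_mem _
  | succ k ih =>
    obtain ⟨b, hb, _, ⟨p, hp, rfl⟩, rfl⟩ := Submodule.mem_sup.1 h
    rw [mul_add]
    refine add_mem (orbitFilt_mono ρ u (by omega) (ih hb)) ?_
    rw [AlgHom.toLinearMap_apply, ← map_mul]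
    exact orbitEval_mem_orbitFilt ρ u (by omega) (hf.mul hp)

theorem orbitFilt_translate {k : ℕ} (h : G) {φ : G → ℂ} (hφ : φ ∈ orbitFilt ρ u k) :
    (fun g => φ (h * g)) ∈ orbitFilt ρ u k := by
  induction k generalizing φ with
  | zero =>
    rw [(Submodule.mem_bot ℂ).1 hφ]; exact zero_mem _
  | succ k ih =>
    obtain ⟨b, hb, _, ⟨p, hp, rfl⟩, rfl⟩ := Submodule.mem_sup.1 hφ
    refine Submodule.add_mem_sup (ih hb) ⟨polyAct ρ h⁻¹ p, polyAct_graded ρ _ _ _ hp, ?_⟩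
    ext g
    simp [orbitEval_apply, eval_polyAct]

/-- Forms of degree `k` which are leading forms of polynomials vanishing on the orbit. -/
noncomputable def leadingForms (k : ℕ) : Submodule ℂ (MvPolynomial (Fin d) ℂ) :=
  homogeneousSubmodule (Fin d) ℂ k ⊓ (orbitFilt ρ u k).comap (orbitEval ρ u).toLinearMap

theorem mem_leadingForms {k : ℕ} {f : MvPolynomial (Fin d) ℂ} :
    f ∈ leadingForms ρ u k ↔ f.IsHomogeneous k ∧ orbitEval ρ u f ∈ orbitFilt ρ u k := Iff.rfl

theorem leadingForms_mul {a k : ℕ} {f p : MvPolynomial (Fin d) ℂ} (hf : f.IsHomogeneous a)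
    (hp : p ∈ leadingForms ρ u k) : f * p ∈ leadingForms ρ u (a + k) := by
  rw [mem_leadingForms] at hp ⊢
  refine ⟨hf.mul hp.1, ?_⟩
  rw [map_mul]
  exact orbitFilt_mul ρ u hf hp.2

theorem leadingForms_act {k : ℕ} (h : G) {f : MvPolynomial (Fin d) ℂ}
    (hf : f ∈ leadingForms ρ u k) : polyAct ρ h f ∈ leadingForms ρ u k := by
  rw [mem_leadingForms] at hf ⊢
  refine ⟨polyAct_graded ρ _ _ _ hf.1, ?_⟩
  convert orbitFilt_translate ρ u h⁻¹ hf.2 using 1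
  ext g
  simp [orbitEval_apply, eval_polyAct]

theorem orbitFilt_le_of_leadingForms {a : ℕ}
    (h : ∀ f : MvPolynomial (Fin d) ℂ, f.IsHomogeneous a → f ∈ leadingForms ρ u a) (k : ℕ) :
    orbitFilt ρ u k ≤ orbitFilt ρ u a := by
  induction k with
  | zero => exact bot_le
  | succ k ih =>
    refine sup_le ih ?_
    rintro _ ⟨f, hf, rfl⟩
    rcases lt_or_ge k a with hk | hk
    · exact orbitEval_mem_orbitFilt ρ u hk hf
    · obtain ⟨l, rfl⟩ := Nat.exists_eq_add_of_le hk
      refine ih (homogeneous_mul_induction (a := l) (b := a)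
        (V := (orbitFilt ρ u (a + l)).comap (orbitEval ρ u).toLinearMap)
        (by rw [add_comm]; exact hf) fun p q hp hq => ?_)
      rw [add_comm a l]
      exact (leadingForms_mul ρ u hp (h q hq)).2

/-- Polynomials separate points. -/
theorem exists_eval_eq_ite {s : Finset (Fin d → ℂ)} {v : Fin d → ℂ} (hv : v ∉ s) :
    ∃ p : MvPolynomial (Fin d) ℂ, eval v p = 1 ∧ ∀ w ∈ s, eval w p = 0 := by
  classical
  have h1 : ∀ w : Fin d → ℂ, w ≠ v → ∃ p : MvPolynomial (Fin d) ℂ, eval v p = 1 ∧ eval w p = 0 := by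
    intro w hw
    obtain ⟨i, hi⟩ := Function.ne_iff.1 hw
    refine ⟨C (v i - w i)⁻¹ * (X i - C (w i)), ?_, ?_⟩
    · simp [inv_mul_cancel₀ (sub_ne_zero.2 hi.symm)]
    · simp
  choose! p hp1 hp0 using h1
  refine ⟨∏ w ∈ s, p w, ?_, fun w hw => ?_⟩
  · rw [map_prod]
    exact Finset.prod_eq_one fun w hw => hp1 w (by rintro rfl; exact hv hw)
  · rw [map_prod]
    exact Finset.prod_eq_zero hw (hp0 w (by rintro rfl; exact hv hw))

variable [Fintype G]

theorem orbitEval_mem_of_leadingForms {a : ℕ}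
    (h : ∀ f : MvPolynomial (Fin d) ℂ, f.IsHomogeneous a → f ∈ leadingForms ρ u a)
    (p : MvPolynomial (Fin d) ℂ) : orbitEval ρ u p ∈ orbitFilt ρ u a := by
  rw [← sum_homogeneousComponent p, map_sum]
  exact sum_mem fun i _ => orbitFilt_le_of_leadingForms ρ u h _
    (orbitEval_mem_orbitFilt ρ u (Nat.lt_succ_self i) (homogeneousComponent_isHomogeneous i p))

variable {ρ u}

theorem eval_eq_constantCoeff_of_invariant {m : ℕ}
    (hu : ∀ j, 1 ≤ j → j ≤ m → ∀ f : MvPolynomial (Fin d) ℂ, f.IsHomogeneous j →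
      (∀ g, polyAct ρ g f = f) → eval u f = 0) {f : MvPolynomial (Fin d) ℂ}
    (hf : f.totalDegree ≤ m) (hinv : ∀ g, polyAct ρ g f = f) : eval u f = constantCoeff f := by
  conv_lhs => rw [← sum_homogeneousComponent f, map_sum, Finset.sum_range_succ']
  rw [Finset.sum_eq_zero, zero_add, homogeneousComponent_zero, eval_C, constantCoeff_eq]
  intro i hi
  refine hu _ (by omega) (by have := Finset.mem_range.1 hi; omega) _
    (homogeneousComponent_isHomogeneous _ f) fun g => ?_
  rw [(polyAct_graded ρ).homogeneousComponent, hinv]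

theorem constantCoeff_polyAct (g : G) (f : MvPolynomial (Fin d) ℂ) :
    constantCoeff (polyAct ρ g f) = constantCoeff f := by
  have := eval_polyAct ρ g 0 f
  rwa [map_zero, eval_zero] at this

theorem totalDegree_polyAct_le (g : G) (f : MvPolynomial (Fin d) ℂ) :
    (polyAct ρ g f).totalDegree ≤ f.totalDegree := by
  conv_lhs => rw [← sum_homogeneousComponent f, map_sum]
  refine (totalDegree_finsetSum _ _).trans (Finset.sup_le fun i hi => ?_)
  exact (IsHomogeneous.totalDegree_le (polyAct_graded ρ g i _
    (homogeneousComponent_isHomogeneous i f))).trans (Nat.lt_succ_iff.1 (Finset.mem_range.1 hi))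

theorem sum_eval_orbit {m : ℕ}
    (hu : ∀ j, 1 ≤ j → j ≤ m → ∀ f : MvPolynomial (Fin d) ℂ, f.IsHomogeneous j →
      (∀ g, polyAct ρ g f = f) → eval u f = 0) {f : MvPolynomial (Fin d) ℂ}
    (hf : f.totalDegree ≤ m) :
    ∑ g : G, eval (ρ g u) f = Fintype.card G * constantCoeff f := by
  have h1 := eval_eq_constantCoeff_of_invariant hu (f := ∑ g : G, polyAct ρ g f)
    ((totalDegree_finsetSum _ _).trans (Finset.sup_le fun i _ =>
      (totalDegree_polyAct_le i f).trans hf)) (fun g => act_sum g f)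
  rw [map_sum, map_sum] at h1
  simp_rw [constantCoeff_polyAct, eval_polyAct] at h1
  rw [← Fintype.sum_equiv (Equiv.inv G) (fun g => eval (ρ g⁻¹ u) f) (fun g => eval (ρ g u) f)
    (fun _ => rfl), h1]
  simp

/-- If low degree invariants vanish at a nonzero `u`, then not all forms of a given small degree are
leading forms of polynomials vanishing on the orbit of `u`. -/
theorem exists_not_mem_leadingForms {m a : ℕ} (ham : 2 * a ≤ m) (hm : 1 ≤ m) (hu0 : u ≠ 0)
    (hunit : ∀ g v w, star (ρ g v) ⬝ᵥ ρ g w = star v ⬝ᵥ w)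
    (hu : ∀ j, 1 ≤ j → j ≤ m → ∀ f : MvPolynomial (Fin d) ℂ, f.IsHomogeneous j →
      (∀ g, polyAct ρ g f = f) → eval u f = 0) :
    ∃ f : MvPolynomial (Fin d) ℂ, f.IsHomogeneous (a + 1) ∧ f ∉ leadingForms ρ u (a + 1) := by
  classical
  by_contra! hcon
  obtain ⟨p₀, hp1, hp0⟩ := exists_eval_eq_ite (v := u)
    (s := (Finset.univ.image fun g : G => ρ g u).erase u) (by simp)
  obtain ⟨p, hpa, hp⟩ := exists_of_mem_orbitFilt ρ u (orbitEval_mem_of_leadingForms ρ u hcon p₀)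
  have hval : ∀ g, eval (ρ g u) p = if ρ g u = u then 1 else 0 := by
    intro g
    rw [← orbitEval_apply, hp, orbitEval_apply]
    split_ifs with h
    · rw [h, hp1]
    · exact hp0 _ (Finset.mem_erase.2 ⟨h, Finset.mem_image_of_mem _ (Finset.mem_univ g)⟩)
  have h1 := sum_eval_orbit hu (f := p) (by omega)
  have h2 := sum_eval_orbit hu (f := p ^ 2) ((totalDegree_pow _ _).trans (by omega))
  simp_rw [map_pow, hval] at h2
  simp_rw [hval] at h1
  have hN : (Fintype.card G : ℂ) ≠ 0 := by exact_mod_cast Fintype.card_ne_zero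
  simp only [ite_pow, one_pow, ne_eq, OfNat.ofNat_ne_zero, not_false_eq_true, zero_pow] at h2
  rw [h1] at h2
  have h3 := mul_left_cancel₀ hN h2
  rw [Finset.sum_boole] at h1
  have hc : constantCoeff p = 1 := by
    have hne : constantCoeff p ≠ 0 := by
      intro h0
      rw [h0, mul_zero, Nat.cast_eq_zero, Finset.card_eq_zero] at h1
      have : (1 : G) ∈ (Finset.univ.filter fun g : G => ρ g u = u) := by simp
      rw [h1] at this
      simp at this
    have : constantCoeff p * 1 = constantCoeff p * constantCoeff p := by rw [mul_one, ← pow_two]; exact h3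
    exact (mul_left_cancel₀ hne this).symm
  rw [hc, mul_one, Nat.cast_inj, Finset.card_eq_iff_eq_univ, Finset.filter_eq_self] at h1
  have hfix : ∀ g, ρ g u = u := fun g => h1 g (Finset.mem_univ g)
  let ℓ : MvPolynomial (Fin d) ℂ := ∑ i, C (star u i) * X i
  have hℓe : ∀ v, eval v ℓ = star u ⬝ᵥ v := fun v => by simp [ℓ, dotProduct]
  have hℓ := hu 1 le_rfl hm ℓ (IsHomogeneous.sum _ _ _ fun i _ => isHomogeneous_C_mul_X _ _)
    fun g => by
      rw [polyAct_eq_self_iff]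
      intro v
      rw [hℓe, hℓe, ← hunit g⁻¹ u v, hfix]
  rw [hℓe] at hℓ
  exact hu0 (eq_zero_of_star_dotProduct_self hℓ)

end Orbit

end NoetherIndex

namespace NoetherIndex

open MvPolynomial

section Lines

/-- A linear form vanishing at `b` and not at `a`. -/
theorem exists_linearForm {d : ℕ} {a b : Fin d → ℂ} (hb : b ≠ 0) (hab : ∀ c : ℂ, a ≠ c • b) :
    ∃ ℓ : MvPolynomial (Fin d) ℂ, ℓ.IsHomogeneous 1 ∧ eval b ℓ = 0 ∧ eval a ℓ ≠ 0 := by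
  obtain ⟨q, hq⟩ := Function.ne_iff.1 hb
  obtain ⟨p, hp⟩ := Function.ne_iff.1 (hab (a q / b q))
  refine ⟨C (b q) * X p - C (b p) * X q, (isHomogeneous_C_mul_X _ _).sub
    (isHomogeneous_C_mul_X _ _), ?_, ?_⟩
  · simp [mul_comm]
  · simp only [map_sub, map_mul, eval_C, eval_X]
    intro h
    apply hp
    simp only [Pi.zero_apply] at hq
    simp only [Pi.smul_apply, smul_eq_mul]
    field_simp
    linear_combination h

theorem exists_separating_form {d s k : ℕ} (hs : s ≤ k + 1) {z : Fin s → Fin d → ℂ}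
    (hz : ∀ i, z i ≠ 0) (hpar : ∀ i j, i ≠ j → ∀ c : ℂ, z i ≠ c • z j) (i : Fin s) :
    ∃ p : MvPolynomial (Fin d) ℂ, p.IsHomogeneous k ∧ eval (z i) p = 1 ∧
      ∀ j, j ≠ i → eval (z j) p = 0 := by
  classical
  choose! ℓ hℓ hℓ0 hℓ1 using fun j (hj : j ≠ i) => exists_linearForm (hz j) (hpar i j hj.symm)
  obtain ⟨q, hq⟩ := Function.ne_iff.1 (hz i)
  let p := (∏ j ∈ Finset.univ.erase i, ℓ j) * X q ^ (k + 1 - s)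
  have hp : p.IsHomogeneous k := by
    have h1 : (∏ j ∈ Finset.univ.erase i, ℓ j).IsHomogeneous (∑ j ∈ Finset.univ.erase i, 1) :=
      IsHomogeneous.prod _ _ _ fun j hj => hℓ j (Finset.ne_of_mem_erase hj)
    have h2 := h1.mul ((isHomogeneous_X ℂ q).pow (k + 1 - s))
    convert h2 using 1
    have := i.2
    simp
    omega
  have hpi : eval (z i) p ≠ 0 := by
    simp only [p, map_mul, map_prod, map_pow, eval_X]
    exact mul_ne_zero (Finset.prod_ne_zero_iff.2 fun j hj => hℓ1 j (Finset.ne_of_mem_erase hj))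
      (pow_ne_zero _ hq)
  refine ⟨C (eval (z i) p)⁻¹ * p, hp.C_mul _, by simp [inv_mul_cancel₀ hpi], fun j hj => ?_⟩
  have hpj : eval (z j) p = 0 := by
    simp only [p, map_mul, map_prod]
    rw [Finset.prod_eq_zero (Finset.mem_erase.2 ⟨hj, Finset.mem_univ j⟩) (hℓ0 j hj), zero_mul]
  rw [map_mul, hpj, mul_zero]

/-- Vanishing power sums force all the terms to vanish. -/
theorem eq_zero_of_sum_pow_eq_zero {ι : Type*} [Fintype ι] {w : ι → ℂ} {r : ℕ}
    (hr : (Set.range w).ncard ≤ r) (h : ∀ j, 1 ≤ j → j ≤ r → ∑ i, w i ^ j = 0) (i : ι) :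
    w i = 0 := by
  classical
  by_contra hi
  let S : Finset ℂ := (Finset.univ.image w).erase (w i)
  let q : Polynomial ℂ := Polynomial.X * ∏ s ∈ S, (Polynomial.X - Polynomial.C s)
  have hS : S.card + 1 ≤ r := by
    have : (Finset.univ.image w).card = (Set.range w).ncard := by
      rw [← Set.ncard_coe_finset]; simp
    rw [Finset.card_erase_add_one (Finset.mem_image_of_mem _ (Finset.mem_univ i)), this]
    exact hr
  have hdeg : q.natDegree < r + 1 := by
    refine lt_of_le_of_lt Polynomial.natDegree_mul_le ?_
    rw [Polynomial.natDegree_X, Polynomial.natDegree_prod_of_monic _ _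
      fun s _ => Polynomial.monic_X_sub_C s]
    simp
    omega
  have h1 : ∑ j, q.eval (w j) = 0 := by
    simp_rw [Polynomial.eval_eq_sum_range' hdeg]
    rw [Finset.sum_comm]
    refine Finset.sum_eq_zero fun k hk => ?_
    rw [← Finset.mul_sum]
    rcases Nat.eq_zero_or_pos k with rfl | hk0
    · simp [q]
    · rw [h k hk0 (Nat.lt_succ_iff.1 (Finset.mem_range.1 hk)), mul_zero]
  have h2 : ∀ j, q.eval (w j) = if w j = w i then q.eval (w i) else 0 := by
    intro j
    split_ifs with hj
    · rw [hj]
    · simp only [q, Polynomial.eval_mul, Polynomial.eval_prod]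
      rw [Finset.prod_eq_zero (i := w j) (Finset.mem_erase.2
        ⟨hj, Finset.mem_image_of_mem _ (Finset.mem_univ j)⟩) (by simp), mul_zero]
  rw [Finset.sum_congr rfl fun j _ => h2 j] at h1
  rw [← Finset.sum_filter, Finset.sum_const, nsmul_eq_mul, mul_eq_zero] at h1
  rcases h1 with h1 | h1
  · rw [Nat.cast_eq_zero, Finset.card_eq_zero] at h1
    have : i ∈ Finset.univ.filter fun j => w j = w i := by simp
    rw [h1] at this
    simp at this
  · simp only [q, Polynomial.eval_mul, Polynomial.eval_X, Polynomial.eval_prod, mul_eq_zero, hi,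
      Finset.prod_eq_zero_iff, Polynomial.eval_sub, Polynomial.eval_C, false_or] at h1
    obtain ⟨s, hs, h1⟩ := h1
    exact Finset.ne_of_mem_erase hs (sub_eq_zero.1 h1).symm

end Lines

section Orbit

variable {G : Type} [Group G] [Fintype G] {d : ℕ} {ρ : Representation ℂ G (Fin d → ℂ)}
  {u : Fin d → ℂ}

omit [Fintype G] in
theorem homogeneousComponent_mem_leadingForms {a : ℕ} {f : MvPolynomial (Fin d) ℂ}
    (hf : f ∈ Ideal.span (leadingForms ρ u a : Set (MvPolynomial (Fin d) ℂ))) (k : ℕ) :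
    homogeneousComponent k f ∈ leadingForms ρ u k := by
  induction hf using Submodule.span_induction generalizing k with
  | mem h hh =>
    rw [homogeneousComponent_of_mem ((mem_leadingForms ρ u).1 hh).1]
    split_ifs with hk
    · rw [hk]; exact hh
    · exact zero_mem _
  | zero => simp
  | add x y _ _ hx hy => rw [map_add]; exact add_mem (hx k) (hy k)
  | smul c x _ hx =>
    rw [smul_eq_mul, ← sum_homogeneousComponent c, Finset.sum_mul, map_sum]
    refine sum_mem fun i _ => ?_
    rcases lt_or_ge k i with hk | hk
    · rw [homogeneousComponent_homogeneous_mul_of_lt (homogeneousComponent_isHomogeneous i c) _ hk]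
      exact zero_mem _
    · obtain ⟨k, rfl⟩ := Nat.exists_eq_add_of_le hk
      rw [homogeneousComponent_homogeneous_mul (homogeneousComponent_isHomogeneous i c)]
      exact leadingForms_mul ρ u (homogeneousComponent_isHomogeneous i c) (hx k)

theorem exists_zero_leadingForms {m κ : ℕ} (hκm : 2 * (d * κ) ≤ m) (hm : 1 ≤ m) (hu0 : u ≠ 0)
    (hunit : ∀ g v w, star (ρ g v) ⬝ᵥ ρ g w = star v ⬝ᵥ w)
    (hu : ∀ j, 1 ≤ j → j ≤ m → ∀ f : MvPolynomial (Fin d) ℂ, f.IsHomogeneous j →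
      (∀ g, polyAct ρ g f = f) → eval u f = 0) :
    ∃ z : Fin d → ℂ, z ≠ 0 ∧ ∀ k ≤ κ + 1, ∀ f ∈ leadingForms ρ u k, eval z f = 0 := by
  obtain ⟨f, hf, hfn⟩ := exists_not_mem_leadingForms hκm hm hu0 hunit hu
  have : ∃ z : Fin d → ℂ, z ≠ 0 ∧ ∀ f ∈ leadingForms ρ u (κ + 1), eval z f = 0 := by
    by_contra! hcon
    have h1 := macaulay_bound (J := leadingForms ρ u (κ + 1)) (fun f hf => hf.1)
      (fun z hz => by
        by_contra hz0
        obtain ⟨f, hf, hfz⟩ := hcon z hz0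
        exact hfz (hz f hf)) f hf
    have h2 := homogeneousComponent_mem_leadingForms h1 (d * κ + 1)
    rw [homogeneousComponent_of_mem hf, if_pos rfl] at h2
    exact hfn h2
  obtain ⟨z, hz0, hz⟩ := this
  refine ⟨z, hz0, fun k hk p hp => ?_⟩
  obtain ⟨q, hq⟩ := Function.ne_iff.1 hz0
  have h1 := leadingForms_mul ρ u ((isHomogeneous_X ℂ q).pow (κ + 1 - k)) hp
  rw [show 1 * (κ + 1 - k) + k = κ + 1 by omega] at h1
  have h2 := hz _ h1
  rw [map_mul, map_pow, eval_X, mul_eq_zero] at h2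
  exact h2.resolve_left (pow_ne_zero _ hq)

theorem finrank_orbitFilt_add_le {z : Fin d → ℂ} {k s : ℕ} (hs : s ≤ k + 1) (hz0 : z ≠ 0)
    (hz : ∀ f ∈ leadingForms ρ u k, eval z f = 0) {γ : Fin s → G}
    (hγ : ∀ i j, i ≠ j → ∀ c : ℂ, ρ (γ i) z ≠ c • ρ (γ j) z) :
    Module.finrank ℂ (orbitFilt ρ u k) + s ≤ Module.finrank ℂ (orbitFilt ρ u (k + 1)) := by
  have hne : ∀ g, ρ g z ≠ 0 := by
    intro g h
    apply hz0
    have : ρ g⁻¹ (ρ g z) = z := by simp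
    rw [← this, h, map_zero]
  choose p hp hp1 hp0 using exists_separating_form hs (fun i => hne (γ i)) hγ
  let Ψ : (orbitFilt ρ u k × (Fin s → ℂ)) →ₗ[ℂ] (G → ℂ) :=
    (orbitFilt ρ u k).subtype.coprod
      ((orbitEval ρ u).toLinearMap ∘ₗ Fintype.linearCombination ℂ p)
  have hΨ : ∀ t c, Ψ (t, c) = t + orbitEval ρ u (∑ i, c i • p i) := fun t c => rfl
  have hhom : ∀ c : Fin s → ℂ, (∑ i, c i • p i).IsHomogeneous k := fun c =>
    Submodule.sum_mem (homogeneousSubmodule (Fin d) ℂ k) fun i _ =>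
      Submodule.smul_mem _ _ (hp i)
  have hrange : ∀ x, Ψ x ∈ orbitFilt ρ u (k + 1) := by
    rintro ⟨t, c⟩
    rw [hΨ]
    exact add_mem (orbitFilt_mono ρ u (Nat.le_succ k) t.2)
      (orbitEval_mem_orbitFilt ρ u (Nat.lt_succ_self k) (hhom c))
  have hinj : Function.Injective (Ψ.codRestrict _ hrange) := by
    rw [injective_iff_map_eq_zero]
    rintro ⟨t, c⟩ h
    have h1 : (t : G → ℂ) + orbitEval ρ u (∑ i, c i • p i) = 0 := congrArg Subtype.val h
    have h2 : (∑ i, c i • p i) ∈ leadingForms ρ u k := by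
      rw [mem_leadingForms]
      refine ⟨hhom c, ?_⟩
      rw [eq_neg_of_add_eq_zero_right h1]
      exact neg_mem t.2
    have hc : c = 0 := by
      ext j
      have h3 := hz _ (leadingForms_act ρ u (γ j)⁻¹ h2)
      rw [eval_polyAct, inv_inv, map_sum, Finset.sum_eq_single j] at h3
      · simpa [smul_eval, hp1] using h3
      · intro i _ hij
        rw [smul_eval, hp0 i j hij.symm, mul_zero]
      · simp
    subst hc
    simp only [Pi.zero_apply, zero_smul, Finset.sum_const_zero, map_zero, add_zero] at h1
    rw [Prod.mk_eq_zero]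
    exact ⟨Subtype.ext h1, rfl⟩
  have := LinearMap.finrank_le_finrank_of_injective hinj
  simpa using this

theorem mul_le_card_of_lines {z : Fin d → ℂ} {κ s t : ℕ} (hst : s - 1 + t ≤ κ + 2) (hz0 : z ≠ 0)
    (hz : ∀ k ≤ κ + 1, ∀ f ∈ leadingForms ρ u k, eval z f = 0) {γ : Fin s → G}
    (hγ : ∀ i j, i ≠ j → ∀ c : ℂ, ρ (γ i) z ≠ c • ρ (γ j) z) : t * s ≤ Fintype.card G := by
  have key : ∀ t, s - 1 + t ≤ κ + 2 → t * s ≤ Module.finrank ℂ (orbitFilt ρ u (s - 1 + t)) := by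
    intro t
    induction t with
    | zero => simp
    | succ t ih =>
      intro h
      have h1 := ih (by omega)
      have h2 := finrank_orbitFilt_add_le (u := u) (k := s - 1 + t) (by omega) hz0
        (hz _ (by omega)) hγ
      rw [add_mul, one_mul, ← add_assoc]
      omega
  refine (key t hst).trans ((Submodule.finrank_le _).trans ?_)
  simp

/-- The stabilizer of the line spanned by a vector. -/
def lineStabilizer (ρ : Representation ℂ G (Fin d → ℂ)) (z : Fin d → ℂ) : Subgroup G where
  carrier := {g | ∃ c : ℂ, ρ g z = c • z}
  one_mem' := ⟨1, by simp⟩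
  mul_mem' := by
    rintro a b ⟨x, hx⟩ ⟨y, hy⟩
    exact ⟨y * x, by rw [map_mul, Module.End.mul_apply, hy, map_smul, hx, smul_smul]⟩
  inv_mem' := by
    rintro a ⟨x, hx⟩
    refine ⟨x⁻¹, ?_⟩
    have h : ρ a⁻¹ (ρ a z) = z := by simp
    rw [hx, map_smul] at h
    by_cases hx0 : x = 0
    · rw [hx0, zero_smul] at h
      rw [← h]; simp
    · rw [eq_inv_smul_iff₀ hx0]; exact h

omit [Fintype G] in
theorem mem_lineStabilizer {z : Fin d → ℂ} {g : G} :
    g ∈ lineStabilizer ρ z ↔ ∃ c : ℂ, ρ g z = c • z := Iff.rfl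

omit [Fintype G] in
theorem exists_character {z : Fin d → ℂ} (hz : z ≠ 0) :
    ∃ χ : lineStabilizer ρ z →* ℂˣ, ∀ g : lineStabilizer ρ z, ρ g z = (χ g : ℂ) • z := by
  obtain ⟨q, hq⟩ := Function.ne_iff.1 hz
  simp only [Pi.zero_apply] at hq
  have h : ∀ g : lineStabilizer ρ z, ρ g z = ((ρ g z) q / z q) • z := by
    intro g
    obtain ⟨c, hc⟩ := mem_lineStabilizer.1 g.2
    rw [hc]
    simp [hq]
  let χ₀ : lineStabilizer ρ z →* ℂ :=
    { toFun := fun g => (ρ g z) q / z q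
      map_one' := by simp [hq]
      map_mul' := fun a b => by
        rw [Subgroup.coe_mul, map_mul, Module.End.mul_apply, h b, map_smul]
        simp only [Pi.smul_apply, smul_eq_mul]
        field_simp }
  exact ⟨χ₀.toHomUnits, h⟩

/-- If all invariants of degree between `1` and `m` vanish at `u ≠ 0`, then the group has a cyclic
subgroup of small index compared to the number of translates of a suitable line. -/
theorem exists_cyclic_of_lines {m : ℕ} (hu0 : u ≠ 0)
    (hunit : ∀ g v w, star (ρ g v) ⬝ᵥ ρ g w = star v ⬝ᵥ w)
    (hirr : ∀ V : Submodule ℂ (Fin d → ℂ), (∀ g, ∀ v ∈ V, ρ g v ∈ V) → V = ⊥ ∨ V = ⊤)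
    (hu : ∀ j, 1 ≤ j → j ≤ m → ∀ f : MvPolynomial (Fin d) ℂ, f.IsHomogeneous j →
      (∀ g, polyAct ρ g f = f) → eval u f = 0) {z : Fin d → ℂ} (hz0 : z ≠ 0) :
    ∃ h : G, m + 1 ≤ orderOf h * (lineStabilizer ρ z).index := by
  classical
  let P := lineStabilizer ρ z
  obtain ⟨χ, hχ⟩ : ∃ χ : P →* ℂˣ, ∀ g : P, ρ g z = (χ g : ℂ) • z := exists_character hz0
  obtain ⟨⟨_, h, rfl⟩, hgen⟩ := IsCyclic.exists_generator (α := χ.range)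
  set e := Nat.card χ.range with he
  have hχe : ∀ p, χ p ^ e = 1 := by
    intro p
    have : (⟨χ p, p, rfl⟩ : χ.range) ^ e = 1 := pow_card_eq_one'
    exact congrArg Subtype.val this
  have heo : e ≤ orderOf (h : G) := by
    have h1 : orderOf (⟨χ h, h, rfl⟩ : χ.range) = e := orderOf_eq_card_of_forall_mem_zpowers hgen
    have h2 : orderOf (χ h) = e := by rw [← h1, ← Subgroup.orderOf_coe]
    have h3 : orderOf (χ h) ∣ orderOf h := orderOf_map_dvd χ h
    rw [h2, ← Subgroup.orderOf_coe] at h3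
    exact Nat.le_of_dvd (orderOf_pos _) h3
  refine ⟨h, ?_⟩
  by_contra hlt
  have hlt : e * P.index ≤ m :=
    (Nat.mul_le_mul_right _ heo).trans (Nat.lt_succ_iff.1 (not_le.1 hlt))
  have hepos : 0 < e := Nat.card_pos
  let ℓ : G → MvPolynomial (Fin d) ℂ := fun g => ∑ i, C (star (ρ g z) i) * X i
  have hℓh : ∀ g, (ℓ g).IsHomogeneous 1 := fun g =>
    IsHomogeneous.sum _ _ _ fun i _ => isHomogeneous_C_mul_X _ _
  have hℓe : ∀ g v, eval v (ℓ g) = star (ρ g z) ⬝ᵥ v := fun g v => by simp [ℓ, dotProduct]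
  let w : G → ℂ := fun g => (star (ρ g z) ⬝ᵥ u) ^ e
  have hw : ∀ g : G, ∀ p : P, w (g * p) = w g := by
    intro g p
    simp only [w]
    rw [map_mul, Module.End.mul_apply, hχ, map_smul, star_smul, smul_dotProduct, smul_eq_mul,
      mul_pow, ← star_pow, ← Units.val_pow_eq_pow_val, hχe]
    simp
  have hcard : (Set.range w).ncard ≤ P.index := by
    have : Set.range w ⊆ Set.range fun q : G ⧸ P => w q.out := by
      rintro _ ⟨g, rfl⟩
      refine ⟨(g : G ⧸ P), ?_⟩
      obtain ⟨p, hp⟩ := QuotientGroup.mk_out_eq_mul P g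
      simp only [hp, hw]
    refine (Set.ncard_le_ncard this (Set.toFinite _)).trans ?_
    rw [Subgroup.index, ← Set.ncard_univ, ← Set.image_univ]
    exact Set.ncard_image_le (Set.toFinite _)
  have hsum : ∀ j, 1 ≤ j → j ≤ P.index → ∑ g, w g ^ j = 0 := by
    intro j hj1 hj2
    have h1 := hu (1 * (e * j)) (by rw [one_mul]; exact Nat.mul_pos hepos hj1)
      (by rw [one_mul]; exact (Nat.mul_le_mul_left _ hj2).trans hlt) (∑ g, ℓ g ^ (e * j))
      (IsHomogeneous.sum _ _ _ fun g _ => (hℓh g).pow _) (fun k => by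
        rw [polyAct_eq_self_iff]
        intro v
        simp only [map_sum, map_pow, hℓe]
        refine Fintype.sum_equiv (Equiv.mulLeft k) _ _ fun g => ?_
        rw [Equiv.coe_mulLeft, ← hunit k⁻¹ (ρ (k * g) z) v]
        simp)
    simpa only [map_sum, map_pow, hℓe, pow_mul] using h1
  have hw0 : ∀ g, star (ρ g z) ⬝ᵥ u = 0 := fun g =>
    (pow_eq_zero_iff hepos.ne').1 (eq_zero_of_sum_pow_eq_zero hcard hsum g)
  let V : Submodule ℂ (Fin d → ℂ) := Submodule.span ℂ (Set.range fun g => ρ g z)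
  have hV : V = ⊤ := by
    refine (hirr V fun g v hv => ?_).resolve_left fun hbot => hz0 ?_
    · have : V.map (ρ g) ≤ V := by
        rw [Submodule.map_span, Submodule.span_le]
        rintro _ ⟨_, ⟨k, rfl⟩, rfl⟩
        exact Submodule.subset_span ⟨g * k, by simp⟩
      exact this ⟨v, hv, rfl⟩
    · have : z ∈ V := Submodule.subset_span ⟨1, by simp⟩
      rw [hbot] at this
      exact (Submodule.mem_bot ℂ).1 this
  have hall : ∀ v ∈ V, star v ⬝ᵥ u = 0 := by
    intro v hv
    induction hv using Submodule.span_induction with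
    | mem x hx => obtain ⟨g, rfl⟩ := hx; exact hw0 g
    | zero => simp
    | add x y _ _ hx hy => rw [star_add, add_dotProduct, hx, hy, add_zero]
    | smul c x _ hx => rw [star_smul, smul_dotProduct, hx, smul_zero]
  exact hu0 (eq_zero_of_star_dotProduct_self (hall u (hV ▸ Submodule.mem_top)))

theorem index_lineStabilizer_mul_le {z : Fin d → ℂ} {c κ : ℕ} (hz0 : z ≠ 0)
    (hz : ∀ k ≤ κ + 1, ∀ f ∈ leadingForms ρ u k, eval z f = 0) (hc : 2 * c ≤ κ)
    (hN : Fintype.card G < (c + 1) * (c + 1)) :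
    (c + 1) * (lineStabilizer ρ z).index ≤ Fintype.card G := by
  have key : ∀ s ≤ (lineStabilizer ρ z).index, s ≤ c + 1 → (c + 1) * s ≤ Fintype.card G := by
    intro s hs hsc
    have hcard : Fintype.card (Fin s) ≤ Nat.card (G ⧸ lineStabilizer ρ z) := by
      simpa [Subgroup.index] using hs
    have : Fintype (G ⧸ lineStabilizer ρ z) := Fintype.ofFinite _
    rw [Nat.card_eq_fintype_card] at hcard
    obtain ⟨ι⟩ := Function.Embedding.nonempty_of_card_le hcard
    refine mul_le_card_of_lines (κ := κ) (by omega) hz0 hz (γ := fun i => (ι i).out) ?_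
    intro i j hij x hx
    apply hij
    apply ι.injective
    have h1 : (ι j).out⁻¹ * (ι i).out ∈ lineStabilizer ρ z :=
      mem_lineStabilizer.2 ⟨x, by rw [map_mul, Module.End.mul_apply, hx, map_smul]; simp⟩
    have h2 := QuotientGroup.eq.2 h1
    rw [QuotientGroup.out_eq', QuotientGroup.out_eq'] at h2
    exact h2.symm
  rcases le_or_gt (lineStabilizer ρ z).index (c + 1) with h | h
  · exact key _ le_rfl h
  · exact absurd (key (c + 1) h.le le_rfl) (by omega)

/-- If all invariants of degree between `1` and `m` vanish at a nonzero vector of an irreducible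
representation, then the group has a cyclic subgroup of small index. -/
theorem exists_cyclic_index_le {m c : ℕ} (hu0 : u ≠ 0)
    (hunit : ∀ g v w, star (ρ g v) ⬝ᵥ ρ g w = star v ⬝ᵥ w)
    (hirr : ∀ V : Submodule ℂ (Fin d → ℂ), (∀ g, ∀ v ∈ V, ρ g v ∈ V) → V = ⊥ ∨ V = ⊤)
    (hu : ∀ j, 1 ≤ j → j ≤ m → ∀ f : MvPolynomial (Fin d) ℂ, f.IsHomogeneous j →
      (∀ g, polyAct ρ g f = f) → eval u f = 0) (hm : 1 ≤ m) (hc : 4 * (d * c) ≤ m)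
    (hN : Fintype.card G < (c + 1) * (c + 1)) :
    ∃ h : G, (c + 1) * (m + 1) * (Subgroup.zpowers h).index ≤ Fintype.card G ^ 2 := by
  obtain ⟨z, hz0, hz⟩ := exists_zero_leadingForms (κ := 2 * c) (by linarith) hm hu0 hunit hu
  have h1 := index_lineStabilizer_mul_le hz0 hz le_rfl hN
  obtain ⟨h, hh⟩ := exists_cyclic_of_lines hu0 hunit hirr hu hz0
  refine ⟨h, ?_⟩
  have h2 := (Subgroup.zpowers h).card_mul_index
  rw [Nat.card_zpowers, Nat.card_eq_fintype_card] at h2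
  calc _ = (c + 1) * (Subgroup.zpowers h).index * (m + 1) := by ring
    _ ≤ (c + 1) * (Subgroup.zpowers h).index * (orderOf h * (lineStabilizer ρ z).index) := by gcongr
    _ = ((c + 1) * (lineStabilizer ρ z).index) * (orderOf h * (Subgroup.zpowers h).index) := by ring
    _ ≤ Fintype.card G * Fintype.card G := by rw [h2]; gcongr
    _ = _ := by ring

end Orbit

end NoetherIndex

namespace NoetherIndex

open MeasureTheory Set Filter Topology Polynomial

section RayIntegral

variable {ζ : ℂ}

theorem norm_sq_one_add_ray (hre : ζ.re = 1) (him : ζ.im ^ 2 = 1) (t : ℝ) :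
    ‖1 + t * ζ‖ ^ 2 = 1 + 2 * t + 2 * t ^ 2 := by
  rw [Complex.sq_norm, Complex.normSq_apply]
  simp [hre]
  linear_combination t ^ 2 * him

theorem norm_ray_sq (hre : ζ.re = 1) (him : ζ.im ^ 2 = 1) (t : ℝ) :
    ‖(t : ℂ) * ζ‖ ^ 2 = 2 * t ^ 2 := by
  rw [Complex.sq_norm, Complex.normSq_apply]
  simp [hre]
  linear_combination t ^ 2 * him

theorem one_add_ray_ne_zero (hre : ζ.re = 1) (him : ζ.im ^ 2 = 1) (t : ℝ) :
    1 + t * ζ ≠ 0 := by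
  intro h
  have := norm_sq_one_add_ray hre him t
  rw [h] at this
  simp at this
  nlinarith [sq_nonneg (1 + t), sq_nonneg t]

theorem one_le_norm_one_add_ray (hre : ζ.re = 1) (him : ζ.im ^ 2 = 1) {t : ℝ} (ht : 0 ≤ t) :
    1 ≤ ‖1 + t * ζ‖ := by
  have := norm_sq_one_add_ray hre him t
  nlinarith [norm_nonneg (1 + t * ζ), sq_nonneg t]

theorem norm_ray_le (hre : ζ.re = 1) (him : ζ.im ^ 2 = 1) {t : ℝ} (ht : 0 ≤ t) :
    ‖(t : ℂ) * ζ‖ ≤ ‖1 + t * ζ‖ := by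
  refine le_of_sq_le_sq ?_ (norm_nonneg _)
  rw [norm_sq_one_add_ray hre him, norm_ray_sq hre him]
  linarith

theorem norm_eval_ray_le (hre : ζ.re = 1) (him : ζ.im ^ 2 = 1) {Q : ℂ[X]} {n : ℕ}
    (hQ : Q.natDegree ≤ n) {t : ℝ} (ht : 0 ≤ t) :
    ‖Q.eval (t * ζ)‖ ≤ (∑ k ∈ Finset.range (n + 1), ‖Q.coeff k‖) * ‖1 + t * ζ‖ ^ n := by
  rw [eval_eq_sum_range' (Nat.lt_succ_of_le hQ), Finset.sum_mul]
  refine (norm_sum_le _ _).trans (Finset.sum_le_sum fun k hk => ?_)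
  rw [norm_mul, norm_pow]
  gcongr
  refine (pow_le_pow_left₀ (norm_nonneg _) (norm_ray_le hre him ht) k).trans ?_
  exact pow_le_pow_right₀ (one_le_norm_one_add_ray hre him ht)
    (Nat.lt_succ_iff.1 (Finset.mem_range.1 hk))

theorem continuous_ray (hre : ζ.re = 1) (him : ζ.im ^ 2 = 1) (Q : ℂ[X]) (n : ℕ) :
    Continuous fun t : ℝ => ζ * Q.eval (t * ζ) / (1 + t * ζ) ^ n := by
  have h : Continuous fun t : ℝ => (t : ℂ) * ζ := by fun_prop
  refine Continuous.div (continuous_const.mul (Q.continuous.comp h)) (by fun_prop) fun t => ?_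
  exact pow_ne_zero _ (one_add_ray_ne_zero hre him t)

theorem integrableOn_ray (hre : ζ.re = 1) (him : ζ.im ^ 2 = 1) {Q : ℂ[X]} {n : ℕ}
    (hQ : Q.natDegree ≤ n) :
    IntegrableOn (fun t : ℝ => ζ * Q.eval (t * ζ) / (1 + t * ζ) ^ (n + 2)) (Ioi 0) := by
  set C := ∑ k ∈ Finset.range (n + 1), ‖Q.coeff k‖
  refine Integrable.mono' (g := fun t : ℝ => ‖ζ‖ * C * (1 + t ^ 2)⁻¹)
    ((integrable_inv_one_add_sq.const_mul _).integrableOn)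
    (continuous_ray hre him Q (n + 2)).aestronglyMeasurable ?_
  refine (ae_restrict_iff' measurableSet_Ioi).2 (Eventually.of_forall fun t ht => ?_)
  have ht : 0 ≤ t := le_of_lt ht
  have h1 := norm_eval_ray_le hre him hQ ht
  have h2 := one_le_norm_one_add_ray hre him ht
  have hpos : 0 < ‖1 + t * ζ‖ := by linarith
  rw [norm_div, norm_mul, norm_pow, div_le_iff₀ (by positivity)]
  have h3 : 1 ≤ (1 + t ^ 2)⁻¹ * ‖1 + t * ζ‖ ^ 2 := by
    rw [norm_sq_one_add_ray hre him, ← div_eq_inv_mul, le_div_iff₀ (by positivity)]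
    nlinarith
  calc ‖ζ‖ * ‖Q.eval (t * ζ)‖ ≤ ‖ζ‖ * (C * ‖1 + t * ζ‖ ^ n) := by gcongr
    _ = ‖ζ‖ * C * ‖1 + t * ζ‖ ^ n * 1 := by ring
    _ ≤ ‖ζ‖ * C * ‖1 + t * ζ‖ ^ n * ((1 + t ^ 2)⁻¹ * ‖1 + t * ζ‖ ^ 2) := by gcongr
    _ = _ := by rw [pow_add]; ring

/-- The integral of `Q(u) / (1 + u)^(n + 2)` along the ray through `ζ`. -/
noncomputable def rayInt (ζ : ℂ) (n : ℕ) (Q : ℂ[X]) : ℂ :=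
  ∫ t : ℝ in Ioi 0, ζ * Q.eval (t * ζ) / (1 + t * ζ) ^ (n + 2)

theorem rayInt_add (hre : ζ.re = 1) (him : ζ.im ^ 2 = 1) {n : ℕ} {P Q : ℂ[X]}
    (hP : P.natDegree ≤ n) (hQ : Q.natDegree ≤ n) :
    rayInt ζ n (P + Q) = rayInt ζ n P + rayInt ζ n Q := by
  rw [rayInt, rayInt, rayInt, ← integral_add (integrableOn_ray hre him hP)
    (integrableOn_ray hre him hQ)]
  congr 1
  ext t
  rw [eval_add]
  ring

theorem rayInt_C_mul {n : ℕ} (c : ℂ) (P : ℂ[X]) :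
    rayInt ζ n (C c * P) = c * rayInt ζ n P := by
  rw [rayInt, rayInt, ← integral_const_mul]
  congr 1
  ext t
  rw [eval_mul, eval_C]
  ring

theorem rayInt_sum (hre : ζ.re = 1) (him : ζ.im ^ 2 = 1) {n : ℕ} {ι : Type*} (s : Finset ι)
    {P : ι → ℂ[X]} (hP : ∀ i ∈ s, (P i).natDegree ≤ n) :
    rayInt ζ n (∑ i ∈ s, P i) = ∑ i ∈ s, rayInt ζ n (P i) := by
  classical
  induction s using Finset.induction_on with
  | empty => simp [rayInt]
  | insert a s ha ih =>
    rw [Finset.sum_insert ha, Finset.sum_insert ha, rayInt_add hre him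
      (hP a (Finset.mem_insert_self a s)), ih fun i hi => hP i (Finset.mem_insert_of_mem hi)]
    exact natDegree_sum_le_of_forall_le s P fun i hi => hP i (Finset.mem_insert_of_mem hi)

theorem tendsto_ray (hre : ζ.re = 1) (him : ζ.im ^ 2 = 1) {n : ℕ} {Q : ℂ[X]}
    (hQ : Q.natDegree ≤ n) :
    Tendsto (fun t : ℝ => Q.eval (t * ζ) / (1 + t * ζ) ^ (n + 1)) atTop (𝓝 0) := by
  set C := ∑ k ∈ Finset.range (n + 1), ‖Q.coeff k‖
  have hC : 0 ≤ C := Finset.sum_nonneg fun _ _ => norm_nonneg _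
  have hlim : Tendsto (fun t : ℝ => C / t) atTop (𝓝 0) := tendsto_const_nhds.div_atTop tendsto_id
  refine squeeze_zero_norm' ?_ hlim
  filter_upwards [eventually_gt_atTop 0] with t ht
  have h1 := norm_eval_ray_le hre him hQ ht.le
  have h2 := one_le_norm_one_add_ray hre him ht.le
  have hpos : 0 < ‖1 + t * ζ‖ := by linarith
  have h3 : t ≤ ‖1 + t * ζ‖ := by
    refine le_of_sq_le_sq ?_ (norm_nonneg _)
    rw [norm_sq_one_add_ray hre him]
    nlinarith
  rw [norm_div, norm_pow, div_le_div_iff₀ (by positivity) ht]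
  calc _ ≤ C * ‖1 + t * ζ‖ ^ n * ‖1 + t * ζ‖ := by gcongr
    _ = _ := by ring

/-- Integration of the derivative of `A(u) / (1 + u)^(n + 1)` along a ray. -/
theorem rayInt_derivative (hre : ζ.re = 1) (him : ζ.im ^ 2 = 1) {n : ℕ} {A : ℂ[X]}
    (hA : A.natDegree ≤ n) :
    rayInt ζ n (derivative A * (1 + X) - C ((n : ℂ) + 1) * A) = - A.eval 0 := by
  have hdeg : (derivative A * (1 + X) - C ((n : ℂ) + 1) * A).natDegree ≤ n := by
    refine (natDegree_sub_le _ _).trans (max_le ?_ ((natDegree_C_mul_le _ _).trans hA))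
    rcases Nat.eq_zero_or_pos A.natDegree with h0 | h0
    · rw [eq_C_of_natDegree_eq_zero h0]; simp
    · refine natDegree_mul_le.trans ?_
      have h1 := natDegree_derivative_lt h0.ne'
      have h2 : (1 + X : ℂ[X]).natDegree ≤ 1 := by
        rw [add_comm, ← C_1, natDegree_X_add_C]
      omega
  have hd : ∀ t ∈ Ici (0 : ℝ), HasDerivAt (fun t : ℝ => A.eval (t * ζ) / (1 + t * ζ) ^ (n + 1))
      (ζ * (derivative A * (1 + X) - C ((n : ℂ) + 1) * A).eval (t * ζ) /
        (1 + t * ζ) ^ (n + 2)) t := by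
    intro t _
    have hne := one_add_ray_ne_zero hre him t
    have h1 : HasDerivAt (fun t : ℝ => (t : ℂ) * ζ) ζ t := by
      simpa using (Complex.ofRealCLM.hasDerivAt (x := t)).mul_const ζ
    have h2 : HasDerivAt (fun t : ℝ => A.eval (t * ζ)) ((derivative A).eval (t * ζ) * ζ) t :=
      HasDerivAt.comp (h₂ := fun z : ℂ => A.eval z) t (A.hasDerivAt (t * ζ)) h1
    have h3 := (h1.const_add 1).fun_pow (n + 1)
    have h4 := h2.fun_div h3 (pow_ne_zero _ hne)
    refine h4.congr_deriv ?_
    rw [Nat.add_sub_cancel]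
    simp only [eval_sub, eval_mul, eval_add, eval_one, eval_X, eval_C]
    push_cast
    generalize (derivative A).eval (t * ζ) = α
    generalize A.eval (t * ζ) = β
    generalize 1 + (t : ℂ) * ζ = z at hne
    rw [div_eq_div_iff (by positivity) (by positivity)]
    ring
  rw [rayInt, integral_Ioi_of_hasDerivAt_of_tendsto' hd (integrableOn_ray hre him hdeg)
    (tendsto_ray hre him hA)]
  simp

/-- The Beta-type coefficients `∫ u^k / (1 + u)^(n + 2) du`. -/
noncomputable def betaCoeff (n : ℕ) : ℕ → ℝ
  | 0 => 1 / (n + 1)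
  | k + 1 => (k + 1) / (n - k) * betaCoeff n k

theorem rayInt_X_pow (hre : ζ.re = 1) (him : ζ.im ^ 2 = 1) {n k : ℕ} (hk : k ≤ n) :
    rayInt ζ n (X ^ k) = betaCoeff n k := by
  induction k with
  | zero =>
    have h := rayInt_derivative hre him (n := n) (A := 1) (by simp)
    have h2 : (derivative 1 * (1 + X) - C ((n : ℂ) + 1) * 1 : ℂ[X]) = C (-((n : ℂ) + 1)) * X ^ 0 := by
      simp
    rw [h2, rayInt_C_mul] at h
    have hn : (n : ℂ) + 1 ≠ 0 := Nat.cast_add_one_ne_zero n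
    simp only [eval_one] at h
    simp only [betaCoeff]
    push_cast
    field_simp
    linear_combination -h
  | succ k ih =>
    have h := rayInt_derivative hre him (n := n) (A := X ^ (k + 1)) (by simpa using hk)
    have h2 : (derivative (X ^ (k + 1)) * (1 + X) - C ((n : ℂ) + 1) * X ^ (k + 1) : ℂ[X]) =
        C ((k : ℂ) + 1) * X ^ k + C (-((n : ℂ) - k)) * X ^ (k + 1) := by
      simp only [derivative_X_pow]
      simp only [map_add, map_sub, map_neg, map_natCast, map_one]
      push_cast
      ring
    rw [h2, rayInt_add hre him ((natDegree_C_mul_le _ _).trans (by simp; omega))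
      ((natDegree_C_mul_le _ _).trans (by simpa using hk)), rayInt_C_mul, rayInt_C_mul,
      ih (by omega)] at h
    have hn : (n : ℂ) - k ≠ 0 := sub_ne_zero.2 (by exact_mod_cast (by omega : n ≠ k))
    simp only [eval_pow, eval_X, ne_eq, Nat.add_eq_zero_iff, one_ne_zero, and_false,
      not_false_eq_true, zero_pow, neg_zero] at h
    simp only [betaCoeff]
    push_cast
    field_simp
    linear_combination -h

end RayIntegral

section Majorant

theorem hasDerivAt_one_div_pow {b t : ℝ} (h : 1 + b * t ≠ 0) (k : ℕ) :
    HasDerivAt (fun t : ℝ => 1 / (1 + b * t) ^ k) (-(k * b) / (1 + b * t) ^ (k + 1)) t := by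
  have h1 : HasDerivAt (fun t : ℝ => 1 + b * t) b t := by
    simpa using ((hasDerivAt_id t).const_mul b).const_add 1
  refine ((hasDerivAt_const t (1 : ℝ)).fun_div (h1.fun_pow k) (pow_ne_zero _ h)).congr_deriv ?_
  rcases k with _ | k
  · simp
  · rw [Nat.add_sub_cancel]
    field_simp
    ring

theorem integral_majorant {b : ℝ} (hb : 0 < b) :
    IntegrableOn (fun t : ℝ => t / (1 + b * t) ^ 10) (Ioi 0) ∧
    (∫ t : ℝ in Ioi 0, t / (1 + b * t) ^ 10) = 1 / (72 * b ^ 2) := by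
  have hlim : ∀ k : ℕ, k ≠ 0 → Tendsto (fun t : ℝ => 1 / (1 + b * t) ^ k) atTop (𝓝 0) := by
    intro k hk
    have h1 : Tendsto (fun t : ℝ => 1 + b * t) atTop atTop :=
      tendsto_atTop_add_const_left _ _ (tendsto_id.const_mul_atTop hb)
    exact tendsto_const_nhds.div_atTop ((tendsto_pow_atTop hk).comp h1)
  let F : ℝ → ℝ := fun t => (1 / 9 * (1 / (1 + b * t) ^ 9) - 1 / 8 * (1 / (1 + b * t) ^ 8)) / b ^ 2
  have hF : Tendsto F atTop (𝓝 0) := by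
    have := (((hlim 9 (by simp)).const_mul (1 / 9)).sub ((hlim 8 (by simp)).const_mul
      (1 / 8))).div_const (b ^ 2)
    simpa [F] using this
  have hd : ∀ t ∈ Ici (0 : ℝ), HasDerivAt F (t / (1 + b * t) ^ 10) t := by
    intro t ht
    have ht : 0 ≤ t := ht
    have hne : 1 + b * t ≠ 0 := by positivity
    have h2 := hasDerivAt_one_div_pow hne
    refine ((((h2 9).const_mul (1 / 9)).sub ((h2 8).const_mul (1 / 8))).div_const
      (b ^ 2)).congr_deriv ?_
    push_cast
    field_simp
    ring
  have hnn : ∀ t ∈ Ioi (0 : ℝ), 0 ≤ t / (1 + b * t) ^ 10 := by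
    intro t ht
    have ht : 0 < t := ht
    positivity
  refine ⟨integrableOn_Ioi_deriv_of_nonneg' hd hnn hF, ?_⟩
  rw [integral_Ioi_of_hasDerivAt_of_nonneg' hd hnn hF]
  simp only [F]
  field_simp
  norm_num

theorem integral_majorant_sq {b : ℝ} (hb : 0 < b) :
    IntegrableOn (fun t : ℝ => t ^ 2 / (1 + b * t) ^ 10) (Ioi 0) ∧
    (∫ t : ℝ in Ioi 0, t ^ 2 / (1 + b * t) ^ 10) = 1 / (252 * b ^ 3) := by
  have hlim : ∀ k : ℕ, k ≠ 0 → Tendsto (fun t : ℝ => 1 / (1 + b * t) ^ k) atTop (𝓝 0) := by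
    intro k hk
    have h1 : Tendsto (fun t : ℝ => 1 + b * t) atTop atTop :=
      tendsto_atTop_add_const_left _ _ (tendsto_id.const_mul_atTop hb)
    exact tendsto_const_nhds.div_atTop ((tendsto_pow_atTop hk).comp h1)
  let F : ℝ → ℝ := fun t => (1 / 4 * (1 / (1 + b * t) ^ 8) - 1 / 7 * (1 / (1 + b * t) ^ 7) -
    1 / 9 * (1 / (1 + b * t) ^ 9)) / b ^ 3
  have hF : Tendsto F atTop (𝓝 0) := by
    have := ((((hlim 8 (by simp)).const_mul (1 / 4)).sub ((hlim 7 (by simp)).const_mul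
      (1 / 7))).sub ((hlim 9 (by simp)).const_mul (1 / 9))).div_const (b ^ 3)
    simpa [F] using this
  have hd : ∀ t ∈ Ici (0 : ℝ), HasDerivAt F (t ^ 2 / (1 + b * t) ^ 10) t := by
    intro t ht
    have ht : 0 ≤ t := ht
    have hne : 1 + b * t ≠ 0 := by positivity
    have h2 := hasDerivAt_one_div_pow hne
    refine (((((h2 8).const_mul (1 / 4)).sub ((h2 7).const_mul (1 / 7))).sub
      ((h2 9).const_mul (1 / 9))).div_const (b ^ 3)).congr_deriv ?_
    push_cast
    field_simp
    ring
  have hnn : ∀ t ∈ Ioi (0 : ℝ), 0 ≤ t ^ 2 / (1 + b * t) ^ 10 := by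
    intro t ht
    have ht : 0 < t := ht
    positivity
  refine ⟨integrableOn_Ioi_deriv_of_nonneg' hd hnn hF, ?_⟩
  rw [integral_Ioi_of_hasDerivAt_of_nonneg' hd hnn hF]
  simp only [F]
  field_simp
  norm_num

theorem pow_mul_majorant_le {t κ r s : ℝ} {e : ℕ} (ht : 0 ≤ t) (hκ : 0 ≤ κ) (hr : 0 ≤ r)
    (hs0 : 0 ≤ s) (hs : s ^ 2 = 1 + 2 * t + 2 * t ^ 2) (hrs : r ^ 2 ≤ s ^ 2 - 2 * t * κ) :
    r ^ e * (1 + (10 + e * κ / 10) * t) ^ 10 ≤ s ^ (e + 100) := by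
  set W := s ^ 2 with hW
  have hW1 : 1 ≤ W := by rw [hs]; nlinarith
  have hW0 : 0 < W := by linarith
  have h1 : r ≤ s * Real.exp (-(t * κ / W)) := by
    refine le_of_sq_le_sq ?_ (by positivity)
    rw [mul_pow, ← hW, ← Real.exp_nat_mul]
    have h := Real.add_one_le_exp (((2 : ℕ) : ℝ) * -(t * κ / W))
    calc r ^ 2 ≤ W - 2 * t * κ := hrs
      _ = W * (((2 : ℕ) : ℝ) * -(t * κ / W) + 1) := by push_cast; field_simp; ring
      _ ≤ _ := by gcongr
  have h2 : 1 + (10 + e * κ / 10) * t ≤ W ^ 5 * Real.exp (e * (t * κ / W) / 10) := by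
    have h := Real.add_one_le_exp (e * (t * κ / W) / 10)
    have h5 : 1 + 10 * t ≤ W ^ 5 := by
      have hb := one_add_mul_le_pow (a := 2 * t) (by linarith) 5
      refine le_trans (by norm_num; linarith) (hb.trans ?_)
      gcongr
      rw [hs]; nlinarith
    have h4 : 1 ≤ W ^ 4 := one_le_pow₀ hW1
    calc _ = 1 + 10 * t + e * (t * κ) / 10 * 1 := by ring
      _ ≤ W ^ 5 + e * (t * κ) / 10 * W ^ 4 := by gcongr
      _ = W ^ 5 * (e * (t * κ / W) / 10 + 1) := by field_simp; ring
      _ ≤ _ := by gcongr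
  calc _ ≤ (s * Real.exp (-(t * κ / W))) ^ e * (W ^ 5 * Real.exp (e * (t * κ / W) / 10)) ^ 10 := by
        gcongr
    _ = s ^ e * W ^ 50 * (Real.exp (-(t * κ / W)) ^ e * Real.exp (e * (t * κ / W) / 10) ^ 10) := by
        ring
    _ = s ^ e * W ^ 50 := by
        rw [← Real.exp_nat_mul, ← Real.exp_nat_mul, ← Real.exp_add]
        have : (e : ℝ) * -(t * κ / W) + ((10 : ℕ) : ℝ) * (e * (t * κ / W) / 10) = 0 := by
          push_cast; ring
        rw [this, Real.exp_zero, mul_one]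
    _ = _ := by rw [hW, ← pow_mul, ← pow_add]

end Majorant

end NoetherIndex

namespace NoetherIndex

open MeasureTheory Set Filter Topology Polynomial

section Estimates

variable {ζ φ : ℂ} {e : ℕ}

theorem norm_of_ray (hre : ζ.re = 1) (him : ζ.im ^ 2 = 1) : ‖ζ‖ ^ 2 = 2 := by
  rw [Complex.sq_norm, Complex.normSq_apply, hre]
  linear_combination him

theorem norm_sq_add_ray (hre : ζ.re = 1) (him : ζ.im ^ 2 = 1) (t : ℝ) :
    ‖1 + t * ζ * φ‖ ^ 2 + ‖t * ζ‖ ^ 2 * (1 - ‖φ‖ ^ 2) =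
      ‖1 + t * ζ‖ ^ 2 - 2 * t * (ζ * (1 - φ)).re := by
  rw [norm_sq_one_add_ray hre him, norm_ray_sq hre him, Complex.sq_norm, Complex.sq_norm,
    Complex.normSq_apply, Complex.normSq_apply]
  simp [hre]
  linear_combination (t ^ 2 * (φ.re ^ 2 + φ.im ^ 2)) * him

theorem norm_rayInt_le {n : ℕ} {Q : ℂ[X]} {K : ℝ → ℝ} (hK : IntegrableOn K (Ioi 0))
    (h : ∀ t : ℝ, 0 ≤ t → ‖ζ‖ * ‖Q.eval (t * ζ)‖ ≤ K t * ‖1 + t * ζ‖ ^ (n + 2))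
    (hre : ζ.re = 1) (him : ζ.im ^ 2 = 1) :
    ‖rayInt ζ n Q‖ ≤ ∫ t : ℝ in Ioi 0, K t := by
  refine norm_integral_le_of_norm_le hK
    ((ae_restrict_iff' measurableSet_Ioi).2 (Eventually.of_forall fun t ht => ?_))
  have ht : 0 ≤ t := le_of_lt ht
  have := one_le_norm_one_add_ray hre him ht
  rw [norm_div, norm_mul, norm_pow, div_le_iff₀ (by positivity)]
  exact h t ht

theorem norm_rayInt_moment_le (hre : ζ.re = 1) (him : ζ.im ^ 2 = 1) (hφ : ‖φ‖ ≤ 1)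
    (hκ : 0 ≤ (ζ * (1 - φ)).re) {b : ℝ} (hb : b = 10 + e * (ζ * (1 - φ)).re / 10) :
    ‖rayInt ζ (e + 2 + 98) (X * (1 + C φ * X) ^ (e + 2))‖ ≤ 1 / (36 * b ^ 2) := by
  have hb0 : 0 < b := by rw [hb]; positivity
  obtain ⟨hint, hval⟩ := integral_majorant hb0
  refine (norm_rayInt_le (hint.const_mul 2) ?_ hre him).trans (le_of_eq ?_)
  · intro t ht
    have hs := one_le_norm_one_add_ray hre him ht
    have hs2 := norm_sq_one_add_ray hre him t
    have hadd := norm_sq_add_ray (φ := φ) hre him t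
    have hu := norm_ray_sq hre him t
    set s := ‖1 + t * ζ‖
    have h1 : ‖1 + t * ζ * φ‖ ^ 2 ≤ s ^ 2 - 2 * t * (ζ * (1 - φ)).re := by
      rw [← hadd]
      have : 0 ≤ 1 - ‖φ‖ ^ 2 := by nlinarith [norm_nonneg φ]
      have := mul_nonneg (sq_nonneg ‖t * ζ‖) this
      linarith
    have h2 := pow_mul_majorant_le (e := e) ht hκ (norm_nonneg _) (by linarith) hs2 h1
    rw [← hb] at h2
    have h3 : ‖1 + t * ζ * φ‖ ^ 2 ≤ s ^ 2 := by
      have := mul_nonneg ht hκ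
      linarith
    have h4 : ‖ζ‖ * ‖t * ζ‖ = 2 * t := by
      rw [norm_mul, Complex.norm_real, Real.norm_of_nonneg ht]
      linear_combination t * norm_of_ray hre him
    have h5 : ‖1 + t * ζ * φ‖ ^ (e + 2) * (1 + b * t) ^ 10 ≤ s ^ (e + 2 + 98 + 2) := by
      calc _ = ‖1 + t * ζ * φ‖ ^ e * (1 + b * t) ^ 10 * ‖1 + t * ζ * φ‖ ^ 2 := by ring
        _ ≤ s ^ (e + 100) * s ^ 2 := by gcongr
        _ = _ := by ring
    have hpos : 0 < (1 + b * t) ^ 10 := by positivity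
    rw [eval_mul, eval_X, eval_pow, eval_add, eval_one, eval_mul, eval_C, eval_X, norm_mul,
      ← mul_assoc, h4, norm_pow, mul_comm φ]
    calc _ = 2 * t / (1 + b * t) ^ 10 * (‖1 + t * ζ * φ‖ ^ (e + 2) * (1 + b * t) ^ 10) := by
          field_simp
      _ ≤ 2 * t / (1 + b * t) ^ 10 * s ^ (e + 2 + 98 + 2) := by gcongr
      _ = _ := by ring
  · rw [integral_const_mul, hval]
    field_simp
    norm_num

theorem norm_rayInt_error_le (hre : ζ.re = 1) (him : ζ.im ^ 2 = 1) (hφ : ‖φ‖ ≤ 1)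
    (hκ : 0 ≤ (ζ * (1 - φ)).re) {b : ℝ} (hb : b = 10 + e * (ζ * (1 - φ)).re / 10) {P : ℂ[X]}
    (hP : ∀ (u : ℂ) (r : ℝ), 0 ≤ r → r ^ 2 = ‖1 + u * φ‖ ^ 2 + ‖u‖ ^ 2 * (1 - ‖φ‖ ^ 2) →
      ‖P.eval u - (1 + u * φ) ^ (e + 2)‖ ≤
        3 * ((e + 2 : ℕ) : ℝ) * (‖u‖ ^ 2 * (1 - ‖φ‖ ^ 2)) * r ^ e) :
    ‖rayInt ζ (e + 2 + 98) (P - (1 + C φ * X) ^ (e + 2))‖ ≤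
      ((e + 2 : ℕ) : ℝ) * (1 - ‖φ‖ ^ 2) / (28 * b ^ 3) := by
  have hb0 : 0 < b := by rw [hb]; positivity
  obtain ⟨hint, hval⟩ := integral_majorant_sq hb0
  set D : ℝ := ((e + 2 : ℕ) : ℝ)
  have hD : 0 ≤ D := Nat.cast_nonneg _
  have hε : 0 ≤ 1 - ‖φ‖ ^ 2 := by nlinarith [norm_nonneg φ]
  refine (norm_rayInt_le (hint.const_mul (9 * D * (1 - ‖φ‖ ^ 2))) ?_ hre him).trans (le_of_eq ?_)
  · intro t ht
    have hs := one_le_norm_one_add_ray hre him ht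
    have hs2 := norm_sq_one_add_ray hre him t
    have hadd := norm_sq_add_ray (φ := φ) hre him t
    have hu := norm_ray_sq hre him t
    set s := ‖1 + t * ζ‖
    have h0 : 0 ≤ s ^ 2 - 2 * t * (ζ * (1 - φ)).re := by rw [← hadd]; positivity
    have hr := Real.sq_sqrt h0
    have hr0 := Real.sqrt_nonneg (s ^ 2 - 2 * t * (ζ * (1 - φ)).re)
    set r := √(s ^ 2 - 2 * t * (ζ * (1 - φ)).re)
    have h2 := pow_mul_majorant_le (e := e) ht hκ hr0 (by linarith) hs2 hr.le
    rw [← hb] at h2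
    have h3 := hP (t * ζ) r hr0 (by rw [hr, hadd])
    rw [hu] at h3
    have h4 : ‖ζ‖ ≤ 3 / 2 := by nlinarith [norm_of_ray hre him, norm_nonneg ζ]
    have h5 : s ^ (e + 100) ≤ s ^ (e + 2 + 98 + 2) := pow_le_pow_right₀ hs (by omega)
    have hpos : 0 < (1 + b * t) ^ 10 := by positivity
    rw [eval_sub, eval_pow, eval_add, eval_one, eval_mul, eval_C, eval_X, mul_comm φ]
    calc _ ≤ 3 / 2 * (3 * D * (2 * t ^ 2 * (1 - ‖φ‖ ^ 2)) * r ^ e) := by gcongr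
      _ = 9 * D * (1 - ‖φ‖ ^ 2) * t ^ 2 / (1 + b * t) ^ 10 * (r ^ e * (1 + b * t) ^ 10) := by
          field_simp
          ring
      _ ≤ 9 * D * (1 - ‖φ‖ ^ 2) * t ^ 2 / (1 + b * t) ^ 10 * s ^ (e + 2 + 98 + 2) := by
          gcongr
          exact h2.trans h5
      _ = _ := by ring
  · rw [integral_const_mul, hval]
    field_simp
    ring

theorem rayInt_main (hre : ζ.re = 1) (him : ζ.im ^ 2 = 1) (φ : ℂ) (D : ℕ) :
    ((D + 1) * (1 - φ) + 98) * rayInt ζ (D + 98) ((1 + C φ * X) ^ D) =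
      1 - 98 * φ * rayInt ζ (D + 98) (X * (1 + C φ * X) ^ D) := by
  have hlin : (1 + C φ * X : ℂ[X]).natDegree ≤ 1 := by
    rw [add_comm]
    exact natDegree_linear_le (a := φ) (b := 1)
  have hpow : ∀ k : ℕ, ((1 + C φ * X : ℂ[X]) ^ k).natDegree ≤ k := fun k =>
    natDegree_pow_le_of_le k hlin |>.trans (by simp)
  have h := rayInt_derivative hre him (n := D + 98) (A := (1 + C φ * X) ^ (D + 1))
    ((hpow _).trans (by omega))
  have h2 : (derivative ((1 + C φ * X) ^ (D + 1)) * (1 + X) -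
      C (((D + 98 : ℕ) : ℂ) + 1) * (1 + C φ * X) ^ (D + 1) : ℂ[X]) =
      C (-((D + 1) * (1 - φ) + 98)) * (1 + C φ * X) ^ D +
        C (-(98 * φ)) * (X * (1 + C φ * X) ^ D) := by
    rw [derivative_pow, Nat.add_sub_cancel]
    simp only [derivative_one, derivative_mul, derivative_C, derivative_X,
      map_neg, map_add, map_mul, map_sub, map_one, map_natCast, map_ofNat]
    push_cast
    ring
  rw [h2, rayInt_add hre him ((natDegree_C_mul_le _ _).trans ((hpow D).trans (by omega)))
    ((natDegree_C_mul_le _ _).trans (natDegree_mul_le.trans (by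
      rw [natDegree_X]; have := hpow D; omega))), rayInt_C_mul, rayInt_C_mul] at h
  simp only [eval_pow, eval_add, eval_one, eval_mul, eval_C, eval_X, mul_zero, add_zero,
    one_pow] at h
  linear_combination -h

end Estimates

end NoetherIndex

namespace NoetherIndex

open Polynomial

section KernelBound

theorem exists_ray (ω : ℂ) (hω : 0 ≤ ω.re) :
    ∃ ζ : ℂ, ζ.re = 1 ∧ ζ.im ^ 2 = 1 ∧ ‖ω‖ ≤ (ζ * ω).re := by
  have h := Complex.norm_le_abs_re_add_abs_im ω
  rw [abs_of_nonneg hω] at h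
  rcases le_total 0 ω.im with hq | hq
  · refine ⟨⟨1, -1⟩, rfl, by norm_num, ?_⟩
    rw [abs_of_nonneg hq] at h
    rw [Complex.mul_re]
    simpa using h
  · refine ⟨⟨1, 1⟩, rfl, by norm_num, ?_⟩
    rw [abs_of_nonpos hq] at h
    rw [Complex.mul_re]
    simp only [one_mul]
    linarith

theorem re_add_nonneg_of_bounds {φ A E η Z : ℂ} {b D κ : ℝ} (hφ : ‖φ‖ ≤ 1) (hD : 20000 ≤ D)
    (hκ : ‖1 - φ‖ ≤ κ) (hb : b = 10 + (D - 2) * κ / 10) (hZ : Z = (D + 1) * (1 - φ) + 98)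
    (hA : Z * A = 1 - η) (hη : ‖η‖ ≤ 98 / (36 * b ^ 2))
    (hE : ‖E‖ ≤ D * (1 - ‖φ‖ ^ 2) / (28 * b ^ 3)) : 0 ≤ (A + E).re := by
  have hκ0 : 0 ≤ κ := (norm_nonneg _).trans hκ
  have hb10 : 10 ≤ b := by
    rw [hb]; have := mul_nonneg (by linarith : 0 ≤ D - 2) hκ0; linarith
  have hb0 : 0 < b := by linarith
  have hp : 0 ≤ 1 - φ.re := by linarith [Complex.re_le_norm φ]
  have hZre : Z.re = (D + 1) * (1 - φ.re) + 98 := by rw [hZ]; simp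
  have hZ98 : 98 ≤ Z.re := by rw [hZre]; nlinarith
  have hZn : ‖Z‖ ≤ 10.4 * b := by
    rw [hZ]
    refine (norm_add_le _ _).trans ?_
    rw [norm_mul]
    have h1 : ‖((D : ℂ) + 1)‖ = D + 1 := by
      rw [← Complex.ofReal_one, ← Complex.ofReal_add, Complex.norm_real, Real.norm_of_nonneg]
      linarith
    have h2 : ‖(98 : ℂ)‖ = 98 := by simp
    rw [h1, h2, hb]
    have : (D + 1) * ‖1 - φ‖ ≤ (D + 1) * κ := by gcongr
    nlinarith
  have hN : 0 < Complex.normSq Z := Complex.normSq_pos.2 fun h => by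
    rw [h] at hZ98; norm_num at hZ98
  have hA1 : A.re * Complex.normSq Z = ((1 - η) * (starRingEnd ℂ) Z).re := by
    rw [← hA, mul_assoc, mul_comm A, ← mul_assoc, Complex.mul_conj, Complex.re_ofReal_mul]
    ring
  have hA2 : Z.re - ‖η‖ * ‖Z‖ ≤ A.re * Complex.normSq Z := by
    rw [hA1, sub_mul, one_mul, Complex.sub_re, Complex.conj_re]
    have := Complex.re_le_norm (η * (starRingEnd ℂ) Z)
    rw [norm_mul, Complex.norm_conj] at this
    linarith
  have hη2 : ‖η‖ * ‖Z‖ ≤ 3 := by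
    calc ‖η‖ * ‖Z‖ ≤ 98 / (36 * b ^ 2) * (10.4 * b) := by gcongr
      _ = 98 * 10.4 / (36 * b) := by field_simp
      _ ≤ 3 := by rw [div_le_iff₀ (by positivity)]; linarith
  have hε : 1 - ‖φ‖ ^ 2 ≤ 2 * (1 - φ.re) := by
    have := Complex.re_le_norm φ
    nlinarith [sq_nonneg (1 - φ.re), abs_nonneg φ.re, Complex.sq_norm φ, Complex.normSq_apply φ,
      sq_nonneg φ.im]
  have hE2 : ‖E‖ * Complex.normSq Z ≤ D * (1 - φ.re) := by
    have hD0 : 0 ≤ D * (1 - φ.re) := mul_nonneg (by linarith) hp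
    rw [← Complex.sq_norm]
    calc ‖E‖ * ‖Z‖ ^ 2 ≤ D * (2 * (1 - φ.re)) / (28 * b ^ 3) * (10.4 * b) ^ 2 := by
          gcongr
          refine hE.trans ?_
          gcongr
      _ = D * (1 - φ.re) * (2 * 10.4 ^ 2 / (28 * b)) := by field_simp
      _ ≤ D * (1 - φ.re) * 1 := by
          gcongr
          rw [div_le_one (by positivity)]
          linarith
      _ = _ := mul_one _
  have hE3 : -‖E‖ ≤ E.re := by
    have := Complex.abs_re_le_norm E
    exact (abs_le.1 this).1
  have : 0 ≤ (A + E).re * Complex.normSq Z := by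
    rw [Complex.add_re, add_mul]
    have h1 : -(‖E‖ * Complex.normSq Z) ≤ E.re * Complex.normSq Z := by
      rw [← neg_mul]; gcongr
    rw [hZre] at hA2
    linarith
  exact nonneg_of_mul_nonneg_left this hN

theorem norm_sub_le_of_bounds {φ A E η Z : ℂ} {b D κ : ℝ} (hφ : ‖φ‖ ≤ 2 / 3) (hD : 20000 ≤ D)
    (hκ : ‖1 - φ‖ ≤ κ) (hb : b = 10 + (D - 2) * κ / 10) (hZ : Z = (D + 1) * (1 - φ) + 98)
    (hA : Z * A = 1 - η) (hη : ‖η‖ ≤ 98 / (36 * b ^ 2))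
    (hE : ‖E‖ ≤ D * (1 - ‖φ‖ ^ 2) / (28 * b ^ 3)) :
    ‖(D + 99) * (A + E) - 1 - (D / (D + 98) : ℝ) * φ‖ ≤ 3 * ‖φ‖ ^ 2 + 10 ^ 4 / D := by
  have hD0 : 0 < D := by linarith
  have hp : 1 / 3 ≤ 1 - φ.re := by linarith [Complex.re_le_norm φ]
  have hω : 1 / 3 ≤ ‖1 - φ‖ := by
    have := Complex.re_le_norm (1 - φ)
    simp only [Complex.sub_re, Complex.one_re] at this
    linarith
  have hκ3 : 1 / 3 ≤ κ := hω.trans hκ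
  have hbD : D / 40 ≤ b := by
    rw [hb]
    have : (D - 2) * (1 / 3) ≤ (D - 2) * κ := by gcongr; linarith
    linarith
  have hb0 : 0 < b := by linarith
  have hZn : D / 3 ≤ ‖Z‖ := by
    have hZre : Z.re = (D + 1) * (1 - φ.re) + 98 := by rw [hZ]; simp
    have := Complex.re_le_norm Z
    have : D * (1 / 3) ≤ D * (1 - φ.re) := by gcongr
    nlinarith
  have hη2 : ‖η‖ ≤ 4400 / D ^ 2 := by
    refine hη.trans ?_
    calc 98 / (36 * b ^ 2) ≤ 98 / (36 * (D / 40) ^ 2) := by gcongr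
      _ = (98 * 1600 / 36) / D ^ 2 := by field_simp; norm_num
      _ ≤ _ := by gcongr; norm_num
  have hE2 : ‖E‖ ≤ 2300 / D ^ 2 := by
    refine hE.trans ?_
    calc D * (1 - ‖φ‖ ^ 2) / (28 * b ^ 3) ≤ D * 1 / (28 * (D / 40) ^ 3) := by
          gcongr
          linarith [sq_nonneg ‖φ‖]
      _ = (64000 / 28) / D ^ 2 := by field_simp; norm_num
      _ ≤ _ := by gcongr; norm_num
  have hZ0 : Z ≠ 0 := norm_pos_iff.1 (by linarith [div_pos hD0 three_pos])
  have hω0 : 1 - φ ≠ 0 := norm_pos_iff.1 (by linarith)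
  have hDc : (D : ℂ) + 98 ≠ 0 := by
    have : ((D + 98 : ℝ) : ℂ) ≠ 0 := Complex.ofReal_ne_zero.2 (by linarith)
    push_cast at this
    exact this
  have hA' : A = (1 - η) / Z := by rw [← hA]; field_simp
  have key : (D + 99) * (A + E) - 1 - (D / (D + 98) : ℝ) * φ =
      -(98 * φ / (Z * (1 - φ))) - (D + 99) * η / Z + φ ^ 2 / (1 - φ) + 98 * φ / (D + 98) +
        (D + 99) * E := by
    rw [hA']
    push_cast
    field_simp
    rw [hZ]
    ring
  have hn1 : ‖((D : ℂ) + 99)‖ ≤ 2 * D := by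
    rw [show ((D : ℂ) + 99) = ((D + 99 : ℝ) : ℂ) by push_cast; ring, Complex.norm_real,
      Real.norm_of_nonneg (by linarith)]
    linarith
  have hn2 : D ≤ ‖((D : ℂ) + 98)‖ := by
    rw [show ((D : ℂ) + 98) = ((D + 98 : ℝ) : ℂ) by push_cast; ring, Complex.norm_real,
      Real.norm_of_nonneg (by linarith)]
    linarith
  have b1 : ‖98 * φ / (Z * (1 - φ))‖ ≤ 882 / D := by
    rw [norm_div, norm_mul, norm_mul, Complex.norm_ofNat]
    calc 98 * ‖φ‖ / (‖Z‖ * ‖1 - φ‖) ≤ 98 * 1 / (D / 3 * (1 / 3)) := by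
          gcongr
          linarith
      _ = _ := by field_simp; norm_num
  have b2 : ‖(D + 99) * η / Z‖ ≤ 2 / D := by
    rw [norm_div, norm_mul]
    calc ‖((D : ℂ) + 99)‖ * ‖η‖ / ‖Z‖ ≤ 2 * D * (4400 / D ^ 2) / (D / 3) := by gcongr
      _ = 26400 / D / D := by field_simp; norm_num
      _ ≤ _ := by
          gcongr
          rw [div_le_iff₀ hD0]
          linarith
  have b3 : ‖φ ^ 2 / (1 - φ)‖ ≤ 3 * ‖φ‖ ^ 2 := by
    rw [norm_div, norm_pow]
    calc ‖φ‖ ^ 2 / ‖1 - φ‖ ≤ ‖φ‖ ^ 2 / (1 / 3) := by gcongr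
      _ = _ := by ring
  have b4 : ‖98 * φ / (D + 98)‖ ≤ 98 / D := by
    rw [norm_div, norm_mul, Complex.norm_ofNat]
    calc 98 * ‖φ‖ / ‖((D : ℂ) + 98)‖ ≤ 98 * 1 / D := by
          gcongr
          linarith
      _ = _ := by ring
  have b5 : ‖(D + 99) * E‖ ≤ 4600 / D := by
    rw [norm_mul]
    calc ‖((D : ℂ) + 99)‖ * ‖E‖ ≤ 2 * D * (2300 / D ^ 2) := by gcongr
      _ = _ := by field_simp; norm_num
  rw [key]
  refine (norm_add_le _ _).trans ?_
  have t1 := norm_add_le (-(98 * φ / (Z * (1 - φ))) - (D + 99) * η / Z + φ ^ 2 / (1 - φ))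
    (98 * φ / (D + 98))
  have t2 := norm_add_le (-(98 * φ / (Z * (1 - φ))) - (D + 99) * η / Z) (φ ^ 2 / (1 - φ))
  have t3 := norm_sub_le (-(98 * φ / (Z * (1 - φ)))) ((D + 99) * η / Z)
  rw [norm_neg] at t3
  have t4 : 882 / D + 2 / D + 98 / D + 4600 / D ≤ 10 ^ 4 / D := by
    rw [← add_div, ← add_div, ← add_div]
    gcongr
    norm_num
  linarith

theorem exists_ray_lower_bound {e : ℕ} (he : 20000 ≤ e) {φ : ℂ} (hφ : ‖φ‖ ≤ 1) {P : ℂ[X]}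
    (hdeg : P.natDegree ≤ e + 2)
    (hP : ∀ (u : ℂ) (r : ℝ), 0 ≤ r → r ^ 2 = ‖1 + u * φ‖ ^ 2 + ‖u‖ ^ 2 * (1 - ‖φ‖ ^ 2) →
      ‖P.eval u - (1 + u * φ) ^ (e + 2)‖ ≤
        3 * ((e + 2 : ℕ) : ℝ) * (‖u‖ ^ 2 * (1 - ‖φ‖ ^ 2)) * r ^ e) :
    ∃ ζ : ℂ, ζ.re = 1 ∧ ζ.im ^ 2 = 1 ∧
      -(15 / 4 * ‖φ‖ ^ 2) - 10 ^ 4 / ((e + 2 : ℕ) : ℝ) ≤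
        ((((e + 2 : ℕ) : ℂ) + 99) * rayInt ζ (e + 2 + 98) P).re - 1 -
          ((e + 2 : ℕ) : ℝ) / (((e + 2 : ℕ) : ℝ) + 98) * φ.re := by
  have hp : 0 ≤ (1 - φ).re := by
    simp only [Complex.sub_re, Complex.one_re]
    linarith [Complex.re_le_norm φ]
  obtain ⟨ζ, hre, him, hκ⟩ := exists_ray (1 - φ) hp
  refine ⟨ζ, hre, him, ?_⟩
  have hκ0 : 0 ≤ (ζ * (1 - φ)).re := (norm_nonneg _).trans hκ
  have h1 := norm_rayInt_moment_le (e := e) hre him hφ hκ0 rfl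
  have hE := norm_rayInt_error_le (e := e) hre him hφ hκ0 rfl hP
  have hmain := rayInt_main hre him φ (e + 2)
  have hlin : ((1 + C φ * X : ℂ[X]) ^ (e + 2)).natDegree ≤ e + 2 := by
    refine (natDegree_pow_le_of_le (e + 2) (?_ : _ ≤ 1)).trans (by simp)
    rw [add_comm]
    exact natDegree_linear_le (a := φ) (b := 1)
  have hsplit : rayInt ζ (e + 2 + 98) P = rayInt ζ (e + 2 + 98) ((1 + C φ * X) ^ (e + 2)) +
      rayInt ζ (e + 2 + 98) (P - (1 + C φ * X) ^ (e + 2)) := by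
    rw [← rayInt_add hre him (hlin.trans (by omega))
      ((natDegree_sub_le _ _).trans (max_le (hdeg.trans (by omega)) (hlin.trans (by omega))))]
    congr 1
    ring
  have hcast : (e : ℝ) = ((e + 2 : ℕ) : ℝ) - 2 := by push_cast; ring
  have hcast2 : ((e + 2 : ℕ) : ℂ) = (((e + 2 : ℕ) : ℝ) : ℂ) := by push_cast; ring
  have hD : (20000 : ℝ) ≤ ((e + 2 : ℕ) : ℝ) := by exact_mod_cast (by omega : 20000 ≤ e + 2)
  rw [hcast2] at hmain ⊢
  rw [hcast] at h1 hE
  rw [hsplit]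
  generalize ((e + 2 : ℕ) : ℝ) = D at *
  generalize rayInt ζ (e + 2 + 98) ((1 + C φ * X) ^ (e + 2)) = A at *
  generalize rayInt ζ (e + 2 + 98) (P - (1 + C φ * X) ^ (e + 2)) = E at *
  generalize rayInt ζ (e + 2 + 98) (X * (1 + C φ * X) ^ (e + 2)) = I at *
  have hη : ‖98 * φ * I‖ ≤ 98 / (36 * (10 + (D - 2) * (ζ * (1 - φ)).re / 10) ^ 2) := by
    rw [norm_mul, norm_mul, Complex.norm_ofNat]
    calc 98 * ‖φ‖ * ‖I‖ ≤ 98 * 1 * (1 / (36 * (10 + (D - 2) * (ζ * (1 - φ)).re / 10) ^ 2)) := by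
          gcongr
      _ = _ := by ring
  have hDpos : 0 < D := by linarith
  rcases le_or_gt ‖φ‖ (2 / 3) with hsmall | hbig
  · have h := norm_sub_le_of_bounds hsmall hD hκ rfl rfl hmain hη hE
    have h2 := (abs_le.1 ((Complex.abs_re_le_norm _).trans h)).1
    rw [Complex.sub_re, Complex.sub_re, Complex.one_re, Complex.re_ofReal_mul] at h2
    nlinarith [sq_nonneg ‖φ‖]
  · have h := re_add_nonneg_of_bounds hφ hD hκ rfl rfl hmain hη hE
    have h2 : 0 ≤ (((D : ℂ) + 99) * (A + E)).re := by
      rw [show ((D : ℂ) + 99) = ((D + 99 : ℝ) : ℂ) by push_cast; ring, Complex.re_ofReal_mul]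
      exact mul_nonneg (by linarith) h
    have h3 : D / (D + 98) * φ.re ≤ ‖φ‖ := by
      have h4 : D / (D + 98) ≤ 1 := (div_le_one (by linarith)).2 (by linarith)
      calc D / (D + 98) * φ.re ≤ D / (D + 98) * ‖φ‖ := by
            gcongr
            exact Complex.re_le_norm φ
        _ ≤ 1 * ‖φ‖ := by gcongr
        _ = _ := one_mul _
    have h5 : 0 ≤ 10 ^ 4 / D := by positivity
    nlinarith

/-- The weights with which the forms `Λ(x^(D-k) y^k)` are averaged. -/
noncomputable def weight (D k : ℕ) : ℝ := (D + 99) * D.choose k * betaCoeff (D + 98) k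

theorem weight_zero (D : ℕ) : weight D 0 = 1 := by
  simp only [weight, betaCoeff, Nat.choose_zero_right]
  push_cast
  field_simp
  ring

theorem weight_one (D : ℕ) : weight D 1 = D / (D + 98) := by
  simp only [weight, betaCoeff, Nat.choose_one_right]
  push_cast
  have h1 : (D : ℝ) + 99 ≠ 0 := by positivity
  have h2 : (D : ℝ) + 98 ≠ 0 := by positivity
  rw [show (D : ℝ) + 98 + 1 = D + 99 by ring]
  field_simp
  ring

theorem natDegree_binomialPoly_le (D : ℕ) (f : ℕ → ℂ) :
    (∑ k ∈ Finset.range (D + 1), C ((D.choose k : ℂ) * f k) * X ^ k).natDegree ≤ D :=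
  natDegree_sum_le_of_forall_le _ _ fun k hk => (natDegree_C_mul_le _ _).trans (by
    rw [natDegree_X_pow]; exact Nat.lt_succ_iff.1 (Finset.mem_range.1 hk))

theorem mul_rayInt_eq_sum_weight {ζ : ℂ} (hre : ζ.re = 1) (him : ζ.im ^ 2 = 1) (D : ℕ)
    (f : ℕ → ℂ) :
    ((D : ℂ) + 99) * rayInt ζ (D + 98)
        (∑ k ∈ Finset.range (D + 1), C ((D.choose k : ℂ) * f k) * X ^ k) =
      ∑ k ∈ Finset.range (D + 1), (weight D k : ℂ) * f k := by
  rw [rayInt_sum hre him, Finset.mul_sum]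
  · refine Finset.sum_congr rfl fun k hk => ?_
    rw [rayInt_C_mul, rayInt_X_pow hre him (by have := Finset.mem_range.1 hk; omega), weight]
    push_cast
    ring
  · intro k hk
    refine (natDegree_C_mul_le _ _).trans ?_
    rw [natDegree_X_pow]
    have := Finset.mem_range.1 hk
    omega

theorem sum_weight (D : ℕ) : ∑ k ∈ Finset.range (D + 1), weight D k = (D + 99) / 99 := by
  have hre : (⟨1, 1⟩ : ℂ).re = 1 := rfl
  have him : (⟨1, 1⟩ : ℂ).im ^ 2 = 1 := by norm_num
  have h := mul_rayInt_eq_sum_weight hre him D fun _ => 1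
  have h1 : ∑ k ∈ Finset.range (D + 1), C ((D.choose k : ℂ) * 1) * X ^ k = (1 + X : ℂ[X]) ^ D := by
    rw [add_comm (1 : ℂ[X]) X, add_pow]
    refine Finset.sum_congr rfl fun k _ => ?_
    simp [mul_comm]
  have hlin : (1 + X : ℂ[X]).natDegree ≤ 1 := by
    rw [add_comm, ← C_1]
    exact natDegree_X_add_C _ |>.le
  have h2 := rayInt_derivative hre him (n := D + 98) (A := (1 + X) ^ D)
    ((natDegree_pow_le_of_le D hlin).trans (by omega))
  have h3 : (derivative ((1 + X) ^ D) * (1 + X) - C (((D + 98 : ℕ) : ℂ) + 1) * (1 + X) ^ D : ℂ[X])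
      = C (-99) * (1 + X) ^ D := by
    rcases D with _ | D
    · simp only [pow_zero, derivative_one, zero_mul, map_neg, map_add, map_one, map_natCast,
        map_ofNat]
      push_cast
      ring
    · rw [derivative_pow, Nat.add_sub_cancel]
      simp only [derivative_one, derivative_X, map_neg, map_add, map_one,
        map_natCast, map_ofNat]
      push_cast
      ring
  rw [h3, rayInt_C_mul] at h2
  simp only [eval_pow, eval_add, eval_one, eval_X, add_zero, one_pow] at h2
  rw [h1] at h
  have h4 : rayInt (⟨1, 1⟩ : ℂ) (D + 98) ((1 + X) ^ D) = 1 / 99 := by linear_combination -h2 / 99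
  rw [h4] at h
  simp only [mul_one] at h
  apply Complex.ofReal_injective
  push_cast
  rw [← h]
  ring

/-- Lower bound for the weighted average of the forms `f k`. -/
theorem re_sum_weight_ge {D : ℕ} (hD : 20002 ≤ D) {φ : ℂ} (hφ : ‖φ‖ ≤ 1) {f : ℕ → ℂ}
    (hf : ∀ (u : ℂ) (r : ℝ), 0 ≤ r → r ^ 2 = ‖1 + u * φ‖ ^ 2 + ‖u‖ ^ 2 * (1 - ‖φ‖ ^ 2) →
      ‖∑ k ∈ Finset.range (D + 1), D.choose k * f k * u ^ k - (1 + u * φ) ^ D‖ ≤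
        3 * D * (‖u‖ ^ 2 * (1 - ‖φ‖ ^ 2)) * r ^ (D - 2)) :
    -(15 / 4 * ‖φ‖ ^ 2) - 10 ^ 4 / D ≤
      (∑ k ∈ Finset.range (D + 1), (weight D k : ℂ) * f k).re - 1 - (weight D 1 : ℝ) * φ.re := by
  obtain ⟨e, rfl⟩ : ∃ e, D = e + 2 := ⟨D - 2, by omega⟩
  obtain ⟨ζ, hre, him, h⟩ := exists_ray_lower_bound (e := e) (by omega) hφ
    (natDegree_binomialPoly_le (e + 2) f) (fun u r hr0 hr => by
      have h := hf u r hr0 hr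
      simp only [eval_finsetSum, eval_mul, eval_C, eval_pow, eval_X]
      exact h)
  rw [mul_rayInt_eq_sum_weight hre him] at h
  rw [weight_one]
  exact h

end KernelBound

end NoetherIndex

namespace NoetherIndex

open Polynomial

section ExtremalForm

theorem coeff_one_eq_zero_of_norm_le {p : ℂ[X]} {c : ℝ} {D : ℕ} (h0 : p.eval 0 = 1)
    (hp : ∀ τ : ℂ, ‖p.eval τ‖ ≤ (1 + c * ‖τ‖ ^ 2) ^ D) : p.coeff 1 = 0 := by
  set b := p.coeff 1 with hb
  have hd : p.derivative.eval 0 = b := by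
    rw [← coeff_zero_eq_eval_zero, coeff_derivative]
    simp [hb]
  have h1 : HasDerivAt (fun z : ℂ => p.eval (z * star b)) (b * star b) ((0 : ℝ) : ℂ) := by
    have h2 := (hasDerivAt_id ((0 : ℝ) : ℂ)).mul_const (star b)
    have h3 := HasDerivAt.comp ((0 : ℝ) : ℂ) (p.hasDerivAt (id ((0 : ℝ) : ℂ) * star b)) h2
    simp only [id, Complex.ofReal_zero, zero_mul, hd, one_mul] at h3
    simpa [Function.comp_def] using h3
  have h4 := h1.real_of_complex
  have h5 : HasDerivAt (fun t : ℝ => (1 + c * ‖b‖ ^ 2 * t ^ 2) ^ D) 0 0 := by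
    have := ((((hasDerivAt_id (0 : ℝ)).fun_pow 2).const_mul (c * ‖b‖ ^ 2)).const_add 1).fun_pow D
    simpa using this
  have h6 := h5.sub h4
  have h7 : IsLocalMin ((fun t : ℝ => (1 + c * ‖b‖ ^ 2 * t ^ 2) ^ D) -
      fun t : ℝ => (p.eval ((t : ℂ) * star b)).re) 0 := by
    refine Filter.Eventually.of_forall fun t => ?_
    have h8 := (Complex.re_le_norm _).trans (hp ((t : ℂ) * star b))
    have h9 : ‖(t : ℂ) * star b‖ ^ 2 = ‖b‖ ^ 2 * t ^ 2 := by
      rw [norm_mul, norm_star, mul_pow, Complex.norm_real, Real.norm_eq_abs, sq_abs, mul_comm]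
    rw [h9, ← mul_assoc] at h8
    simpa [h0] using h8
  have h10 := h7.hasDerivAt_eq_zero h6
  have h11 : (b * star b).re = ‖b‖ ^ 2 := by
    rw [Complex.star_def, Complex.mul_conj, Complex.ofReal_re, Complex.normSq_eq_norm_sq]
  rw [h11, zero_sub, neg_eq_zero] at h10
  exact norm_eq_zero.1 (pow_eq_zero_iff two_ne_zero |>.1 h10)

theorem norm_eval_one_sub_one_le {p : ℂ[X]} {s : ℝ} {D : ℕ} (hD : 1 ≤ D) (hs : 0 < s)
    (hDs : D * s ≤ 1) (h0 : p.eval 0 = 1)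
    (hp : ∀ (τ : ℂ) (r : ℝ), 0 ≤ r → r ^ 2 = 1 + s * ‖τ‖ ^ 2 → ‖p.eval τ‖ ≤ r ^ D) :
    ‖p.eval 1 - 1‖ ≤ 3 * D * s := by
  have hD0 : (0 : ℝ) < D := by exact_mod_cast hD
  have h1 : p.coeff 1 = 0 := by
    refine coeff_one_eq_zero_of_norm_le (c := s) (D := D) h0 fun τ => ?_
    have hpos : 0 ≤ s * ‖τ‖ ^ 2 := by positivity
    refine (hp τ _ (Real.sqrt_nonneg _) (Real.sq_sqrt (by linarith))).trans ?_
    refine pow_le_pow_left₀ (Real.sqrt_nonneg _) ?_ _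
    rw [Real.sqrt_le_left (by linarith)]
    nlinarith
  obtain ⟨q, hq⟩ : X ^ 2 ∣ p - 1 := by
    rw [X_pow_dvd_iff]
    intro k hk
    interval_cases k
    · rw [coeff_sub, coeff_zero_eq_eval_zero, h0]; simp
    · rw [coeff_sub, h1, coeff_one]; simp
  have hq' : ∀ τ, p.eval τ - 1 = τ ^ 2 * q.eval τ := fun τ => by
    have := congrArg (eval τ) hq
    simpa using this
  set R := Real.sqrt (1 / (D * s)) with hR
  have hDs0 : 0 < D * s := by positivity
  have hR2 : R ^ 2 = 1 / (D * s) := Real.sq_sqrt (by positivity)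
  have hR1 : 1 ≤ R := by
    rw [hR, Real.one_le_sqrt, le_div_iff₀ hDs0]; linarith
  have hbound : ∀ z ∈ frontier (Metric.ball (0 : ℂ) R), ‖q.eval z‖ ≤ 3 * D * s := by
    intro z hz
    rw [frontier_ball _ (by linarith : R ≠ 0), mem_sphere_zero_iff_norm] at hz
    have hr : 0 ≤ Real.sqrt (1 + 1 / D) := Real.sqrt_nonneg _
    have hr2 : Real.sqrt (1 + 1 / D) ^ 2 = 1 + 1 / D := Real.sq_sqrt (by positivity)
    have h2 := hp z _ hr (by rw [hr2, hz, hR2]; field_simp)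
    have h3 : Real.sqrt (1 + 1 / D) ^ D ≤ 2 := by
      refine le_of_sq_le_sq ?_ (by norm_num)
      rw [← pow_mul, mul_comm, pow_mul, hr2]
      calc (1 + 1 / (D : ℝ)) ^ D ≤ Real.exp (1 / D) ^ D := by
            gcongr
            linarith [Real.add_one_le_exp (1 / (D : ℝ))]
        _ = Real.exp 1 := by rw [← Real.exp_nat_mul]; congr 1; field_simp
        _ ≤ 2 ^ 2 := by linarith [Real.exp_one_lt_d9]
    have h4 : ‖z ^ 2 * q.eval z‖ ≤ 3 := by
      rw [← hq']
      refine (norm_sub_le _ _).trans ?_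
      rw [norm_one]
      linarith
    rw [norm_mul, norm_pow, hz, hR2] at h4
    rw [one_div_mul_eq_div, div_le_iff₀ hDs0] at h4
    linarith
  have h5 := Complex.norm_le_of_forall_mem_frontier_norm_le Metric.isBounded_ball
    q.differentiable.diffContOnCl hbound (z := 1)
    (by rw [closure_ball _ (by linarith : R ≠ 0)]; simpa using hR1)
  rw [hq']
  simpa using h5

variable {E : Type*} [NormedAddCommGroup E] [InnerProductSpace ℂ E] {A : Type*} [CommRing A]
  [Algebra ℂ A] {L : E →ₗ[ℂ] A} {Λ : A →ₗ[ℂ] ℂ} {D : ℕ} {x : E}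

theorem map_add_smul_pow (Λ : A →ₗ[ℂ] ℂ) (a b : A) (D : ℕ) (u : ℂ) :
    Λ ((a + u • b) ^ D) =
      ∑ k ∈ Finset.range (D + 1), D.choose k * Λ (a ^ (D - k) * b ^ k) * u ^ k := by
  rw [add_comm, add_pow, map_sum]
  refine Finset.sum_congr rfl fun k _ => ?_
  have : (u • b) ^ k * a ^ (D - k) * (D.choose k : A) =
      ((D.choose k : ℂ) * u ^ k) • (a ^ (D - k) * b ^ k) := by
    rw [_root_.smul_pow, mul_smul, Algebra.smul_def ((D.choose k : ℕ) : ℂ), map_natCast, smul_mul_assoc,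
      smul_mul_assoc, mul_smul_comm]
    congr 1
    ring
  rw [this, map_smul, smul_eq_mul]
  ring

/-- The restriction of a form to an affine line. -/
noncomputable def linePoly (Λ : A →ₗ[ℂ] ℂ) (a b : A) (D : ℕ) : ℂ[X] :=
  ∑ k ∈ Finset.range (D + 1), C ((D.choose k : ℂ) * Λ (a ^ (D - k) * b ^ k)) * X ^ k

theorem eval_linePoly (Λ : A →ₗ[ℂ] ℂ) (a b : A) (D : ℕ) (u : ℂ) :
    (linePoly Λ a b D).eval u = Λ ((a + u • b) ^ D) := by
  rw [map_add_smul_pow, linePoly]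
  simp [eval_finsetSum]

theorem coeff_linePoly (Λ : A →ₗ[ℂ] ℂ) (a b : A) {D k : ℕ} (hk : k ≤ D) :
    (linePoly Λ a b D).coeff k = D.choose k * Λ (a ^ (D - k) * b ^ k) := by
  simp only [linePoly, finsetSum_coeff, coeff_C_mul_X_pow]
  rw [Finset.sum_ite_eq, if_pos (by simpa using Nat.lt_succ_iff.2 hk)]

theorem norm_add_smul_sq (hx : ‖x‖ = 1) {e : E} (he : inner ℂ x e = 0) (u : ℂ) :
    ‖x + u • e‖ ^ 2 = 1 + ‖e‖ ^ 2 * ‖u‖ ^ 2 := by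
  have h := norm_add_sq_eq_norm_sq_add_norm_sq_of_inner_eq_zero (𝕜 := ℂ) x (u • e)
    (by rw [inner_smul_right, he, mul_zero])
  rw [pow_two, h, hx, norm_smul]
  ring

variable (hF : ∀ y, ‖Λ (L y ^ D)‖ ≤ ‖y‖ ^ D) (hx : ‖x‖ = 1) (hFx : Λ (L x ^ D) = 1)
include hF hx hFx

theorem map_pow_mul_eq_inner (hD : 1 ≤ D) (y : E) :
    Λ (L x ^ (D - 1) * L y) = inner ℂ x y := by
  set e := y - inner ℂ x y • x with he
  have hxe : inner ℂ x e = 0 := by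
    rw [he, inner_sub_right, inner_smul_right, inner_self_eq_norm_sq_to_K, hx]; simp
  have h1 : (linePoly Λ (L x) (L e) D).coeff 1 = 0 := by
    refine coeff_one_eq_zero_of_norm_le (c := ‖e‖ ^ 2) (D := D) ?_ fun τ => ?_
    · rw [eval_linePoly, zero_smul, add_zero, hFx]
    · rw [eval_linePoly, ← map_smul, ← map_add]
      refine (hF _).trans (pow_le_pow_left₀ (norm_nonneg _) ?_ _)
      rw [← norm_add_smul_sq hx hxe]
      have h2 := norm_add_smul_sq hx hxe τ
      have h3 : 0 ≤ ‖e‖ ^ 2 * ‖τ‖ ^ 2 := by positivity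
      nlinarith [norm_nonneg (x + τ • e)]
  rw [coeff_linePoly _ _ _ hD] at h1
  have hD0 : (D.choose 1 : ℂ) ≠ 0 := by
    rw [Nat.choose_one_right]; exact_mod_cast (by omega : D ≠ 0)
  have h2 := (mul_eq_zero.1 h1).resolve_left hD0
  rw [he, map_sub, map_smul, pow_one, mul_sub, map_sub, mul_smul_comm, map_smul,
    ← pow_succ, Nat.sub_add_cancel hD, hFx, smul_eq_mul, mul_one, sub_eq_zero] at h2
  exact h2

theorem norm_map_pow_sub_le (hD : 2 ≤ D) (y : E) :
    ‖Λ (L y ^ D) - inner ℂ x y ^ D‖ ≤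
      3 * D * (‖y‖ ^ 2 - ‖inner ℂ x y‖ ^ 2) * ‖y‖ ^ (D - 2) := by
  set α := inner ℂ x y with hα
  have hαy : ‖α‖ ≤ ‖y‖ := by
    have := norm_inner_le_norm (𝕜 := ℂ) x y
    rwa [hx, one_mul] at this
  have hδ : 0 ≤ ‖y‖ ^ 2 - ‖α‖ ^ 2 := by
    have := pow_le_pow_left₀ (norm_nonneg α) hαy 2
    linarith
  set δ := ‖y‖ ^ 2 - ‖α‖ ^ 2 with hδd
  have hD2 : (2 : ℝ) ≤ D := by exact_mod_cast hD
  rcases le_or_gt (‖y‖ ^ 2) ((D + 1) * δ) with h | h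
  · calc ‖Λ (L y ^ D) - α ^ D‖ ≤ ‖y‖ ^ D + ‖y‖ ^ D := by
          refine (norm_sub_le _ _).trans (add_le_add (hF y) ?_)
          rw [norm_pow]
          exact pow_le_pow_left₀ (norm_nonneg _) hαy _
      _ = 2 * ‖y‖ ^ 2 * ‖y‖ ^ (D - 2) := by
          rw [mul_assoc, ← pow_add, Nat.add_sub_cancel' hD]; ring
      _ ≤ _ := by
          gcongr ?_ * _
          nlinarith
  · have hDδ : D * δ < ‖α‖ ^ 2 := by linarith
    have hα0 : 0 < ‖α‖ := by
      by_contra h0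
      have : ‖α‖ = 0 := le_antisymm (not_lt.1 h0) (norm_nonneg _)
      rw [this] at hDδ
      nlinarith
    have hα1 : α ≠ 0 := norm_pos_iff.1 hα0
    set e := α⁻¹ • y - x with he
    have hxe : inner ℂ x e = 0 := by
      rw [he, inner_sub_right, inner_smul_right, inner_self_eq_norm_sq_to_K, hx, ← hα,
        inv_mul_cancel₀ hα1]
      simp
    have hy : y = α • (x + e) := by
      rw [he, add_sub_cancel, smul_inv_smul₀ hα1]
    have hes : ‖e‖ ^ 2 * ‖α‖ ^ 2 = δ := by
      have h1 := norm_add_smul_sq hx hxe 1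
      have h2 : ‖y‖ ^ 2 = ‖α‖ ^ 2 * ‖x + e‖ ^ 2 := by
        conv_lhs => rw [hy, norm_smul, mul_pow]
      rw [one_smul] at h1
      rw [hδd, h2, h1, norm_one]
      ring
    have hmain : ‖Λ (L (x + e) ^ D) - 1‖ ≤ 3 * D * ‖e‖ ^ 2 := by
      rcases eq_or_lt_of_le (sq_nonneg ‖e‖) with h0 | h0
      · have he0 : e = 0 := norm_eq_zero.1 (pow_eq_zero_iff two_ne_zero |>.1 h0.symm)
        rw [he0, add_zero, hFx]
        simp
      · have := norm_eval_one_sub_one_le (p := linePoly Λ (L x) (L e) D) (D := D) (by omega) h0 ?_ ?_ ?_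
        · rwa [eval_linePoly, one_smul, ← map_add] at this
        · refine le_of_mul_le_mul_right ?_ (pow_pos hα0 2)
          rw [mul_assoc, hes, one_mul]
          exact hDδ.le
        · rw [eval_linePoly, zero_smul, add_zero, hFx]
        · intro τ r hr hr2
          rw [eval_linePoly, ← map_smul, ← map_add]
          refine (hF _).trans (le_of_eq ?_)
          rw [← norm_add_smul_sq hx hxe] at hr2
          rw [(pow_left_inj₀ hr (norm_nonneg _) two_ne_zero).1 hr2]
    calc ‖Λ (L y ^ D) - α ^ D‖ = ‖α‖ ^ D * ‖Λ (L (x + e) ^ D) - 1‖ := by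
          conv_lhs => rw [hy, map_smul, _root_.smul_pow, map_smul, smul_eq_mul]
          rw [← norm_pow, ← norm_mul, mul_sub, mul_one]
      _ ≤ ‖α‖ ^ D * (3 * D * ‖e‖ ^ 2) := by gcongr
      _ = 3 * D * δ * ‖α‖ ^ (D - 2) := by
          obtain ⟨k, rfl⟩ := Nat.exists_eq_add_of_le' hD
          rw [← hes, Nat.add_sub_cancel, pow_add]
          ring
      _ ≤ _ := by gcongr

theorem re_sum_weight_map_ge (hD : 20002 ≤ D) {y : E} (hy : ‖y‖ = 1) :
    -(15 / 4 * ‖(inner ℂ x y : ℂ)‖ ^ 2) - 10 ^ 4 / D ≤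
      (∑ k ∈ Finset.range (D + 1), (weight D k : ℂ) * Λ (L x ^ (D - k) * L y ^ k)).re - 1 -
        weight D 1 * (inner ℂ x y : ℂ).re := by
  have hφ : ‖(inner ℂ x y : ℂ)‖ ≤ 1 := by
    have := norm_inner_le_norm (𝕜 := ℂ) x y
    rwa [hx, hy, one_mul] at this
  refine re_sum_weight_ge hD hφ fun u r hr hr2 => ?_
  have h1 := norm_map_pow_sub_le hF hx hFx (by omega) (x + u • y)
  have hin : inner ℂ x (x + u • y) = 1 + u * inner ℂ x y := by
    rw [inner_add_right, inner_smul_right, inner_self_eq_norm_sq_to_K, hx]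
    simp
  have hn : ‖x + u • y‖ ^ 2 =
      ‖1 + u * inner ℂ x y‖ ^ 2 + ‖u‖ ^ 2 * (1 - ‖(inner ℂ x y : ℂ)‖ ^ 2) := by
    have h2 := norm_add_sq (𝕜 := ℂ) x (u • y)
    rw [inner_smul_right, norm_smul, hx, hy] at h2
    rw [h2]
    generalize (inner ℂ x y : ℂ) = φ
    rw [← Complex.normSq_eq_norm_sq (1 + _), Complex.normSq_add, Complex.normSq_eq_norm_sq,
      Complex.normSq_eq_norm_sq, norm_mul]
    simp
    ring
  have hr' : r = ‖x + u • y‖ := by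
    rw [← hn] at hr2
    exact (pow_left_inj₀ hr (norm_nonneg _) two_ne_zero).1 hr2
  rw [hin, map_add, map_smul, map_add_smul_pow, hn, add_sub_cancel_left, ← hr'] at h1
  exact h1

end ExtremalForm

end NoetherIndex

namespace NoetherIndex

open Polynomial

section OrbitSum

variable {E : Type*} [NormedAddCommGroup E] [InnerProductSpace ℂ E] {A : Type*} [CommRing A]
  [Algebra ℂ A] {L : E →ₗ[ℂ] A} {Λ : A →ₗ[ℂ] ℂ} {D : ℕ} {x : E} {G : Type*} [Group G] [Fintype G]
  {τ : Representation ℂ G E}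

theorem sum_norm_inner_sq_ge (hF : ∀ y, ‖Λ (L y ^ D)‖ ≤ ‖y‖ ^ D) (hx : ‖x‖ = 1)
    (hFx : Λ (L x ^ D) = 1) (hD : 20002 ≤ D) (hτ : ∀ g v, ‖τ g v‖ = ‖v‖)
    (hΛ : ∀ k, 1 ≤ k → k ≤ D → ∑ g, Λ (L x ^ (D - k) * L (τ g x) ^ k) = 0) :
    (D + 99) / 99 - 2 - Fintype.card G * (10 ^ 4 / D : ℝ) ≤
      15 / 4 * ∑ g, ‖(inner ℂ x (τ g x) : ℂ)‖ ^ 2 := by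
  classical
  have hD0 : (0 : ℝ) < D := by exact_mod_cast (by omega : 0 < D)
  set t : G → ℝ := fun g => (∑ k ∈ Finset.range (D + 1),
    (weight D k : ℂ) * Λ (L x ^ (D - k) * L (τ g x) ^ k)).re - 1 -
      weight D 1 * (inner ℂ x (τ g x) : ℂ).re with ht
  have hinner : ∑ g, (inner ℂ x (τ g x) : ℂ) = 0 := by
    rw [← hΛ 1 le_rfl (by omega)]
    refine Finset.sum_congr rfl fun g _ => ?_
    rw [pow_one, map_pow_mul_eq_inner hF hx hFx (by omega)]
  have hsum : ∑ g, t g = 0 := by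
    simp only [ht, Finset.sum_sub_distrib, ← Finset.mul_sum, ← Complex.re_sum, hinner]
    rw [Finset.sum_comm, Finset.sum_eq_single 0]
    · simp [weight_zero, hFx]
    · intro k hk hk0
      rw [← Finset.mul_sum, hΛ k (by omega) (by have := Finset.mem_range.1 hk; omega), mul_zero]
    · simp
  have hone : (D + 99) / 99 - 2 ≤ t 1 := by
    have h1 : ∀ k ∈ Finset.range (D + 1),
        (weight D k : ℂ) * Λ (L x ^ (D - k) * L (τ 1 x) ^ k) = (weight D k : ℂ) := by
      intro k hk
      rw [map_one, Module.End.one_apply, ← pow_add,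
        Nat.sub_add_cancel (Nat.lt_succ_iff.1 (Finset.mem_range.1 hk)), hFx, mul_one]
    have h2 : weight D 1 ≤ 1 := by
      rw [weight_one, div_le_one (by positivity)]; linarith
    simp only [ht]
    rw [Finset.sum_congr rfl h1, ← Complex.ofReal_sum, sum_weight, Complex.ofReal_re, map_one,
      Module.End.one_apply, inner_self_eq_norm_sq_to_K, hx]
    simp
    linarith
  have hother : ∀ g ∈ Finset.univ.erase (1 : G),
      -(15 / 4 * ‖(inner ℂ x (τ g x) : ℂ)‖ ^ 2 + 10 ^ 4 / D) ≤ t g := by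
    intro g _
    have := re_sum_weight_map_ge hF hx hFx hD (y := τ g x) (by rw [hτ, hx])
    simp only [ht]
    linarith
  have h3 := Finset.sum_le_sum hother
  rw [Finset.sum_neg_distrib] at h3
  have h4 : ∑ g ∈ Finset.univ.erase (1 : G), (15 / 4 * ‖(inner ℂ x (τ g x) : ℂ)‖ ^ 2 + 10 ^ 4 / D)
      ≤ ∑ g, (15 / 4 * ‖(inner ℂ x (τ g x) : ℂ)‖ ^ 2 + 10 ^ 4 / (D : ℝ)) :=
    Finset.sum_le_sum_of_subset_of_nonneg (Finset.subset_univ _) fun _ _ _ => by positivity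
  have h5 : ∑ g, (15 / 4 * ‖(inner ℂ x (τ g x) : ℂ)‖ ^ 2 + 10 ^ 4 / (D : ℝ)) =
      15 / 4 * ∑ g, ‖(inner ℂ x (τ g x) : ℂ)‖ ^ 2 + Fintype.card G * (10 ^ 4 / D : ℝ) := by
    rw [Finset.sum_add_distrib, Finset.sum_const, ← Finset.mul_sum, Finset.card_univ, nsmul_eq_mul]
  rw [← Finset.add_sum_erase _ _ (Finset.mem_univ (1 : G))] at hsum
  linarith

end OrbitSum

section Degree

theorem HasDerivAt.nonneg_of_le {f : ℝ → ℝ} {f' : ℝ} (hf : HasDerivAt f f' 1)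
    (h : ∀ t, 0 < t → t < 1 → f t ≤ f 1) : 0 ≤ f' := by
  have h1 := (hasDerivWithinAt_iff_tendsto_slope' (by simp : (1 : ℝ) ∉ Set.Iio 1)).1
    hf.hasDerivWithinAt
  refine ge_of_tendsto h1 ?_
  filter_upwards [self_mem_nhdsWithin, mem_nhdsWithin_of_mem_nhds (Ioi_mem_nhds one_pos)]
    with t ht1 ht0
  rw [slope_def_field]
  exact div_nonneg_of_nonpos (by linarith [h t ht0 ht1]) (by linarith [Set.mem_Iio.1 ht1])

/-- A polynomial bounded by `1` on the unit circle with value `1` at `1` and a zero of order `j` at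
the origin has derivative at least `j` at `1`. -/
theorem le_re_derivative_eval_one {p : ℂ[X]} {j : ℕ} (hp : ∀ z : ℂ, ‖z‖ = 1 → ‖p.eval z‖ ≤ 1)
    (h1 : p.eval 1 = 1) (hj : X ^ j ∣ p) : (j : ℝ) ≤ (p.derivative.eval 1).re := by
  obtain ⟨r, rfl⟩ := hj
  have hr1 : r.eval 1 = 1 := by simpa using h1
  have hr : ∀ z : ℂ, ‖z‖ ≤ 1 → ‖r.eval z‖ ≤ 1 := by
    intro z hz
    refine Complex.norm_le_of_forall_mem_frontier_norm_le (Metric.isBounded_ball (x := (0 : ℂ)))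
      r.differentiable.diffContOnCl (fun w hw => ?_) (z := z)
      (by rw [closure_ball _ one_ne_zero]; simpa using hz)
    rw [frontier_ball _ one_ne_zero, mem_sphere_zero_iff_norm] at hw
    have := hp w hw
    rwa [eval_mul, eval_pow, eval_X, norm_mul, norm_pow, hw, one_pow, one_mul] at this
  have hd : HasDerivAt (fun t : ℝ => (r.eval (t : ℂ)).re) (r.derivative.eval 1).re 1 := by
    have := (r.hasDerivAt ((1 : ℝ) : ℂ)).real_of_complex
    simpa using this
  have h2 := HasDerivAt.nonneg_of_le hd fun t ht0 ht1 => by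
    have h3 := (Complex.re_le_norm _).trans (hr (t : ℂ) (by
      rw [Complex.norm_real, Real.norm_eq_abs, abs_of_pos ht0]; exact ht1.le))
    simpa [hr1] using h3
  rw [derivative_mul, derivative_X_pow]
  simp [hr1]
  linarith

end Degree

end NoetherIndex

namespace NoetherIndex

section OrbitOperator

variable {E : Type*} [NormedAddCommGroup E] [InnerProductSpace ℂ E] {G : Type*} [Group G]
  {τ : Representation ℂ G E}

theorem inner_map_map_of_norm (hτ : ∀ g v, ‖τ g v‖ = ‖v‖) (g : G) (v w : E) :
    inner ℂ (τ g v) (τ g w) = inner ℂ v w :=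
  LinearIsometry.inner_map_map (⟨τ g, hτ g⟩ : E →ₗᵢ[ℂ] E) v w

theorem inner_map_left_of_norm (hτ : ∀ g v, ‖τ g v‖ = ‖v‖) (g : G) (v w : E) :
    inner ℂ (τ g v) w = inner ℂ v (τ g⁻¹ w) := by
  rw [← inner_map_map_of_norm hτ g⁻¹, ← Module.End.mul_apply, ← map_mul, inv_mul_cancel, map_one,
    Module.End.one_apply]

variable [Fintype G]

/-- The sum of the rank one operators attached to the orbit of `x`. -/
noncomputable def orbitOperator (τ : Representation ℂ G E) (x : E) : E →ₗ[ℂ] E :=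
  ∑ g, ((innerSL ℂ (τ g x)).toLinearMap).smulRight (τ g x)

theorem orbitOperator_apply (x v : E) :
    orbitOperator τ x v = ∑ g, (inner ℂ (τ g x) v : ℂ) • τ g x := by
  simp [orbitOperator]

theorem inner_orbitOperator (x v w : E) :
    inner ℂ v (orbitOperator τ x w) = ∑ g, (inner ℂ (τ g x) w : ℂ) * inner ℂ v (τ g x) := by
  rw [orbitOperator_apply, inner_sum]
  simp_rw [inner_smul_right]

theorem inner_orbitOperator_self (x v : E) :
    inner ℂ v (orbitOperator τ x v) = ((∑ g, ‖(inner ℂ (τ g x) v : ℂ)‖ ^ 2 : ℝ) : ℂ) := by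
  rw [inner_orbitOperator, Complex.ofReal_sum]
  refine Finset.sum_congr rfl fun g _ => ?_
  rw [← inner_conj_symm v, Complex.mul_conj, Complex.normSq_eq_norm_sq]

theorem orbitOperator_isSymmetric (x : E) : (orbitOperator τ x).IsSymmetric := by
  intro v w
  rw [inner_orbitOperator, ← inner_conj_symm, inner_orbitOperator, map_sum]
  refine Finset.sum_congr rfl fun g _ => ?_
  rw [map_mul, inner_conj_symm, inner_conj_symm, mul_comm]

theorem orbitOperator_map (hτ : ∀ g v, ‖τ g v‖ = ‖v‖) (x : E) (h : G) (v : E) :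
    orbitOperator τ x (τ h v) = τ h (orbitOperator τ x v) := by
  rw [orbitOperator_apply, orbitOperator_apply, map_sum]
  refine (Fintype.sum_equiv (Equiv.mulLeft h) _ _ fun g => ?_).symm
  simp only [Equiv.coe_mulLeft, map_mul, Module.End.mul_apply, map_smul]
  rw [inner_map_map_of_norm hτ]

variable [FiniteDimensional ℂ E]

theorem exists_eigenvalue_ge {T : E →ₗ[ℂ] E} (hT : T.IsSymmetric) {x : E} (hx : ‖x‖ = 1) :
    ∃ μ : ℝ, (inner ℂ x (T x) : ℂ).re ≤ μ ∧ Module.End.HasEigenvalue T (μ : ℂ) := by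
  set b := hT.eigenvectorBasis rfl with hb
  by_contra! h
  have hlt : ∀ i, hT.eigenvalues rfl i < (inner ℂ x (T x) : ℂ).re := fun i => by
    by_contra! h1
    exact h _ h1 (hT.hasEigenvalue_eigenvalues rfl i)
  have h1 : (inner ℂ x (T x) : ℂ).re = ∑ i, hT.eigenvalues rfl i * ‖(inner ℂ (b i) x : ℂ)‖ ^ 2 := by
    rw [← b.sum_inner_mul_inner x (T x), Complex.re_sum]
    refine Finset.sum_congr rfl fun i _ => ?_
    rw [← hT, hT.apply_eigenvectorBasis, inner_smul_left, ← inner_conj_symm x]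
    have := Complex.mul_conj (inner ℂ (b i) x : ℂ)
    rw [Complex.normSq_eq_norm_sq] at this
    rw [mul_left_comm, mul_comm (starRingEnd ℂ _) (inner ℂ (b i) x : ℂ), this]
    simp [-Complex.ofReal_mul, -Complex.ofReal_pow]
  have h2 : ∑ i, ‖(inner ℂ (b i) x : ℂ)‖ ^ 2 = 1 := by
    rw [b.sum_sq_norm_inner_right, hx, one_pow]
  have h3 : ∑ i, hT.eigenvalues rfl i * ‖(inner ℂ (b i) x : ℂ)‖ ^ 2 <
      ∑ i, (inner ℂ x (T x) : ℂ).re * ‖(inner ℂ (b i) x : ℂ)‖ ^ 2 := by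
    refine Finset.sum_lt_sum (fun i _ => by have := (hlt i).le; gcongr) ?_
    obtain ⟨i, -, hi⟩ := Finset.exists_ne_zero_of_sum_ne_zero (h2.trans_ne one_ne_zero)
    exact ⟨i, Finset.mem_univ _, mul_lt_mul_of_pos_right (hlt i)
      (lt_of_le_of_ne (sq_nonneg _) (Ne.symm hi))⟩
  rw [← Finset.mul_sum, h2, mul_one, ← h1] at h3
  exact lt_irrefl _ h3

/-- A unitary representation has an irreducible constituent on which the unit vector `x` has a large
component, measured by the mean square of its matrix coefficient. -/
theorem exists_irreducible_component (hτ : ∀ g v, ‖τ g v‖ = ‖v‖) {x : E} (hx : ‖x‖ = 1) :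
    ∃ U : Submodule ℂ E, U ≠ ⊥ ∧ (∀ g, ∀ v ∈ U, τ g v ∈ U) ∧
      (∀ V ≤ U, (∀ g, ∀ v ∈ V, τ g v ∈ V) → V = ⊥ ∨ V = U) ∧
      ∃ y ∈ U, (∀ u ∈ U, inner ℂ u (x - y) = (0 : ℂ)) ∧
        Module.finrank ℂ U * ∑ g, ‖(inner ℂ x (τ g x) : ℂ)‖ ^ 2 ≤ Fintype.card G * ‖y‖ ^ 2 := by
  obtain ⟨μ, hμ, hev⟩ := exists_eigenvalue_ge (orbitOperator_isSymmetric (τ := τ) x) hx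
  rw [inner_orbitOperator_self, Complex.ofReal_re] at hμ
  obtain ⟨U, ⟨hU0, hUinv, hUle⟩, hUmin⟩ := wellFounded_lt.has_min
    {V : Submodule ℂ E | V ≠ ⊥ ∧ (∀ g, ∀ v ∈ V, τ g v ∈ V) ∧
      V ≤ Module.End.eigenspace (orbitOperator τ x) (μ : ℂ)}
    ⟨_, hev, fun g v hv => by
      rw [Module.End.mem_eigenspace_iff] at hv ⊢
      rw [orbitOperator_map hτ, hv, map_smul], le_rfl⟩
  refine ⟨U, hU0, hUinv, fun V hV hVinv => ?_, U.starProjection x, by simp, fun u hu => ?_, ?_⟩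
  · by_contra! h
    exact hUmin V ⟨h.1, hVinv, hV.trans hUle⟩ (lt_of_le_of_ne hV h.2)
  · exact U.sub_starProjection_mem_orthogonal x u hu
  set y := U.starProjection x with hy
  have hxy : ∀ u ∈ U, (inner ℂ x u : ℂ) = inner ℂ y u := fun u hu => by
    have := U.sub_starProjection_mem_orthogonal x u hu
    rw [← inner_conj_symm, map_eq_zero, inner_sub_left, sub_eq_zero] at this
    exact this
  let b := stdOrthonormalBasis ℂ U
  have hb : Orthonormal ℂ fun i => (b i : E) := b.orthonormal.comp_linearIsometry U.subtypeₗᵢ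
  have h1 : ∀ i, ∑ g, ‖(inner ℂ (τ g x) (b i : E) : ℂ)‖ ^ 2 = μ := fun i => by
    have h2 := inner_orbitOperator_self (τ := τ) x (b i : E)
    rw [Module.End.mem_eigenspace_iff.1 (hUle (b i).2), inner_smul_right,
      inner_self_eq_norm_sq_to_K, hb.1 i] at h2
    simp only [RCLike.ofReal_one, one_pow, mul_one] at h2
    exact (Complex.ofReal_injective h2).symm
  have h3 : ∀ g, ∑ i, ‖(inner ℂ (τ g x) (b i : E) : ℂ)‖ ^ 2 ≤ ‖y‖ ^ 2 := fun g => by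
    rw [← hτ g y]
    refine le_trans (le_of_eq ?_) (hb.sum_inner_products_le (τ g y) (s := Finset.univ))
    refine Finset.sum_congr rfl fun i _ => ?_
    rw [inner_map_left_of_norm hτ, hxy _ (hUinv _ _ (b i).2), ← inner_map_left_of_norm hτ,
      norm_inner_symm]
  calc (Module.finrank ℂ U : ℝ) * ∑ g, ‖(inner ℂ x (τ g x) : ℂ)‖ ^ 2
      ≤ Module.finrank ℂ U * μ := by
        gcongr
        simpa only [norm_inner_symm] using hμ
    _ = ∑ g, ∑ i, ‖(inner ℂ (τ g x) (b i : E) : ℂ)‖ ^ 2 := by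
        rw [Finset.sum_comm]
        simp [h1]
    _ ≤ ∑ g : G, ‖y‖ ^ 2 := Finset.sum_le_sum fun g _ => h3 g
    _ = _ := by simp

end OrbitOperator

end NoetherIndex

namespace NoetherIndex

section MatrixForm

variable {U : Type*} [NormedAddCommGroup U] [InnerProductSpace ℂ U] {G : Type*} [Group G] {d : ℕ}

/-- Conjugate coordinates with respect to an orthonormal basis. -/
noncomputable def conjCoord (b : OrthonormalBasis (Fin d) ℂ U) (w : U) : Fin d → ℂ :=
  fun i => inner ℂ w (b i)

/-- The inverse of `conjCoord`. -/
noncomputable def ofConjCoord (b : OrthonormalBasis (Fin d) ℂ U) (v : Fin d → ℂ) : U :=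
  ∑ j, star (v j) • b j

variable (b : OrthonormalBasis (Fin d) ℂ U)

theorem conjCoord_ofConjCoord (v : Fin d → ℂ) : conjCoord b (ofConjCoord b v) = v := by
  classical
  funext i
  simp [conjCoord, ofConjCoord, orthonormal_iff_ite.1 b.orthonormal]

theorem ofConjCoord_conjCoord (w : U) : ofConjCoord b (conjCoord b w) = w := by
  simp only [conjCoord, ofConjCoord]
  conv_rhs => rw [← b.sum_repr' w]
  refine Finset.sum_congr rfl fun i _ => ?_
  rw [Complex.star_def, inner_conj_symm]

theorem star_conjCoord_dotProduct (v w : U) :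
    star (conjCoord b v) ⬝ᵥ conjCoord b w = inner ℂ w v := by
  rw [← b.sum_inner_mul_inner w v, dotProduct]
  refine Finset.sum_congr rfl fun i _ => ?_
  rw [Pi.star_apply, conjCoord, conjCoord, Complex.star_def, inner_conj_symm, mul_comm]

theorem ofConjCoord_single (j : Fin d) : ofConjCoord b (Pi.single j 1) = b j := by
  rw [ofConjCoord, Finset.sum_eq_single j]
  · simp
  · intro i _ hij
    simp [Pi.single_eq_of_ne hij]
  · simp

/-- The matrix form, in conjugate coordinates, of a representation. -/
noncomputable def conjRep (π : Representation ℂ G U) : Representation ℂ G (Fin d → ℂ) where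
  toFun g :=
    { toFun := fun v => conjCoord b (π g (ofConjCoord b v))
      map_add' := fun v w => by
        have : ofConjCoord b (v + w) = ofConjCoord b v + ofConjCoord b w := by
          simp [ofConjCoord, add_smul, Finset.sum_add_distrib]
        funext i
        simp [this, conjCoord]
      map_smul' := fun a v => by
        have : ofConjCoord b (a • v) = star a • ofConjCoord b v := by
          simp [ofConjCoord, Finset.smul_sum, mul_smul]
        funext i
        simp [this, conjCoord, mul_comm] }
  map_one' := by
    refine LinearMap.ext fun v => ?_
    simp [conjCoord_ofConjCoord]
  map_mul' g h := by
    refine LinearMap.ext fun v => ?_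
    simp [ofConjCoord_conjCoord]

theorem conjRep_apply (π : Representation ℂ G U) (g : G) (v : Fin d → ℂ) :
    conjRep b π g v = conjCoord b (π g (ofConjCoord b v)) := rfl

theorem toMatrix'_conjRep (π : Representation ℂ G U) (g : G) (i j : Fin d) :
    LinearMap.toMatrix' (conjRep b π g) i j = inner ℂ (π g (b j)) (b i) := by
  rw [LinearMap.toMatrix'_apply, conjRep_apply, ofConjCoord_single, conjCoord]

theorem conjRep_unitary {π : Representation ℂ G U} (hπ : ∀ g v, ‖π g v‖ = ‖v‖) (g : G)
    (v w : Fin d → ℂ) : star (conjRep b π g v) ⬝ᵥ conjRep b π g w = star v ⬝ᵥ w := by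
  rw [conjRep_apply, conjRep_apply, star_conjCoord_dotProduct, inner_map_map_of_norm hπ,
    ← star_conjCoord_dotProduct b, conjCoord_ofConjCoord, conjCoord_ofConjCoord]

theorem conjRep_irreducible {π : Representation ℂ G U}
    (hπ : ∀ V : Submodule ℂ U, (∀ g, ∀ v ∈ V, π g v ∈ V) → V = ⊥ ∨ V = ⊤)
    (V : Submodule ℂ (Fin d → ℂ)) (hV : ∀ g, ∀ v ∈ V, conjRep b π g v ∈ V) : V = ⊥ ∨ V = ⊤ := by
  let W : Submodule ℂ U :=
    { carrier := {w | conjCoord b w ∈ V}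
      add_mem' := fun {v w} hv hw => by
        have : conjCoord b (v + w) = conjCoord b v + conjCoord b w := by
          funext i
          simp [conjCoord]
        rw [Set.mem_ofPred_eq, this]
        exact add_mem hv hw
      zero_mem' := by
        have : conjCoord b 0 = 0 := by
          funext i
          simp [conjCoord]
        rw [Set.mem_ofPred_eq, this]
        exact zero_mem _
      smul_mem' := fun a v hv => by
        have : conjCoord b (a • v) = star a • conjCoord b v := by
          funext i
          simp [conjCoord, mul_comm]
        rw [Set.mem_ofPred_eq, this]
        exact V.smul_mem _ hv }
  have hW : ∀ v, v ∈ V ↔ ofConjCoord b v ∈ W := fun v => by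
    change _ ↔ conjCoord b (ofConjCoord b v) ∈ V
    rw [conjCoord_ofConjCoord]
  have hinv : ∀ g, ∀ w ∈ W, π g w ∈ W := fun g w hw => by
    have := hV g _ hw
    rwa [conjRep_apply, ofConjCoord_conjCoord] at this
  rcases hπ W hinv with h | h
  · left
    rw [eq_bot_iff]
    intro v hv
    rw [hW, h, Submodule.mem_bot] at hv
    rw [Submodule.mem_bot, ← conjCoord_ofConjCoord b v, hv]
    funext i
    simp [conjCoord]
  · right
    rw [eq_top_iff]
    intro v _
    rw [hW, h]
    trivial

end MatrixForm

section Transfer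

open MvPolynomial

variable {U : Type*} [NormedAddCommGroup U] [InnerProductSpace ℂ U] {G : Type} [Group G] {d n : ℕ}
  {φ : G →* (MvPolynomial (Fin n) ℂ →ₐ[ℂ] MvPolynomial (Fin n) ℂ)} {π : Representation ℂ G U}
  {L : U →ₗ[ℂ] MvPolynomial (Fin n) ℂ} (b : OrthonormalBasis (Fin d) ℂ U)

theorem aeval_polyAct_conjRep (hπ : ∀ g v, ‖π g v‖ = ‖v‖) (hL : ∀ g v, φ g (L v) = L (π g v))
    (g : G) (p : MvPolynomial (Fin d) ℂ) :
    aeval (fun i => L (b i)) (polyAct (conjRep b π) g p) = φ g (aeval (fun i => L (b i)) p) := by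
  have h : (aeval (fun i => L (b i))).comp (polyAct (conjRep b π) g) =
      (φ g).comp (aeval fun i => L (b i)) := by
    refine MvPolynomial.algHom_ext fun i => ?_
    simp only [AlgHom.comp_apply, polyAct_apply, Representation.polySubst, aeval_X, map_sum,
      map_mul, aeval_C, hL, toMatrix'_conjRep]
    conv_rhs => rw [← b.sum_repr' (π g (b i)), map_sum]
    refine Finset.sum_congr rfl fun j _ => ?_
    rw [inner_map_left_of_norm hπ, inv_inv, map_smul, Algebra.smul_def]
  exact DFunLike.congr_fun h p

/-- If a functional killing the Hilbert ideal in degree `D` does not kill the product of `L y ^ a`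
with some form, then the matrix form of the representation has a nonzero vector at which all
invariants of small positive degree vanish. -/
theorem exists_ne_zero_eval_eq_zero {D a m : ℕ} (hπ : ∀ g v, ‖π g v‖ = ‖v‖)
    (hL : ∀ g v, φ g (L v) = L (π g v)) (hL1 : ∀ v, (L v).IsHomogeneous 1)
    {Λ : MvPolynomial (Fin n) ℂ →ₗ[ℂ] ℂ} (hΛ : ∀ f ∈ hilbSpan φ D, Λ f = 0) {y : U}
    {z : MvPolynomial (Fin n) ℂ} (hz : z.IsHomogeneous (D - a)) (haD : a ≤ D)
    (hne : Λ (L y ^ a * z) ≠ 0) (ham : d * m + 1 ≤ a) :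
    ∃ u : Fin d → ℂ, u ≠ 0 ∧ ∀ j, 1 ≤ j → j ≤ m + 1 → ∀ f : MvPolynomial (Fin d) ℂ,
      f.IsHomogeneous j → (∀ g, polyAct (conjRep b π) g f = f) → eval u f = 0 := by
  set ρ := conjRep b π with hρ
  set Ψ : MvPolynomial (Fin d) ℂ →ₐ[ℂ] MvPolynomial (Fin n) ℂ := aeval fun i => L (b i) with hΨ
  have hΨhom : ∀ {j f}, f.IsHomogeneous j → (Ψ f).IsHomogeneous j := fun {j f} hf => by
    have := hf.aeval (n := 1) (fun i => L (b i)) fun i => hL1 _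
    rwa [one_mul] at this
  by_cases hJ : ∀ u, (∀ f ∈ hilbSpan (polyAct ρ) (m + 1), eval u f = 0) → u = 0
  · exfalso
    apply hne
    have hJm : ∀ f ∈ hilbSpan (polyAct ρ) (m + 1), f.IsHomogeneous (m + 1) := fun f hf => by
      rw [← mem_homogeneousSubmodule]
      refine (Submodule.span_le.2 ?_ : hilbSpan (polyAct ρ) (m + 1) ≤ _) hf
      rintro _ ⟨i, j, q, h, hij, -, hq, hh, -, rfl⟩
      rw [SetLike.mem_coe, mem_homogeneousSubmodule, ← hij]
      exact hq.mul hh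
    set l : MvPolynomial (Fin d) ℂ := ∑ i, C (inner ℂ (b i) y) * X i with hl
    have hl1 : l.IsHomogeneous 1 := IsHomogeneous.sum _ _ _ fun j _ => isHomogeneous_C_mul_X _ _
    have hΨl : Ψ l = L y := by
      conv_rhs => rw [← b.sum_repr' y, map_sum]
      simp only [hl, map_sum, map_mul, hΨ, aeval_X, aeval_C, map_smul, Algebra.smul_def]
    have h1 : l ^ (d * m + 1) ∈ Ideal.span (hilbSpan (polyAct ρ) (m + 1) : Set _) :=
      macaulay_bound hJm hJ _ (by simpa using hl1.pow (d * m + 1))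
    have h2 : l ^ a ∈ Ideal.span {h : MvPolynomial (Fin d) ℂ | constantCoeff h = 0 ∧
        ∀ g, polyAct ρ g h = h} := by
      rw [← Nat.sub_add_cancel ham, pow_add]
      refine Ideal.mul_mem_left _ _ (Ideal.span_le.2 ?_ h1)
      intro f hf
      refine Submodule.span_induction (p := fun f _ => f ∈ Ideal.span
        {h : MvPolynomial (Fin d) ℂ | constantCoeff h = 0 ∧ ∀ g, polyAct ρ g h = h})
        ?_ (zero_mem _) (fun _ _ _ _ => add_mem) (fun c f _ hf => ?_) hf
      · rintro _ ⟨i, j, q, h, -, hj, -, hh, hinv, rfl⟩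
        refine Ideal.mul_mem_left _ _ (Ideal.subset_span ⟨?_, hinv⟩)
        rw [constantCoeff_eq]
        exact hh.coeff_eq_zero (by simp; omega)
      · rw [smul_eq_C_mul]
        exact Ideal.mul_mem_left _ _ hf
    have h3 := homogeneousComponent_mem_hilbSpan (polyAct_graded ρ) h2 a
    rw [homogeneousComponent_eq_self (by simpa using hl1.pow a)] at h3
    rw [← hΨl, ← map_pow]
    refine Submodule.span_induction (p := fun f _ => Λ (Ψ f * z) = 0) ?_ (by simp)
      (fun f g _ _ hf hg => by rw [map_add, add_mul, map_add, hf, hg, add_zero])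
      (fun c f _ hf => by rw [map_smul, smul_mul_assoc, map_smul, hf, smul_zero]) h3
    rintro _ ⟨i, j, q, h, hij, hj, hq, hh, hinv, rfl⟩
    refine hΛ _ (Submodule.subset_span ⟨D - a + i, j, z * Ψ q, Ψ h, by omega, hj,
      hz.mul (hΨhom hq), hΨhom hh, fun g => ?_, by rw [map_mul]; ring⟩)
    rw [hΨ, ← aeval_polyAct_conjRep b hπ hL, ← hρ, hinv]
  · push Not at hJ
    obtain ⟨u, hu, hu0⟩ := hJ
    refine ⟨u, hu0, fun j hj hjm f hf hinv => ?_⟩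
    obtain ⟨i, hi⟩ := Function.ne_iff.1 hu0
    have h1 := hu (X i ^ (m + 1 - j) * f) (Submodule.subset_span ⟨m + 1 - j, j, _, f, by omega, hj,
      by simpa using (isHomogeneous_X ℂ i).pow (m + 1 - j), hf, hinv, rfl⟩)
    rw [map_mul, map_pow, eval_X] at h1
    exact (mul_eq_zero.1 h1).resolve_left (pow_ne_zero _ hi)

end Transfer

end NoetherIndex

namespace NoetherIndex

section Subrep

variable {E : Type*} [NormedAddCommGroup E] [InnerProductSpace ℂ E] {G : Type*} [Group G]

/-- The restriction of a representation to an invariant subspace. -/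
noncomputable def restrictRep (τ : Representation ℂ G E) (U : Submodule ℂ E)
    (hU : ∀ g, ∀ v ∈ U, τ g v ∈ U) : Representation ℂ G U where
  toFun g := (τ g).restrict (hU g)
  map_one' := by
    refine LinearMap.ext fun v => Subtype.ext ?_
    simp
  map_mul' g h := by
    refine LinearMap.ext fun v => Subtype.ext ?_
    simp

theorem restrictRep_irreducible {τ : Representation ℂ G E} {U : Submodule ℂ E}
    (hU : ∀ g, ∀ v ∈ U, τ g v ∈ U)
    (hirr : ∀ V ≤ U, (∀ g, ∀ v ∈ V, τ g v ∈ V) → V = ⊥ ∨ V = U) (V : Submodule ℂ U)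
    (hV : ∀ g, ∀ v ∈ V, restrictRep τ U hU g v ∈ V) : V = ⊥ ∨ V = ⊤ := by
  have hinj := Submodule.map_injective_of_injective U.injective_subtype
  refine (hirr (V.map U.subtype) (Submodule.map_subtype_le _ _) ?_).imp (fun h => hinj ?_)
    fun h => hinj ?_
  · rintro g _ ⟨v, hv, rfl⟩
    exact ⟨restrictRep τ U hU g v, hV g v hv, rfl⟩
  · rw [h, Submodule.map_bot]
  · rw [h, Submodule.map_top, Submodule.range_subtype]

end Subrep

section Maximum

variable {E : Type*} [NormedAddCommGroup E] [InnerProductSpace ℂ E] [FiniteDimensional ℂ E]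
  {A : Type*} [CommRing A] [Algebra ℂ A]

theorem continuous_form (L : E →ₗ[ℂ] A) (Λ : A →ₗ[ℂ] ℂ) (k : ℕ) (a : A) :
    Continuous fun v => Λ (a * L v ^ k) := by
  induction k generalizing a with
  | zero => simpa using continuous_const
  | succ k ih =>
    let b := stdOrthonormalBasis ℂ E
    have h : (fun v => Λ (a * L v ^ (k + 1))) =
        fun v => ∑ i, (inner ℂ (b i) v : ℂ) * Λ (a * L (b i) * L v ^ k) := by
      funext v
      rw [pow_succ']
      conv_lhs => enter [2, 2, 1]; rw [← b.sum_repr' v, map_sum]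
      rw [Finset.sum_mul, Finset.mul_sum, map_sum]
      refine Finset.sum_congr rfl fun i _ => ?_
      rw [map_smul, smul_mul_assoc, mul_smul_comm, map_smul, smul_eq_mul, mul_assoc]
    rw [h]
    exact continuous_finsetSum _ fun i _ =>
      (continuous_const.inner continuous_id).mul (ih (a * L (b i)))

/-- After rescaling, a nonzero form attains its norm at a unit vector, with value `1`. -/
theorem exists_normalized {L : E →ₗ[ℂ] A} {Λ : A →ₗ[ℂ] ℂ} {D : ℕ} (hD : D ≠ 0) {y₀ : E}
    (h : Λ (L y₀ ^ D) ≠ 0) :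
    ∃ (c : ℂ) (x : E), ‖x‖ = 1 ∧ (c • Λ) (L x ^ D) = 1 ∧
      ∀ y, ‖(c • Λ) (L y ^ D)‖ ≤ ‖y‖ ^ D := by
  have hhom : ∀ (a : ℂ) (y : E), Λ (L (a • y) ^ D) = a ^ D * Λ (L y ^ D) := fun a y => by
    rw [map_smul, smul_pow, map_smul, smul_eq_mul]
  have hnorm : ∀ y : E, y ≠ 0 → ‖((‖y‖ : ℂ)⁻¹) • y‖ = 1 := fun y hy => by
    rw [norm_smul, norm_inv, Complex.norm_real, norm_norm, inv_mul_cancel₀ (norm_ne_zero_iff.2 hy)]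
  have hy0 : y₀ ≠ 0 := by
    rintro rfl
    rw [map_zero, zero_pow hD, map_zero] at h
    exact h rfl
  have hcont : Continuous fun v => ‖Λ (L v ^ D)‖ := by
    simpa using (continuous_form L Λ D 1).norm
  have := FiniteDimensional.proper ℂ E
  obtain ⟨x, hx, hmax⟩ := (isCompact_sphere (0 : E) 1).exists_isMaxOn
    ⟨_, mem_sphere_zero_iff_norm.2 (hnorm y₀ hy0)⟩ hcont.continuousOn
  rw [mem_sphere_zero_iff_norm] at hx
  have hle : ∀ y, ‖Λ (L y ^ D)‖ ≤ ‖y‖ ^ D * ‖Λ (L x ^ D)‖ := fun y => by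
    rcases eq_or_ne y 0 with rfl | hy
    · rw [map_zero, zero_pow hD, map_zero, norm_zero, norm_zero]
      positivity
    · have h1 : y = (‖y‖ : ℂ) • ((‖y‖ : ℂ)⁻¹ • y) := by
        rw [smul_inv_smul₀ (by exact_mod_cast norm_ne_zero_iff.2 hy)]
      conv_lhs => rw [h1, hhom, norm_mul, norm_pow, Complex.norm_real, norm_norm]
      gcongr
      exact hmax (mem_sphere_zero_iff_norm.2 (hnorm y hy))
  have hx0 : Λ (L x ^ D) ≠ 0 := by
    intro h0
    have := hle y₀
    rw [h0, norm_zero, mul_zero] at this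
    exact h (norm_le_zero_iff.1 this)
  refine ⟨(Λ (L x ^ D))⁻¹, x, hx, by rw [LinearMap.smul_apply, smul_eq_mul, inv_mul_cancel₀ hx0],
    fun y => ?_⟩
  rw [LinearMap.smul_apply, smul_eq_mul, norm_mul, norm_inv, inv_mul_le_iff₀ (norm_pos_iff.2 hx0),
    mul_comm]
  exact hle y

end Maximum

section Component

open Polynomial

variable {E : Type*} [NormedAddCommGroup E] [InnerProductSpace ℂ E]
  {A : Type*} [CommRing A] [Algebra ℂ A]

/-- If `x` is a normalized extremal vector and `y` is an orthogonal component of `x`, then the form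
has a nonzero mixed coefficient of large degree in `y`. -/
theorem exists_mixed_coeff_ne_zero {L : E →ₗ[ℂ] A} {Λ : A →ₗ[ℂ] ℂ} {D : ℕ} {x y : E}
    (hF : ∀ y, ‖Λ (L y ^ D)‖ ≤ ‖y‖ ^ D) (hx : ‖x‖ = 1) (hFx : Λ (L x ^ D) = 1) (hD : 1 ≤ D)
    (hxy : inner ℂ y (x - y) = (0 : ℂ)) :
    ∃ a ≤ D, (D : ℝ) * ‖y‖ ^ 2 ≤ a ∧ Λ (L y ^ a * L (x - y) ^ (D - a)) ≠ 0 := by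
  set x' := x - y with hx'
  have hxs : x = y + x' := by rw [hx', add_sub_cancel]
  set p := linePoly Λ (L y) (L x') D with hp
  have hev : ∀ z, p.eval z = Λ (L (y + z • x') ^ D) := fun z => by
    rw [hp, eval_linePoly, map_add, map_smul]
  have hpyth : ∀ z : ℂ, ‖z‖ = 1 → ‖y + z • x'‖ ^ 2 = ‖y‖ ^ 2 + ‖x'‖ ^ 2 := fun z hz => by
    have h := norm_add_sq_eq_norm_sq_add_norm_sq_of_inner_eq_zero (𝕜 := ℂ) y (z • x')
      (by rw [inner_smul_right, hxy, mul_zero])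
    rw [norm_smul, hz, one_mul] at h
    rw [pow_two, h]
    ring
  have hone : ‖y‖ ^ 2 + ‖x'‖ ^ 2 = 1 := by
    have := hpyth 1 norm_one
    rw [one_smul, ← hxs, hx] at this
    linarith
  have hp1 : p.eval 1 = 1 := by rw [hev, one_smul, ← hxs, hFx]
  have hp0 : p ≠ 0 := by
    rintro h
    rw [h] at hp1
    simp at hp1
  have hnorm : ∀ z : ℂ, ‖z‖ = 1 → ‖p.eval z‖ ≤ 1 := fun z hz => by
    rw [hev]
    refine (hF _).trans (pow_le_one₀ (norm_nonneg _) ?_)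
    have := hpyth z hz
    rw [hone] at this
    nlinarith [norm_nonneg (y + z • x')]
  have hder : p.derivative.eval 1 = D * ‖x'‖ ^ 2 := by
    have hcomp : p.comp (1 + X) = linePoly Λ (L x) (L x') D := by
      refine Polynomial.funext fun w => ?_
      rw [eval_comp, hev, eval_linePoly, ← map_smul, ← map_add]
      congr 3
      conv_rhs => rw [hxs]
      simp [add_smul, add_assoc]
    have h1 := congrArg (fun q : ℂ[X] => q.derivative.eval 0) hcomp
    simp only [derivative_comp, derivative_add, derivative_one, derivative_X, zero_add, one_mul,
      eval_comp, eval_add, eval_one, eval_X, add_zero] at h1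
    rw [← coeff_zero_eq_eval_zero, coeff_derivative, zero_add, coeff_linePoly _ _ _ hD,
      Nat.choose_one_right, pow_one, map_pow_mul_eq_inner hF hx hFx hD] at h1
    rw [h1]
    conv_lhs => rw [hxs, inner_add_left, hxy, inner_self_eq_norm_sq_to_K]
    simp
  set j := p.natTrailingDegree with hj
  have hdvd : X ^ j ∣ p := X_pow_dvd_iff.2 fun k hk => coeff_eq_zero_of_lt_natTrailingDegree hk
  have hle := le_re_derivative_eval_one hnorm hp1 hdvd
  have hcoeff : p.coeff j ≠ 0 := by
    rw [hj, ← trailingCoeff, Ne, trailingCoeff_eq_zero]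
    exact hp0
  have hder' : (p.derivative.eval 1).re = D * ‖x'‖ ^ 2 := by
    rw [hder]
    norm_cast
  rw [hder'] at hle
  have hD0 : (0 : ℝ) ≤ D := Nat.cast_nonneg D
  have hjD : j ≤ D := by
    have h1 : (D : ℝ) * ‖x'‖ ^ 2 ≤ D * 1 := by
      gcongr
      nlinarith [sq_nonneg ‖y‖]
    have : (j : ℝ) ≤ D := by linarith
    exact_mod_cast this
  rw [hp, coeff_linePoly _ _ _ hjD] at hcoeff
  refine ⟨D - j, Nat.sub_le _ _, ?_, ?_⟩
  · rw [Nat.cast_sub hjD]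
    have : (D : ℝ) * (‖y‖ ^ 2 + ‖x'‖ ^ 2) = D := by rw [hone, mul_one]
    linarith
  · rw [Nat.sub_sub_self hjD]
    exact right_ne_zero_of_mul hcoeff

end Component

section Selection

open MvPolynomial

variable {E : Type*} [NormedAddCommGroup E] [InnerProductSpace ℂ E] [FiniteDimensional ℂ E]
  {G : Type} [Group G] [Fintype G] {n : ℕ}
  {φ : G →* (MvPolynomial (Fin n) ℂ →ₐ[ℂ] MvPolynomial (Fin n) ℂ)} {τ : Representation ℂ G E}
  {L : E →ₗ[ℂ] MvPolynomial (Fin n) ℂ} {Λ : MvPolynomial (Fin n) ℂ →ₗ[ℂ] ℂ} {D : ℕ}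

theorem sum_map_pow_mul_eq_zero (hφ : GradedAct φ) (hL : ∀ g v, φ g (L v) = L (τ g v))
    (hL1 : ∀ v, (L v).IsHomogeneous 1) (hΛ : ∀ f ∈ hilbSpan φ D, Λ f = 0) (x : E) {k : ℕ}
    (hk : 1 ≤ k) (hkD : k ≤ D) : ∑ g, Λ (L x ^ (D - k) * L (τ g x) ^ k) = 0 := by
  have h1 : ∀ g, L (τ g x) ^ k = φ g (L x ^ k) := fun g => by rw [map_pow, hL]
  simp_rw [h1, ← map_sum, ← Finset.mul_sum]
  refine hΛ _ (Submodule.subset_span ⟨D - k, k, _, _, by omega, hk, ?_, ?_, fun g => act_sum g _,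
    rfl⟩)
  · simpa using (hL1 x).pow (D - k)
  · exact hφ.sum_isHomogeneous (by simpa using (hL1 x).pow k)

theorem exists_null_vector (hφ : GradedAct φ) (hτ : ∀ g v, ‖τ g v‖ = ‖v‖)
    (hL : ∀ g v, φ g (L v) = L (τ g v)) (hL1 : ∀ v, (L v).IsHomogeneous 1)
    (hΛ : ∀ f ∈ hilbSpan φ D, Λ f = 0) {y₀ : E} (hy₀ : Λ (L y₀ ^ D) ≠ 0) (hD : 20002 ≤ D) {S : ℝ}
    (hS0 : 0 < S)
    (hS : 15 / 4 * S ≤ (D + 99) / 99 - 2 - Fintype.card G * (10 ^ 4 / D : ℝ)) :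
    ∃ (d m : ℕ) (ρ : Representation ℂ G (Fin d → ℂ)) (u : Fin d → ℂ), u ≠ 0 ∧
      (∀ g v w, star (ρ g v) ⬝ᵥ ρ g w = star v ⬝ᵥ w) ∧
      (∀ V : Submodule ℂ (Fin d → ℂ), (∀ g, ∀ v ∈ V, ρ g v ∈ V) → V = ⊥ ∨ V = ⊤) ∧
      (∀ j, 1 ≤ j → j ≤ m → ∀ f : MvPolynomial (Fin d) ℂ, f.IsHomogeneous j →
        (∀ g, polyAct ρ g f = f) → eval u f = 0) ∧
      1 ≤ d ∧ d * S ≤ Fintype.card G ∧ D * S ≤ Fintype.card G * m := by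
  obtain ⟨c, x, hx, hFx, hF⟩ := exists_normalized (by omega) hy₀
  have hΛ' : ∀ f ∈ hilbSpan φ D, (c • Λ) f = 0 := fun f hf => by
    rw [LinearMap.smul_apply, hΛ f hf, smul_zero]
  generalize c • Λ = Λ' at hFx hF hΛ'
  have hsum := hS.trans (sum_norm_inner_sq_ge hF hx hFx hD hτ
    fun k hk hkD => sum_map_pow_mul_eq_zero hφ hL hL1 hΛ' x hk hkD)
  obtain ⟨U, hU0, hUinv, hUirr, y, hyU, hxy, hdim⟩ := exists_irreducible_component hτ hx
  have hSle : S ≤ ∑ g, ‖(inner ℂ x (τ g x) : ℂ)‖ ^ 2 := by linarith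
  obtain ⟨a, haD, hya, hne⟩ := exists_mixed_coeff_ne_zero hF hx hFx (by omega) (hxy y hyU)
  have hd : 1 ≤ Module.finrank ℂ U := by
    rw [Nat.one_le_iff_ne_zero, Ne, Submodule.finrank_eq_zero]
    exact hU0
  set d := Module.finrank ℂ U with hdd
  have hdS : d * S ≤ Fintype.card G * ‖y‖ ^ 2 :=
    (mul_le_mul_of_nonneg_left hSle (Nat.cast_nonneg d)).trans hdim
  have hd0 : (0 : ℝ) < d := by exact_mod_cast hd
  have hN0 : (0 : ℝ) < Fintype.card G := by exact_mod_cast Fintype.card_pos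
  have hy2 : 0 < ‖y‖ ^ 2 := by
    have : 0 < d * S := by positivity
    exact pos_of_mul_pos_right (this.trans_le hdS) hN0.le
  have hy1 : ‖y‖ ^ 2 ≤ 1 := by
    have h := norm_add_sq_eq_norm_sq_add_norm_sq_of_inner_eq_zero (𝕜 := ℂ) y (x - y) (hxy y hyU)
    rw [add_sub_cancel, hx] at h
    nlinarith [mul_self_nonneg ‖x - y‖]
  have hD0 : (0 : ℝ) < D := by exact_mod_cast (by omega : 0 < D)
  have ha : 1 ≤ a := by
    have : (0 : ℝ) < a := lt_of_lt_of_le (by positivity) hya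
    exact_mod_cast this
  have ham : d * ((a - 1) / d) + 1 ≤ a := by
    have := Nat.mul_div_le (a - 1) d
    omega
  have hma : a ≤ d * ((a - 1) / d + 1) := by
    have h1 := Nat.lt_mul_div_succ (a - 1) hd
    omega
  let b := stdOrthonormalBasis ℂ U
  have hπ : ∀ g v, ‖restrictRep τ U hUinv g v‖ = ‖v‖ := fun g v => hτ g v
  obtain ⟨u, hu0, hu⟩ := exists_ne_zero_eval_eq_zero (L := L ∘ₗ U.subtype) b hπ
    (fun g v => hL g v) (fun v => hL1 v) hΛ' (y := ⟨y, hyU⟩) (z := L (x - y) ^ (D - a))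
    (by simpa using (hL1 (x - y)).pow (D - a)) haD hne ham
  refine ⟨d, (a - 1) / d + 1, conjRep b (restrictRep τ U hUinv), u, hu0, conjRep_unitary b hπ,
    conjRep_irreducible b (restrictRep_irreducible hUinv hUirr), hu, hd, ?_, ?_⟩
  · nlinarith
  · have h1 : (a : ℝ) ≤ d * (((a - 1) / d + 1 : ℕ) : ℝ) := by exact_mod_cast hma
    refine le_of_mul_le_mul_left ?_ hd0
    calc d * (D * S) = D * (d * S) := by ring
      _ ≤ D * (Fintype.card G * ‖y‖ ^ 2) := by gcongr
      _ = Fintype.card G * (D * ‖y‖ ^ 2) := by ring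
      _ ≤ Fintype.card G * (d * (((a - 1) / d + 1 : ℕ) : ℝ)) :=
          mul_le_mul_of_nonneg_left (hya.trans h1) hN0.le
      _ = _ := by ring

end Selection

end NoetherIndex

namespace NoetherIndex

open MvPolynomial

/-- A linear form on the polynomials of degree `D` that vanishes on all powers of linear forms
is zero. -/
theorem exists_pow_ne_zero {σ : Type*} {Λ : MvPolynomial σ ℂ →ₗ[ℂ] ℂ} {D : ℕ}
    {f : MvPolynomial σ ℂ} (hf : f.IsHomogeneous D) (hΛ : Λ f ≠ 0) :
    ∃ l : MvPolynomial σ ℂ, l.IsHomogeneous 1 ∧ Λ (l ^ D) ≠ 0 := by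
  by_contra! h
  suffices H : ∀ k j, j + k = D → ∀ a : MvPolynomial σ ℂ, a.IsHomogeneous j →
      ∀ l : MvPolynomial σ ℂ, l.IsHomogeneous 1 → Λ (a * l ^ k) = 0 by
    refine hΛ ?_
    simpa using H 0 D rfl f hf 0 (isHomogeneous_zero _ _ _)
  intro k j
  induction j generalizing k with
  | zero =>
    rintro rfl a ha l hl
    obtain ⟨c, rfl⟩ : ∃ c, a = C c := by
      rw [← mem_homogeneousSubmodule, homogeneousSubmodule_zero, Submodule.mem_one] at ha
      obtain ⟨c, rfl⟩ := ha
      exact ⟨c, rfl⟩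
    rw [C_mul', map_smul, ← Nat.zero_add k, h l hl, smul_zero]
  | succ j ih =>
    intro hjk a ha l hl
    rw [← mem_homogeneousSubmodule, ← homogeneousSubmodule_one_pow, pow_succ,
      homogeneousSubmodule_one_pow] at ha
    induction ha using Submodule.mul_induction_on' with
    | mem_mul_mem a ha b hb =>
      have h0 : linePoly (Λ ∘ₗ LinearMap.mulLeft ℂ a) l b (k + 1) = 0 := by
        refine Polynomial.funext fun u => ?_
        rw [eval_linePoly, Polynomial.eval_zero]
        refine ih (k + 1) (by omega) a ha _ ?_
        rw [← mem_homogeneousSubmodule]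
        exact Submodule.add_mem _ hl (Submodule.smul_mem _ _ hb)
      have h1 := coeff_linePoly (Λ ∘ₗ LinearMap.mulLeft ℂ a) l b (D := k + 1) (k := 1) (by omega)
      rw [h0, Polynomial.coeff_zero, eq_comm, mul_eq_zero] at h1
      rcases h1 with h1 | h1
      · rw [Nat.choose_one_right, Nat.cast_eq_zero] at h1
        omega
      · rw [LinearMap.comp_apply, LinearMap.mulLeft_apply, Nat.add_sub_cancel, pow_one] at h1
        rw [mul_assoc, mul_comm b]
        exact h1
    | add a _ b _ ha hb => rw [add_mul, map_add, ha, hb, add_zero]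

section Average

variable {E ι : Type*} [AddCommGroup E] [Module ℂ E] [Fintype ι] {G : Type*} [Group G] [Fintype G]

/-- The inner product obtained by averaging over a finite group. -/
noncomputable abbrev averagedCore (b : Module.Basis ι ℂ E) (τ : Representation ℂ G E) :
    InnerProductSpace.Core ℂ E where
  inner v w := ∑ g, ∑ i, star (b.repr (τ g v) i) * b.repr (τ g w) i
  conj_inner_symm v w := by
    simp only [map_sum, map_mul, starRingEnd_apply, star_star]
    exact Finset.sum_congr rfl fun g _ => Finset.sum_congr rfl fun i _ => mul_comm _ _
  re_inner_nonneg v := by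
    rw [map_sum]
    refine Finset.sum_nonneg fun g _ => ?_
    rw [map_sum]
    refine Finset.sum_nonneg fun i _ => ?_
    rw [← starRingEnd_apply, ← Complex.normSq_eq_conj_mul_self]
    exact Complex.normSq_nonneg _
  add_left u v w := by
    simp [add_mul, Finset.sum_add_distrib]
  smul_left u v r := by
    simp [Finset.mul_sum, mul_assoc]
  definite v hv := by
    have h1 : ∑ g, ∑ i, Complex.normSq (b.repr (τ g v) i) = 0 := by
      have h2 : ((∑ g, ∑ i, Complex.normSq (b.repr (τ g v) i) : ℝ) : ℂ) = 0 := by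
        rw [← hv]
        push_cast
        exact Finset.sum_congr rfl fun g _ => Finset.sum_congr rfl fun i _ =>
          Complex.normSq_eq_conj_mul_self
      exact_mod_cast h2
    have h3 := (Finset.sum_eq_zero_iff_of_nonneg fun g _ => Finset.sum_nonneg fun i _ =>
      Complex.normSq_nonneg _).1 h1 1 (Finset.mem_univ _)
    refine b.repr.map_eq_zero_iff.1 (Finsupp.ext fun i => ?_)
    have h4 := (Finset.sum_eq_zero_iff_of_nonneg fun i _ =>
      Complex.normSq_nonneg _).1 h3 i (Finset.mem_univ _)
    rw [map_one, Module.End.one_apply] at h4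
    exact Complex.normSq_eq_zero.1 h4

theorem averagedCore_inner_map (b : Module.Basis ι ℂ E) (τ : Representation ℂ G E) (h : G)
    (v w : E) : (averagedCore b τ).inner (τ h v) (τ h w) = (averagedCore b τ).inner v w := by
  refine Fintype.sum_equiv (Equiv.mulRight h) _ _ fun g => ?_
  simp only [Equiv.coe_mulRight, map_mul, Module.End.mul_apply]

end Average

/-- The action on linear forms. -/
noncomputable def linearFormRep {σ G : Type} [Group G]
    {φ : G →* (MvPolynomial σ ℂ →ₐ[ℂ] MvPolynomial σ ℂ)} (hφ : GradedAct φ) :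
    Representation ℂ G (homogeneousSubmodule σ ℂ 1) where
  toFun g := (φ g).toLinearMap.restrict fun f hf => hφ g 1 f hf
  map_one' := by
    refine LinearMap.ext fun v => Subtype.ext ?_
    simp
  map_mul' g h := by
    refine LinearMap.ext fun v => Subtype.ext ?_
    exact DFunLike.congr_fun (map_mul φ g h) (v : MvPolynomial σ ℂ)

theorem exists_null_vector_of_lt_noetherNumber {G : Type} [Group G] [Fintype G] {D : ℕ}
    (hDG : D < noetherNumber G) (hD : 20002 ≤ D) {S : ℝ} (hS0 : 0 < S)
    (hS : 15 / 4 * S ≤ (D + 99) / 99 - 2 - Fintype.card G * (10 ^ 4 / D : ℝ)) :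
    ∃ (d m : ℕ) (ρ : Representation ℂ G (Fin d → ℂ)) (u : Fin d → ℂ), u ≠ 0 ∧
      (∀ g v w, star (ρ g v) ⬝ᵥ ρ g w = star v ⬝ᵥ w) ∧
      (∀ V : Submodule ℂ (Fin d → ℂ), (∀ g, ∀ v ∈ V, ρ g v ∈ V) → V = ⊥ ∨ V = ⊤) ∧
      (∀ j, 1 ≤ j → j ≤ m → ∀ f : MvPolynomial (Fin d) ℂ, f.IsHomogeneous j →
        (∀ g, polyAct ρ g f = f) → eval u f = 0) ∧
      1 ≤ d ∧ d * S ≤ Fintype.card G ∧ D * S ≤ Fintype.card G * m := by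
  obtain ⟨n, ρ, hρ⟩ := exists_not_le_hilbSpan hDG
  obtain ⟨f, hf, hfn⟩ := SetLike.not_le_iff_exists.1 hρ
  obtain ⟨Λ, hΛf, hΛ⟩ := Submodule.exists_le_ker_of_notMem hfn
  obtain ⟨l, hl, hlD⟩ := exists_pow_ne_zero hf hΛf
  have hφ := polyAct_graded ρ
  have hfin : FiniteDimensional ℂ (homogeneousSubmodule (Fin n) ℂ 1) :=
    Module.Finite.iff_fg.2 (homogeneousSubmodule_fg (Fin n) ℂ 1)
  let τ := linearFormRep hφ
  let core := averagedCore (Module.finBasis ℂ (homogeneousSubmodule (Fin n) ℂ 1)) τ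
  letI := core.toNormedAddCommGroup
  letI : InnerProductSpace ℂ (homogeneousSubmodule (Fin n) ℂ 1) :=
    InnerProductSpace.ofCore core.toCore
  refine exists_null_vector (E := homogeneousSubmodule (Fin n) ℂ 1) (τ := τ)
    (L := (homogeneousSubmodule (Fin n) ℂ 1).subtype) hφ (fun g v => ?_) (fun g v => rfl)
    (fun v => v.2) (fun f hf => hΛ hf) (y₀ := ⟨l, hl⟩) hlD hD hS0 hS
  exact congrArg (fun z : ℂ => √(RCLike.re z)) (averagedCore_inner_map _ τ g v v)

end NoetherIndex

namespace NoetherIndex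

open MvPolynomial

theorem exists_cyclic_index_le_of_card_eq {G : Type} [Group G] [Fintype G] {D : ℕ}
    (hDG : D < noetherNumber G) {r : ℝ} (hr : 1 ≤ r) (hcard : (Fintype.card G : ℝ) = r * D)
    (hD : 10 ^ 12 * r ^ 5 ≤ D) :
    ∃ h : G, ((Subgroup.zpowers h).index : ℝ) ≤ 256000000 * r ^ 5 := by
  have hr0 : 0 < r := by linarith
  have hr1 : r ≤ r ^ 5 := le_self_pow₀ hr (by norm_num)
  have hD1 : (10 : ℝ) ^ 12 * r ≤ D := by nlinarith
  have hD2 : (10 : ℝ) ^ 12 ≤ D := by nlinarith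
  have hD0 : (0 : ℝ) < D := by linarith [pow_pos (show (0 : ℝ) < 10 by norm_num) 12]
  have hDn : 20002 ≤ D := by
    have : (20002 : ℝ) ≤ D := by linarith
    exact_mod_cast this
  obtain ⟨d, m, ρ, u, hu0, hunit, hirr, hu, hd, hdS, hmS⟩ :=
    exists_null_vector_of_lt_noetherNumber hDG hDn (S := D / 400) (by positivity) (by
      rw [hcard, mul_assoc, mul_div_cancel₀ _ hD0.ne']
      linarith)
  rw [hcard] at hdS hmS
  have hd' : (d : ℝ) ≤ 400 * r := by
    refine le_of_mul_le_mul_right (?_ : (d : ℝ) * D ≤ 400 * r * D) hD0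
    linarith
  have hm' : (D : ℝ) ≤ 400 * r * m := by
    refine le_of_mul_le_mul_right (?_ : (D : ℝ) * D ≤ 400 * r * m * D) hD0
    linarith
  have hm : 1 ≤ m := by
    rw [Nat.one_le_iff_ne_zero]
    rintro rfl
    rw [Nat.cast_zero, mul_zero] at hm'
    linarith
  have hc : m < 4 * d * (m / (4 * d) + 1) := Nat.lt_mul_div_succ m (by omega)
  have hc' : 4 * (d * (m / (4 * d))) ≤ m := by
    rw [← mul_assoc]
    exact Nat.mul_div_le m (4 * d)
  generalize m / (4 * d) = c at hc hc'
  have hcr : (m : ℝ) ≤ 1600 * r * (c + 1) := by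
    have h1 : (m : ℝ) ≤ 4 * d * (c + 1) := by exact_mod_cast hc.le
    have h2 : (d : ℝ) * (c + 1) ≤ 400 * r * (c + 1) := by gcongr
    linarith
  have hcD : (D : ℝ) ≤ 640000 * r ^ 2 * (c + 1) := by
    have h1 : 400 * r * m ≤ 400 * r * (1600 * r * (c + 1)) := by gcongr
    linarith
  have hN : Fintype.card G < (c + 1) * (c + 1) := by
    have h1 : (D : ℝ) * D ≤ (640000 * r ^ 2 * (c + 1)) * (640000 * r ^ 2 * (c + 1)) := by gcongr
    have h2 : (r * D) * (640000 ^ 2 * r ^ 4) < D * D := by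
      have h3 : 640000 ^ 2 * r ^ 5 < D := by
        have : 0 < r ^ 5 := by positivity
        linarith
      calc _ = 640000 ^ 2 * r ^ 5 * D := by ring
        _ < D * D := by gcongr
    have h3 : (r * D) * (640000 ^ 2 * r ^ 4) < ((c + 1) * (c + 1)) * (640000 ^ 2 * r ^ 4) := by
      linarith
    have h4 : (Fintype.card G : ℝ) < (c + 1) * (c + 1) :=
      hcard ▸ lt_of_mul_lt_mul_right h3 (by positivity)
    exact_mod_cast h4
  obtain ⟨h, hh⟩ := exists_cyclic_index_le hu0 hunit hirr hu hm hc' hN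
  refine ⟨h, ?_⟩
  have hh' : ((c : ℝ) + 1) * (m + 1) * (Subgroup.zpowers h).index ≤ (r * D) ^ 2 := by
    rw [← hcard]
    exact_mod_cast hh
  set I : ℝ := ((Subgroup.zpowers h).index : ℝ)
  have hI0 : 0 ≤ I := Nat.cast_nonneg _
  refine le_of_mul_le_mul_right (?_ : I * D ^ 2 ≤ 256000000 * r ^ 5 * D ^ 2) (by positivity)
  have h1 : (D : ℝ) * D ≤ (640000 * r ^ 2 * (c + 1)) * (400 * r * (m + 1)) := by
    refine mul_le_mul hcD ?_ hD0.le (by positivity)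
    have : 0 ≤ 400 * r := by positivity
    linarith
  calc I * D ^ 2 = I * (D * D) := by ring
    _ ≤ I * ((640000 * r ^ 2 * (c + 1)) * (400 * r * (m + 1))) := by gcongr
    _ = 256000000 * r ^ 3 * ((c + 1) * (m + 1) * I) := by ring
    _ ≤ 256000000 * r ^ 3 * (r * D) ^ 2 := by gcongr
    _ = _ := by ring

theorem exists_characteristic_cyclic_index_le {G : Type} [Group G] [Finite G]
    (hG : 2.7 < noetherIndex G) :
    ∃ C : Subgroup G, C.Characteristic ∧ IsCyclic C ∧ (C.index : ℝ) ≤ noetherIndex G ^ 105 := by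
  have := Fintype.ofFinite G
  set n := noetherIndex G with hn
  have hn0 : 0 < n := by linarith
  rcases le_or_gt (Fintype.card G : ℝ) (n ^ 105) with h | h
  · refine ⟨⊥, inferInstance, inferInstance, ?_⟩
    rwa [Subgroup.index_bot, Nat.card_eq_fintype_card]
  have hβ0 : (0 : ℝ) < noetherNumber G := Nat.cast_pos.2 (noetherNumber_pos G)
  have hNβ : (Fintype.card G : ℝ) = n * noetherNumber G := by
    rw [hn, noetherIndex, div_mul_cancel₀ _ hβ0.ne', Nat.card_eq_fintype_card]
  have hβ : n ^ 104 < noetherNumber G := by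
    refine lt_of_mul_lt_mul_left (?_ : n * n ^ 104 < n * noetherNumber G) hn0.le
    rwa [← hNβ, ← pow_succ']
  have hbig : (10 : ℝ) ^ 20 * n ^ 6 ≤ n ^ 104 := by
    calc (10 : ℝ) ^ 20 * n ^ 6 ≤ 2.7 ^ 98 * n ^ 6 := by gcongr; norm_num
      _ ≤ n ^ 98 * n ^ 6 := by gcongr
      _ = n ^ 104 := by ring
  have hn6 : n ^ 5 ≤ n ^ 6 := pow_le_pow_right₀ (by linarith) (by norm_num)
  have hn5 : 1 ≤ n ^ 5 := one_le_pow₀ (by linarith)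
  obtain ⟨D, hD⟩ : ∃ D, noetherNumber G = D + 1 :=
    ⟨noetherNumber G - 1, (Nat.succ_pred_eq_of_pos (noetherNumber_pos G)).symm⟩
  have hDβ : (noetherNumber G : ℝ) = D + 1 := by rw [hD]; push_cast; ring
  have hDbig : (10 : ℝ) ^ 19 * n ^ 5 ≤ D := by linarith
  have hD0 : (0 : ℝ) < D := by linarith
  set r : ℝ := Fintype.card G / D with hr
  have hrn : r ≤ 1.3 * n := by
    rw [hr, div_le_iff₀ hD0, hNβ, hDβ]
    nlinarith
  have hr1 : 1 ≤ r := by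
    rw [hr, one_le_div hD0, hNβ, hDβ]
    nlinarith
  have hr5 : r ^ 5 ≤ 3.75 * n ^ 5 := by
    calc r ^ 5 ≤ (1.3 * n) ^ 5 := by gcongr
      _ ≤ 3.75 * n ^ 5 := by rw [mul_pow]; gcongr; norm_num
  obtain ⟨h, hh⟩ := exists_cyclic_index_le_of_card_eq (G := G) (D := D) (by omega) hr1
    (by rw [hr, div_mul_cancel₀ _ hD0.ne']) (by linarith)
  obtain ⟨C, hC, hCc, hCi⟩ := exists_characteristic_cyclic (Subgroup.zpowers h)
  refine ⟨C, hC, hCc, ?_⟩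
  have h1 : (C.index : ℝ) ≤ ((Subgroup.zpowers h).index : ℝ) ^ 4 := by exact_mod_cast hCi
  calc (C.index : ℝ) ≤ ((Subgroup.zpowers h).index : ℝ) ^ 4 := h1
    _ ≤ (10 ^ 9 * n ^ 5) ^ 4 := by gcongr; linarith
    _ = 10 ^ 36 * n ^ 20 := by ring
    _ ≤ 2.7 ^ 85 * n ^ 20 := by gcongr; norm_num
    _ ≤ n ^ 85 * n ^ 20 := by gcongr
    _ = n ^ 105 := by ring

theorem half_le_logb_logb {n : ℝ} (hn : 2.7 < n) :
    1 / 2 ≤ Real.logb 2 (Real.logb 2 n) := by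
  have h1 : 1.42 ≤ Real.logb 2 n := by
    rw [Real.le_logb_iff_rpow_le (by norm_num) (by linarith)]
    refine le_trans ?_ hn.le
    refine le_of_pow_le_pow_left₀ (n := 50) (by norm_num) (by norm_num) ?_
    rw [← Real.rpow_natCast, ← Real.rpow_mul (by norm_num)]
    have : (1.42 : ℝ) * (50 : ℕ) = (71 : ℕ) := by norm_num
    rw [this, Real.rpow_natCast]
    norm_num
  rw [Real.le_logb_iff_rpow_le (by norm_num) (by linarith), ← Real.sqrt_eq_rpow]
  exact (Real.sqrt_le_iff.2 ⟨by norm_num, by norm_num⟩).trans h1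

theorem pow_le_rpow_logb {n : ℝ} (hn : 2.7 < n) :
    n ^ 105 ≤ n ^ ((100 : ℝ) + 10 * Real.logb 2 (Real.logb 2 n)) := by
  rw [← Real.rpow_natCast]
  refine Real.rpow_le_rpow_of_exponent_le (by linarith) ?_
  have := half_le_logb_logb hn
  push_cast
  linarith

end NoetherIndex

/-- **Corollary 2.**  If `G` is a finite nonsolvable group then `n(G) > 2.7` and `G`
has a characteristic cyclic subgroup of index at most
`n(G) ^ (100 + 10 log₂ log₂ n(G))`. -/
theorem nonsolvable_group_noether_index_and_char_cyclic_subgroup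
    (G : Type) [Group G] [Finite G] (hnonsolv : ¬ IsSolvable G) :
    2.7 < noetherIndex G ∧
    ∃ C : Subgroup G, C.Characteristic ∧ IsCyclic ↥C ∧
      (C.index : ℝ) ≤
        noetherIndex G ^ ((100 : ℝ) + 10 * Real.logb 2 (Real.logb 2 (noetherIndex G))) := by
  have hG := NoetherIndex.noetherIndex_gt G hnonsolv
  obtain ⟨C, hC, hCc, hCi⟩ := NoetherIndex.exists_characteristic_cyclic_index_le hG
  exact ⟨hG, C, hC, hCc, hCi.trans (NoetherIndex.pow_le_rpow_logb hG)⟩
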